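/- For all t > 0, there exists c = c(t) such that every graph in F_t with treewidth more than c contains a subdivision of the t-by-t wall W_{t×t} as an induced subgraph. -/

import Mathlib

open SimpleGraph Set List

namespace Paper

variable {V : Type} {W : Type}

/-- The closed neighborhood `N[v]` of a vertex. -/
def closedNbhd (G : SimpleGraph V) (v : V) : Set V := insert v (G.neighborSet v)

/-- The degree of a vertex (as the number of its neighbors). -/
noncomputable def deg (G : SimpleGraph V) (v : V) : ℕ := (G.neighborSet v).ncard

/-- `G` contains `H` as an induced subgraph, i.e. some induced subgraph of `G` is
isomorphic to `H`. -/
def ContainsInduced (G : SimpleGraph V) (H : SimpleGraph W) : Prop :=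
  ∃ s : Set V, Nonempty (H ≃g G.induce s)

/-- `(A, C, B)` is a separation of `G`. -/
def IsSeparation (G : SimpleGraph V) (A C B : Set V) : Prop :=
  A ∪ C ∪ B = Set.univ ∧ Disjoint A C ∧ Disjoint A B ∧ Disjoint C B ∧
    ∀ a ∈ A, ∀ b ∈ B, ¬G.Adj a b

/-- `G` admits a star cutset. -/
def HasStarCutset (G : SimpleGraph V) : Prop :=
  ∃ A C B : Set V, IsSeparation G A C B ∧ A.Nonempty ∧ B.Nonempty ∧
    ∃ v ∈ C, C ⊆ closedNbhd G v

/-- `G` admits a clique cutset. -/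
def HasCliqueCutset (G : SimpleGraph V) : Prop :=
  ∃ A C B : Set V, IsSeparation G A C B ∧ A.Nonempty ∧ B.Nonempty ∧ G.IsClique C

/-- `D` is a connected component of `G \ X`: a maximal connected subset of `Xᶜ`. -/
def IsComponentOf (G : SimpleGraph V) (X : Set V) (D : Set V) : Prop :=
  D.Nonempty ∧ D ⊆ Xᶜ ∧ (G.induce D).Connected ∧
    ∀ D' : Set V, D ⊆ D' → D' ⊆ Xᶜ → (G.induce D').Connected → D' = D

/-- An induced path in `G` ("path" in the paper always means induced path). -/
def IsIPath (G : SimpleGraph V) {u v : V} (P : G.Walk u v) : Prop :=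
  P.IsPath ∧ P.toSubgraph.IsInduced

/-- A hole: an induced cycle of length at least four. -/
def IsHole (G : SimpleGraph V) {v : V} (c : G.Walk v v) : Prop :=
  c.IsCycle ∧ 4 ≤ c.length ∧ c.toSubgraph.IsInduced

/-- `G` is sparse: for every hole and every vertex not in it, there is an edge `ab` of the
hole containing all neighbors of the vertex in the hole. -/
def Sparse (G : SimpleGraph V) : Prop :=
  ∀ (v : V) (c : G.Walk v v), IsHole G c → ∀ x, x ∉ c.support →
    ∃ a b, c.toSubgraph.Adj a b ∧ ∀ y ∈ c.support, G.Adj x y → y = a ∨ y = b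

/-- `G` contains a pyramid (necessarily as an induced subgraph). -/
def ContainsPyramid (G : SimpleGraph V) : Prop :=
  ∃ (a b₁ b₂ b₃ : V) (P₁ : G.Walk a b₁) (P₂ : G.Walk a b₂) (P₃ : G.Walk a b₃),
    G.Adj b₁ b₂ ∧ G.Adj b₂ b₃ ∧ G.Adj b₁ b₃ ∧
    IsIPath G P₁ ∧ IsIPath G P₂ ∧ IsIPath G P₃ ∧
    1 ≤ P₁.length ∧ 1 ≤ P₂.length ∧ 1 ≤ P₃.length ∧
    ¬(P₁.length = 1 ∧ P₂.length = 1) ∧ ¬(P₁.length = 1 ∧ P₃.length = 1) ∧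
    ¬(P₂.length = 1 ∧ P₃.length = 1) ∧
    (∀ p ∈ P₁.support, p ≠ a → ∀ q ∈ P₂.support, q ≠ a →
      p ≠ q ∧ (G.Adj p q → p = b₁ ∧ q = b₂)) ∧
    (∀ p ∈ P₁.support, p ≠ a → ∀ q ∈ P₃.support, q ≠ a →
      p ≠ q ∧ (G.Adj p q → p = b₁ ∧ q = b₃)) ∧
    (∀ p ∈ P₂.support, p ≠ a → ∀ q ∈ P₃.support, q ≠ a →
      p ≠ q ∧ (G.Adj p q → p = b₂ ∧ q = b₃))

/-- `G` contains a prism (necessarily as an induced subgraph). -/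
def ContainsPrism (G : SimpleGraph V) : Prop :=
  ∃ (a₁ a₂ a₃ b₁ b₂ b₃ : V) (P₁ : G.Walk a₁ b₁) (P₂ : G.Walk a₂ b₂) (P₃ : G.Walk a₃ b₃),
    G.Adj a₁ a₂ ∧ G.Adj a₂ a₃ ∧ G.Adj a₁ a₃ ∧
    G.Adj b₁ b₂ ∧ G.Adj b₂ b₃ ∧ G.Adj b₁ b₃ ∧
    IsIPath G P₁ ∧ IsIPath G P₂ ∧ IsIPath G P₃ ∧
    1 ≤ P₁.length ∧ 1 ≤ P₂.length ∧ 1 ≤ P₃.length ∧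
    (∀ p ∈ P₁.support, ∀ q ∈ P₂.support,
      p ≠ q ∧ (G.Adj p q → (p = a₁ ∧ q = a₂) ∨ (p = b₁ ∧ q = b₂))) ∧
    (∀ p ∈ P₁.support, ∀ q ∈ P₃.support,
      p ≠ q ∧ (G.Adj p q → (p = a₁ ∧ q = a₃) ∨ (p = b₁ ∧ q = b₃))) ∧
    (∀ p ∈ P₂.support, ∀ q ∈ P₃.support,
      p ≠ q ∧ (G.Adj p q → (p = a₂ ∧ q = a₃) ∨ (p = b₂ ∧ q = b₃)))

/-- `G` is very sparse: sparse, pyramid-free and prism-free. -/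
def VerySparse (G : SimpleGraph V) : Prop :=
  Sparse G ∧ ¬ContainsPyramid G ∧ ¬ContainsPrism G

/-- `G ∈ 𝓕_t`: `G` is very sparse with no clique of size at least `t+1`. -/
def MemF (t : ℕ) (G : SimpleGraph V) : Prop :=
  VerySparse G ∧ ∀ s : Set V, G.IsClique s → s.ncard ≤ t

/-- `G` has a tree decomposition of width at most `k`. -/
def HasTreewidthAtMost (G : SimpleGraph V) (k : ℕ) : Prop :=
  ∃ (ι : Type) (T : SimpleGraph ι) (χ : ι → Finset V),
    T.IsTree ∧
    (∀ v : V, ∃ t, v ∈ χ t) ∧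
    (∀ u v : V, G.Adj u v → ∃ t, u ∈ χ t ∧ v ∈ χ t) ∧
    (∀ v : V, (T.induce {t | v ∈ χ t}).Connected) ∧
    ∀ t, (χ t).card ≤ k + 1

/-- The `n`-by-`n` wall, as a brick wall graph: `n` rows of `2n` vertices each,
with horizontal path edges in each row, and vertical edges between consecutive
rows placed alternately. -/
def Wall (n : ℕ) : SimpleGraph (Fin n × Fin (2 * n)) :=
  SimpleGraph.fromRel (fun a b =>
    (a.1 = b.1 ∧ a.2.val + 1 = b.2.val) ∨
    (a.2 = b.2 ∧ a.1.val + 1 = b.1.val ∧ (a.1.val + a.2.val) % 2 = 0))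

/-- The graph obtained from `G` by subdividing the edge `uv` once (the new vertex
is `none`). -/
def subdivideEdge (G : SimpleGraph V) (u v : V) : SimpleGraph (Option V) :=
  SimpleGraph.fromRel (fun a b =>
    (∃ x y : V, a = some x ∧ b = some y ∧ G.Adj x y ∧ ¬(x = u ∧ y = v) ∧ ¬(x = v ∧ y = u)) ∨
    (a = none ∧ (b = some u ∨ b = some v)))

/-- `IsSubdivision G H`: `G` is (isomorphic to) a graph obtained from `H` by repeatedly
subdividing edges. -/
inductive IsSubdivision : {α : Type} → SimpleGraph α → {β : Type} → SimpleGraph β → Prop where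
  | base {α β : Type} {G : SimpleGraph α} {H : SimpleGraph β} :
      Nonempty (G ≃g H) → IsSubdivision G H
  | step {α β : Type} {G : SimpleGraph α} {H : SimpleGraph β} (u v : β) :
      H.Adj u v → IsSubdivision G (subdivideEdge H u v) → IsSubdivision G H

/-- `G` contains a subdivision of the `t`-by-`t` wall as an induced subgraph. -/
def ContainsWallSubdiv (G : SimpleGraph V) (t : ℕ) : Prop :=
  ∃ (α : Type) (S : SimpleGraph α), IsSubdivision S (Wall t) ∧ ContainsInduced G S

/-- `G` contains the line graph of a subdivision of the `t`-by-`t` wall as an induced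
subgraph. -/
def ContainsLineWallSubdiv (G : SimpleGraph V) (t : ℕ) : Prop :=
  ∃ (α : Type) (S : SimpleGraph α), IsSubdivision S (Wall t) ∧
    ContainsInduced G S.lineGraph

/-- `G` is `𝓣₁`-free: no vertex has two or more neighbors in a hole not containing it. -/
def T1Free (G : SimpleGraph V) : Prop :=
  ∀ (v : V) (c : G.Walk v v), IsHole G c → ∀ x, x ∉ c.support →
    ∀ y z, y ∈ c.support → z ∈ c.support → G.Adj x y → G.Adj x z → y = z

/-- `G` is `𝓣₂`-free: no vertex has two non-adjacent neighbors in a hole not containing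
it, and `G` is pyramid-free and prism-free. -/
def T2Free (G : SimpleGraph V) : Prop :=
  (∀ (v : V) (c : G.Walk v v), IsHole G c → ∀ x, x ∉ c.support →
    ∀ y z, y ∈ c.support → z ∈ c.support → G.Adj x y → G.Adj x z → y ≠ z → G.Adj y z) ∧
  ¬ContainsPyramid G ∧ ¬ContainsPrism G

/-- The weight `w(X)` of a set of vertices. -/
noncomputable def setW (w : V → ℝ) (X : Set V) : ℝ := ∑ᶠ x ∈ X, w x

/-- `w` is a weight function on `G`: values in `[0,1]` with total weight `1`. -/
def IsWeightFn (w : V → ℝ) : Prop :=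
  (∀ v, 0 ≤ w v ∧ w v ≤ 1) ∧ setW w Set.univ = 1

/-- `X` is a `(w, c)`-balanced separator. -/
def IsBalSep (G : SimpleGraph V) (w : V → ℝ) (c : ℝ) (X : Set V) : Prop :=
  ∀ D, IsComponentOf G X D → setW w D ≤ c

/-- `(G, w)` is `d`-unbalanced: `w` is a weight function and there is no
`(w, 1/2)`-balanced separator of size at most `d`. -/
def Unbalanced (G : SimpleGraph V) (w : V → ℝ) (d : ℕ) : Prop :=
  IsWeightFn w ∧ ∀ X : Set V, X.ncard ≤ d → ¬IsBalSep G w (1 / 2 : ℝ) X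

/-- `B = B(K₁,K₂)` is the (unique) component of `G ∖ (K₁ ∪ K₂)` of weight more
than `1/2`.  Then `A(K₁,K₂) = (B ∪ K₁ ∪ K₂)ᶜ` and `S(K₁,K₂) = (A, K₁ ∪ K₂, B)` is the
canonical two-clique-separation for `{K₁, K₂}`. -/
def IsCanonicalB (G : SimpleGraph V) (w : V → ℝ) (K₁ K₂ B : Set V) : Prop :=
  IsComponentOf G (K₁ ∪ K₂) B ∧ (1 / 2 : ℝ) < setW w B

/-- The open neighborhood `N(D)` of a set of vertices. -/
def nbhdOfSet (G : SimpleGraph V) (D : Set V) : Set V :=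
  {v | v ∉ D ∧ ∃ d ∈ D, G.Adj v d}

/-- The canonical two-clique-separation `S(K₁,K₂)` (with big side `B`) is proper. -/
def ProperPair (G : SimpleGraph V) (w : V → ℝ) (K₁ K₂ B : Set V) : Prop :=
  IsCanonicalB G w K₁ K₂ B ∧
  (∃ D, IsComponentOf G (K₁ ∪ K₂) D ∧ D ⊆ (B ∪ K₁ ∪ K₂)ᶜ ∧
    K₁ ∪ K₂ ⊆ nbhdOfSet G D) ∧
  (K₁.ncard = 1 → K₂.ncard = 1 →
    ¬∃ (x y : V) (P : G.Walk x y), K₁ = {x} ∧ K₂ = {y} ∧ IsIPath G P ∧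
      {v | v ∈ P.support} = (B ∪ K₁ ∪ K₂)ᶜ ∪ K₁ ∪ K₂)

/-- The canonical two-clique-separation `S(K₁,K₂)` (with big side `B`) is active,
where `K` bounds the size of the cliques considered. -/
def ActivePair (G : SimpleGraph V) (w : V → ℝ) (K : ℕ) (K₁ K₂ B : Set V) : Prop :=
  ProperPair G w K₁ K₂ B ∧
  ∀ K₁' K₂' B' : Set V, G.IsClique K₁' → G.IsClique K₂' →
    K₁'.ncard ≤ K → K₂'.ncard ≤ K → ProperPair G w K₁' K₂' B' →
    K₁ ∪ K₂ ≠ K₁' ∪ K₂' →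
      ¬(B' ∪ K₁' ∪ K₂' ⊂ B ∪ K₁ ∪ K₂) ∧
      (B' ∪ K₁' ∪ K₂' = B ∪ K₁ ∪ K₂ → B' ⊂ B)

/-- The interiors of two paths from `a` to `b` are disjoint and anticomplete. -/
def IntDisjAnti (G : SimpleGraph V) {a b : V} (P Q : G.Walk a b) : Prop :=
  ∀ x ∈ P.support, x ≠ a → x ≠ b → ∀ y ∈ Q.support, y ≠ a → y ≠ b → x ≠ y ∧ ¬G.Adj x y

/-- `Q₁, Q₂, Q₃` form a theta (as an induced subgraph of `G`) with ends `a, b`. -/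
def ThetaCfg (G : SimpleGraph V) {a b : V} (Q₁ Q₂ Q₃ : G.Walk a b) : Prop :=
  ¬G.Adj a b ∧
  IsIPath G Q₁ ∧ IsIPath G Q₂ ∧ IsIPath G Q₃ ∧
  2 ≤ Q₁.length ∧ 2 ≤ Q₂.length ∧ 2 ≤ Q₃.length ∧
  IntDisjAnti G Q₁ Q₂ ∧ IntDisjAnti G Q₁ Q₃ ∧ IntDisjAnti G Q₂ Q₃

/-- There is a theta through the seagull `a-v-u` in `G`: a theta one of whose ends is
`a` or `u` and which contains the seagull. -/
def ThetaThroughSeagull (G : SimpleGraph V) (a v u : V) : Prop :=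
  (∃ (b : V) (Q₁ Q₂ Q₃ : G.Walk a b), ThetaCfg G Q₁ Q₂ Q₃ ∧ [a, v, u] <+: Q₁.support) ∨
  (∃ (b : V) (Q₁ Q₂ Q₃ : G.Walk u b), ThetaCfg G Q₁ Q₂ Q₃ ∧ [u, v, a] <+: Q₁.support)

/-- `a-v-u` is a heavy seagull in `G`: an induced three-vertex path whose ends both
have degree at least three. -/
def HeavySeagull (G : SimpleGraph V) (a v u : V) : Prop :=
  a ≠ u ∧ G.Adj a v ∧ G.Adj v u ∧ ¬G.Adj a u ∧ 3 ≤ deg G a ∧ 3 ≤ deg G u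

end Paper

namespace Paper
variable {V : Type} {W : Type} {G : SimpleGraph V}
theorem mLa {α : Type*} {l : List α} {a : α} (h : l.getLast? = some a) : a ∈ l := List.mem_of_getLast? h
theorem mHe {α : Type*} {l : List α} {a : α} (h : l.head? = some a) : a ∈ l := List.mem_of_head? h
theorem dsj {α : Type*} {s t : Set α} {a : α} (h : Disjoint s t) : a ∈ s → a ∉ t := fun h' => Set.disjoint_left.1 h h'
theorem mCo {α : Type*} {l : List α} {a b : α} (h : a ∈ b :: l) : a = b ∨ a ∈ l := List.mem_cons.1 h
theorem mAp {α : Type*} {l l' : List α} {a : α} (h : a ∈ l ++ l') : a ∈ l ∨ a ∈ l' := List.mem_append.1 h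

/-- reachability inside a set -/
def R (G : SimpleGraph V) (s : Set V) : V → V → Prop :=
  Relation.ReflTransGen (fun u v => G.Adj u v ∧ u ∈ s ∧ v ∈ s)
theorem R.refl {s : Set V} (a : V) : R G s a a := Relation.ReflTransGen.refl
theorem R.trans {s : Set V} {a b c : V} (h : R G s a b) (h' : R G s b c) :
    R G s a c := Relation.ReflTransGen.trans h h'
theorem R.adj {s : Set V} {a b : V} (h : G.Adj a b) (ha : a ∈ s) (hb : b ∈ s) :
    R G s a b := Relation.ReflTransGen.single ⟨h, ha, hb⟩
theorem R.symm {s : Set V} {a b : V} (h : R G s a b) : R G s b a := by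
  induction h with
  | refl => exact R.refl _
  | tail _ h ih => exact (R.adj h.1.symm h.2.2 h.2.1).trans ih
theorem R.mono {s t : Set V} {a b : V} (h : R G s a b) (hs : s ⊆ t) :
    R G t a b := by
  induction h with
  | refl => exact R.refl _
  | tail _ h ih => exact ih.trans (R.adj h.1 (hs h.2.1) (hs h.2.2))
theorem R.mem {s : Set V} {a b : V} (h : R G s a b) (ha : a ∈ s) : b ∈ s := by
  induction h with
  | refl => exact ha
  | tail _ h _ => grind
/-- a property preserved by steps inside `s` -/
theorem R.prop {s : Set V} {a b : V} (h : R G s a b) (p : V → Prop)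
    (hp : ∀ u v, G.Adj u v → u ∈ s → v ∈ s → p u → p v) (ha : p a) : p b := by
  induction h with
  | refl => exact ha
  | tail _ h ih => grind
/-- first crossing -/
theorem R.cross {s : Set V} {a b : V} (h : R G s a b) (p : V → Prop)
    (ha : p a) (hb : ¬ p b) : ∃ u v, G.Adj u v ∧ u ∈ s ∧ v ∈ s ∧ p u ∧ ¬ p v := by
  by_contra hc
  push Not at hc
  exact hb (h.prop p hc ha)
def Conn (G : SimpleGraph V) (s : Set V) : Prop := s.Nonempty ∧ ∀ a ∈ s, ∀ b ∈ s, R G s a b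
theorem Conn.of_center {s : Set V} {a : V} (ha : a ∈ s)
    (h : ∀ b ∈ s, R G s a b) : Conn G s :=
  ⟨⟨a, ha⟩, fun b hb c hc => (h b hb).symm.trans (h c hc)⟩
theorem Conn.single (a : V) : Conn G {a} :=
  Conn.of_center (mem_singleton a) (fun b hb => by rw [mem_singleton_iff.1 hb]; exact R.refl _)
theorem Conn.union {s t : Set V} (hs : Conn G s) (ht : Conn G t)
    (h : (s ∩ t).Nonempty) : Conn G (s ∪ t) := by
  obtain ⟨a, ha, hb⟩ := h
  refine Conn.of_center (a := a) (Or.inl ha) ?_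
  rintro b (h | h)
  · exact (hs.2 a ha b h).mono subset_union_left
  · exact (ht.2 a hb b h).mono subset_union_right
theorem Conn.union_adj {s t : Set V} (hs : Conn G s) (ht : Conn G t)
    {a b : V} (ha : a ∈ s) (hb : b ∈ t) (h : G.Adj a b) : Conn G (s ∪ t) := by
  refine Conn.of_center (a := a) (Or.inl ha) ?_
  rintro c (h' | h')
  · exact (hs.2 a ha c h').mono subset_union_left
  · exact (R.adj h (Or.inl ha) (Or.inr hb)).trans ((ht.2 b hb c h').mono subset_union_right)
/-- component of `a` inside `s` -/
def comp (G : SimpleGraph V) (s : Set V) (a : V) : Set V := {b | b ∈ s ∧ R G s a b}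
theorem comp_sub {s : Set V} {a : V} : comp G s a ⊆ s := fun _ h => h.1
theorem mem_comp {s : Set V} {a : V} (h : a ∈ s) : a ∈ comp G s a := ⟨h, R.refl _⟩
theorem comp_step {s : Set V} {a b c : V} (hb : b ∈ comp G s a) (hc : c ∈ s)
    (h : G.Adj b c) : c ∈ comp G s a := ⟨hc, hb.2.trans (R.adj h hb.1 hc)⟩
theorem R.in_comp {s : Set V} {a b : V} (h : R G s a b) :
    R G (comp G s a) a b := by
  induction h with
  | refl => exact R.refl _
  | tail h1 h ih => exact ih.trans (R.adj h.1 ⟨h.2.1, h1⟩ ⟨h.2.2, h1.trans (R.adj h.1 h.2.1 h.2.2)⟩)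
theorem comp_conn {s : Set V} {a : V} (h : a ∈ s) : Conn G (comp G s a) :=
  Conn.of_center (mem_comp h) (fun _ hb => hb.2.in_comp)
theorem Conn.sub_comp {s B : Set V} {a : V} (hB : Conn G B) (h : B ⊆ s)
    (ha : ∃ b ∈ B, b ∈ comp G s a) : B ⊆ comp G s a := by
  obtain ⟨b, hb, hb'⟩ := ha
  exact fun c hc => ⟨h hc, hb'.2.trans ((hB.2 b hb c hc).mono h)⟩
/-- induced paths as lists -/
def IP (G : SimpleGraph V) : List V → Prop
  | [] => True
  | a :: l => (∀ b ∈ l, a ≠ b ∧ (G.Adj a b ↔ l.head? = some b)) ∧ IP G l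
theorem IP_append {l₁ l₂ : List V} : IP G (l₁ ++ l₂) ↔ IP G l₁ ∧ IP G l₂ ∧
    ∀ a ∈ l₁, ∀ b ∈ l₂, a ≠ b ∧ (G.Adj a b ↔ l₁.getLast? = some a ∧ l₂.head? = some b) := by
  induction l₁ with
  | nil => simp [IP]
  | cons c l ih =>
    rw [List.cons_append, IP, ih, IP]
    cases l with
    | nil =>
      simp [IP]
      tauto
    | cons d l =>
      simp only [List.cons_append, List.head?_cons, List.mem_cons, List.mem_append, List.getLast?_cons_cons]
      have hl : ∀ a, (d :: l).getLast? = some a → a ∈ d :: l := fun a h => mLa h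
      grind
theorem IP_reverse {l : List V} : IP G l.reverse ↔ IP G l := by
  have key : ∀ l : List V, IP G l → IP G l.reverse := by
    intro l
    induction l with
    | nil => simp [IP]
    | cons a l ih =>
      intro h
      rw [List.reverse_cons, IP_append]
      refine ⟨ih h.2, by simp [IP], ?_⟩
      intro x hx b hb
      rw [List.mem_singleton] at hb
      rw [List.mem_reverse] at hx
      subst hb
      have := h.1 x hx
      rw [G.adj_comm]
      grind
  grind
theorem IP.nodup {l : List V} (h : IP G l) : l.Nodup := by
  induction l with
  | nil => simp
  | cons a l ih => exact List.nodup_cons.2 ⟨fun ha => (h.1 a ha).1 rfl, ih h.2⟩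
theorem IP.chain {l : List V} (h : IP G l) : l.IsChain G.Adj := by
  induction l with
  | nil => simp
  | cons a l ih =>
    cases l with
    | nil => simp
    | cons b l => exact List.isChain_cons_cons.2 ⟨((h.1 b (by simp)).2.2 (by simp)), ih h.2⟩
theorem IP.left {l₁ l₂ : List V} (h : IP G (l₁ ++ l₂)) : IP G l₁ := (IP_append.1 h).1
theorem IP.right {l₁ l₂ : List V} (h : IP G (l₁ ++ l₂)) : IP G l₂ := (IP_append.1 h).2.1
theorem split_last (p : V → Prop) {l : List V} (h : ∃ x ∈ l, p x) :
    ∃ l₁ c l₂, l = l₁ ++ c :: l₂ ∧ p c ∧ ∀ x ∈ l₂, ¬ p x := by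
  induction l with
  | nil => simp at h
  | cons a l ih =>
    by_cases h' : ∃ x ∈ l, p x
    · grind
    · push Not at h'
      obtain ⟨x, hx, hp⟩ := h
      rcases mCo hx with rfl | hx
      · exact ⟨[], x, l, rfl, hp, h'⟩
      · grind
theorem split_first (p : V → Prop) {l : List V} (h : ∃ x ∈ l, p x) :
    ∃ l₁ c l₂, l = l₁ ++ c :: l₂ ∧ p c ∧ ∀ x ∈ l₁, ¬ p x := by
  obtain ⟨l₁, c, l₂, h1, h2, h3⟩ := split_last p (l := l.reverse) (by simpa using h)
  refine ⟨l₂.reverse, c, l₁.reverse, ?_, h2, by simpa using h3⟩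
  have := congrArg List.reverse h1
  simpa using this
theorem chain_R {s : Set V} {l : List V} (h : l.IsChain G.Adj) (hs : ∀ x ∈ l, x ∈ s)
    {a b : V} (ha : l.head? = some a) (hb : b ∈ l) : R G s a b := by
  induction l generalizing a with
  | nil => simp at ha
  | cons c l ih =>
    simp at ha; subst ha
    rcases mCo hb with rfl | hb
    · exact R.refl _
    · cases l with
      | nil => simp at hb
      | cons d l =>
        rw [List.isChain_cons_cons] at h
        exact (R.adj h.1 (hs _ (by simp)) (hs _ (by simp))).trans
          (ih h.2 (fun x hx => hs x (List.mem_cons_of_mem _ hx)) (by simp) hb)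
theorem chain_conn {l : List V} (h : l.IsChain G.Adj) (hne : l ≠ []) :
    Conn G {x | x ∈ l} := by
  obtain ⟨a, l, rfl⟩ := List.exists_cons_of_ne_nil hne
  exact Conn.of_center (a := a) (by simp) (fun b hb => chain_R h (fun x hx => hx) (by simp) hb)
theorem exists_IP {s : Set V} {a b : V} (h : R G s a b) (ha : a ∈ s) :
    ∃ l, IP G l ∧ l.head? = some a ∧ l.getLast? = some b ∧ ∀ x ∈ l, x ∈ s := by
  revert ha
  induction h using Relation.ReflTransGen.head_induction_on with
  | refl => exact fun ha => ⟨[b], by simp [IP], by simp, by simp, by simpa using ha⟩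
  | head h1 h2 ih =>
    rename_i u v
    intro hu
    obtain ⟨l, h3, h4, h5, h6⟩ := ih h1.2.2
    obtain ⟨l₁, c, l₂, rfl, hc, hl⟩ := split_last (fun x => x = u ∨ G.Adj u x) (l := l)
      ⟨v, by exact mHe h4, Or.inr h1.1⟩
    have h7 := h3.right
    rcases hc with rfl | hc
    · exact ⟨c :: l₂, h7, by simp, by simpa using h5, fun x hx => h6 x (by simp at hx ⊢; tauto)⟩
    · refine ⟨u :: c :: l₂, ⟨?_, h7⟩, by simp, by simpa using h5, ?_⟩
      · intro x hx
        rcases mCo hx with rfl | hx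
        · exact ⟨hc.ne, by simpa using hc⟩
        · grind
      · grind
theorem exists_IP_sets {s : Set V} {a b : V} (h : R G s a b) (ha : a ∈ s)
    (A B : V → Prop) (hA : A a) (hB : B b) : ∃ l x y, IP G l ∧ l.head? = some x ∧
      l.getLast? = some y ∧ A x ∧ B y ∧ (∀ v ∈ l, v ∈ s) ∧ (∀ v ∈ l, A v → v = x) ∧
      ∀ v ∈ l, B v → v = y := by
  obtain ⟨l, h1, h2, h3, h4⟩ := exists_IP h ha
  obtain ⟨l₁, c, l₂, rfl, hc, hl⟩ := split_last A (l := l) ⟨a, mHe h2, hA⟩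
  obtain ⟨m₁, d, m₂, hm, hd, hl'⟩ := split_first B (l := c :: l₂)
    ⟨b, by rw [List.getLast?_append] at h3; grind, hB⟩
  have h5 := h1.right
  rw [hm, ← List.singleton_append, ← List.append_assoc] at h5
  have hx : (m₁ ++ [d]).head? = some c := by
    grind
  have hsub : ∀ v ∈ m₁ ++ [d], v ∈ c :: l₂ := fun v hv => by rw [hm]; simp at hv ⊢; tauto
  refine ⟨m₁ ++ [d], c, d, h5.left, hx, by simp, hc, hd, ?_, ?_, ?_⟩
  · grind
  · grind
  · grind

theorem R.mono_graph {G G' : SimpleGraph V} {s : Set V} {a b : V} (h : R G s a b) (hs : G ≤ G') :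
    R G' s a b := by
  induction h with
  | refl => exact R.refl _
  | tail _ h ih => exact ih.trans (R.adj (hs h.1) h.2.1 h.2.2)
theorem Conn.mono_graph {G G' : SimpleGraph V} {s : Set V} (h : Conn G s) (hs : G ≤ G') : Conn G' s :=
  ⟨h.1, fun a ha b hb => (h.2 a ha b hb).mono_graph hs⟩
def Sep (G : SimpleGraph V) (A B X : Set V) : Prop :=
  ∀ a ∈ A, ∀ b ∈ B, a ∉ X → ¬ R G Xᶜ a b
/-- `k` disjoint connected sets meeting `A` and `B` -/
def Lk (G : SimpleGraph V) (A B : Set V) (k : ℕ) : Prop :=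
  ∃ C : Fin k → Set V, (∀ i, Conn G (C i) ∧ (C i ∩ A).Nonempty ∧ (C i ∩ B).Nonempty) ∧
    ∀ i j, i ≠ j → Disjoint (C i) (C j)
theorem Sep.symm {A B X : Set V} (h : Sep G A B X) : Sep G B A X :=
  fun b hb a ha hbX hr => h a ha b hb (hr.mem hbX) hr.symm
theorem Lk.symm {A B : Set V} {k : ℕ} (h : Lk G A B k) : Lk G B A k := by
  obtain ⟨C, h1, h2⟩ := h
  exact ⟨C, fun i => ⟨(h1 i).1, (h1 i).2.2, (h1 i).2.1⟩, h2⟩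
theorem trim {C A T : Set V} (h : Conn G C) (hA : (C ∩ A).Nonempty)
    (hT : (C ∩ T).Nonempty) : ∃ C' ⊆ C, Conn G C' ∧ (C' ∩ A).Nonempty ∧
      ∃ s ∈ C', s ∈ T ∧ (∀ v ∈ C', v ∈ T → v = s) ∧ ∀ v ∈ C', v ≠ s → ∃ a ∈ A, a ∈ C' ∧ a ∉ T ∧ R G (C' \ T) a v := by
  obtain ⟨a, ha, haA⟩ := hA
  obtain ⟨b, hb, hbT⟩ := hT
  obtain ⟨l, x, y, h1, h2, h3, h4, h5, h6, h7, h8⟩ := exists_IP_sets (h.2 a ha b hb) ha (· ∈ A) (· ∈ T) haA hbT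
  have hne : l ≠ [] := by grind
  refine ⟨{x | x ∈ l}, h6, chain_conn h1.chain hne, ⟨x, mHe h2, h4⟩, y,
    mLa h3, h5, h8, ?_⟩
  intro v hv hvy
  obtain ⟨m, rfl⟩ : ∃ m, l = m ++ [y] := by
    rw [List.getLast?_eq_some_iff] at h3; exact h3
  have hvm : v ∈ m := by
    simp at hv; tauto
  have hx : m.head? = some x := by
    cases m with
    | nil => simp at hvm
    | cons c m => simpa using h2
  have hd := List.nodup_append.1 h1.nodup
  have hm : ∀ z ∈ m, z ∈ {x | x ∈ m ++ [y]} \ T := by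
    grind
  exact ⟨x, h4, (hm x (mHe hx)).1, (hm x (mHe hx)).2, chain_R h1.left.chain hm hx hvm⟩
theorem menger_bot [Finite V] (A B : Set V) (k : ℕ)
    (h : ∀ X, Sep (⊥ : SimpleGraph V) A B X → k ≤ X.ncard) : Lk (⊥ : SimpleGraph V) A B k := by
  have h1 : k ≤ (A ∩ B).ncard := by
    apply h
    intro a ha b hb haX hr
    have : a = b := hr.prop (fun v => a = v) (fun u v huv => by simp at huv) rfl
    grind
  obtain ⟨t, ht, htk⟩ := Set.exists_subset_card_eq h1
  have hc : Nat.card t = k := by simpa using htk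
  let e : t ≃ Fin k := Finite.equivFinOfCardEq hc
  refine ⟨fun i => {(e.symm i : V)}, fun i => ⟨Conn.single _, ⟨_, rfl, (ht (e.symm i).2).1⟩, ⟨_, rfl, (ht (e.symm i).2).2⟩⟩, ?_⟩
  intro i j hij
  rw [Set.disjoint_singleton]
  exact fun h => hij (e.symm.injective (Subtype.ext h))
theorem menger_step [Finite V] {G G' : SimpleGraph V} {A B S : Set V} {x y : V} {k : ℕ}
    (hG : ∀ u v, G.Adj u v → G'.Adj u v ∨ (u = x ∧ v = y) ∨ (u = y ∧ v = x))
    (hS : Sep G' A B S)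
    {b : V} (hb : b ∈ B) (hy : y ∉ S) (hyb : R G' Sᶜ y b)
    (h : ∀ X, Sep G A B X → k ≤ X.ncard) : ∀ X, Sep G' A (insert x S) X → k ≤ X.ncard := by
  intro X hX
  apply h
  intro a ha b' hb' haX hr
  have haS : a ∉ insert x S := fun h => hX a ha a h haX (R.refl _)
  have := hr.prop (fun v => v ∉ insert x S ∧ v ∉ X ∧ R G' (X ∪ insert x S)ᶜ a v) ?_ ⟨haS, haX, R.refl _⟩
  · refine hS a ha b' hb' (fun h => haS (Or.inr h)) (this.2.2.mono ?_)
    grind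
  · rintro u v huv hu hv ⟨h1, h2, h3⟩
    have hyn : u ≠ y := by
      rintro rfl
      exact hS a ha b hb (fun h => haS (Or.inr h)) ((h3.mono (by grind)).trans hyb)
    have huv' : G'.Adj u v := by
      grind
    have hvS : v ∉ insert x S := by
      intro h
      exact hX a ha v h haX ((h3.mono (by grind)).trans (R.adj huv' hu hv))
    refine ⟨hvS, hv, h3.trans (R.adj huv' ?_ ?_)⟩
    · grind
    · grind
theorem menger_join [Finite V] {G G' : SimpleGraph V} {A B S : Set V} {x y a₀ b₀ : V} {k : ℕ}
    (hle : G' ≤ G) (hxy : G.Adj x y) (hS : Sep G' A B S) (hk : S.ncard < k)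
    (ha₀ : a₀ ∈ A) (hb₀ : b₀ ∈ B) (ha₀S : a₀ ∉ S) (hx : x ∉ S) (hy : y ∉ S)
    (hax : R G' Sᶜ a₀ x) (hyb : R G' Sᶜ y b₀)
    (h1 : Lk G' A (insert x S) k) (h2 : Lk G' B (insert y S) k) : Lk G A B k := by
  obtain ⟨C, hC, hCd⟩ := h1
  obtain ⟨D, hD, hDd⟩ := h2
  choose C' hCs hCc hCA s hsC hsS hsu hsr using fun i => trim (hC i).1 (hC i).2.1 (hC i).2.2
  choose D' hDs hDc hDB t htD htS htu htr using fun i => trim (hD i).1 (hD i).2.1 (hD i).2.2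
  have hs_inj : Function.Injective s := fun i j h => by
    by_contra hij
    exact dsj (hCd i j hij) (hCs i (hsC i)) (h ▸ hCs j (hsC j))
  have ht_inj : Function.Injective t := fun i j h => by
    by_contra hij
    exact dsj (hDd i j hij) (hDs i (htD i)) (h ▸ hDs j (htD j))
  have ht_surj : ∀ v ∈ insert y S, ∃ j, t j = v := by
    have : Set.range t = insert y S := by
      apply Set.eq_of_subset_of_ncard_le
      · rintro _ ⟨j, rfl⟩; exact htS j
      · rw [← Set.image_univ, Set.ncard_image_of_injective _ ht_inj, Set.ncard_univ, Nat.card_fin]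
        have := Set.ncard_insert_le y S
        omega
      · exact Set.toFinite _
    grind
  have : ∀ i, ∃ j, (s i = x ∧ t j = y) ∨ (s i ∈ S ∧ t j = s i) := by
    intro i
    rcases hsS i with h | h
    · obtain ⟨j, hj⟩ := ht_surj y (Or.inl rfl)
      exact ⟨j, Or.inl ⟨h, hj⟩⟩
    · obtain ⟨j, hj⟩ := ht_surj (s i) (Or.inr h)
      exact ⟨j, Or.inr ⟨h, hj⟩⟩
  choose p hp using this
  have hpinj : ∀ i j, p i = p j → i = j := by
    grind
  have key : ∀ v, (v ∉ S → ∃ a ∈ A, a ∉ S ∧ R G' Sᶜ a v) → (v ∉ S → ∃ b ∈ B, R G' Sᶜ b v) → v ∈ S := by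
    intro v h3 h4
    by_contra hv
    obtain ⟨a, ha, haS, hr⟩ := h3 hv
    obtain ⟨b, hb, hr'⟩ := h4 hv
    exact hS a ha b hb haS (hr.trans hr'.symm)
  have kC : ∀ i, ∀ v ∈ C' i, v ∉ S → ∃ a ∈ A, a ∉ S ∧ R G' Sᶜ a v := by
    intro i v hv hvS
    by_cases h : v = s i
    · grind
    · obtain ⟨a, ha, _, haT, hr⟩ := hsr i v hv h
      exact ⟨a, ha, fun h => haT (Or.inr h), hr.mono (fun z hz h => hz.2 (Or.inr h))⟩
  have kD : ∀ i, ∀ v ∈ D' i, v ∉ S → ∃ a ∈ B, R G' Sᶜ a v := by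
    intro i v hv hvS
    by_cases h : v = t i
    · have : v = y := by
        rcases htS i with h' | h'
        · exact h.trans h'
        · exact absurd (h ▸ h') hvS
      exact ⟨b₀, hb₀, this ▸ hyb.symm⟩
    · obtain ⟨a, ha, _, haT, hr⟩ := htr i v hv h
      exact ⟨a, ha, hr.mono (fun z hz h => hz.2 (Or.inr h))⟩
  have kCD : ∀ i j, i ≠ j → Disjoint (C' i) (D' (p j)) := by
    grind
  refine ⟨fun i => C' i ∪ D' (p i), fun i => ⟨?_, (hCA i).mono (inter_subset_inter_left _ subset_union_left),
    (hDB (p i)).mono (inter_subset_inter_left _ subset_union_right)⟩, ?_⟩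
  · have c1 := (hCc i).mono_graph hle
    have c2 := (hDc (p i)).mono_graph hle
    rcases hp i with h | h
    · exact c1.union_adj c2 (hsC i) (htD (p i)) (by rw [h.1, h.2]; exact hxy)
    · exact c1.union c2 ⟨s i, hsC i, by rw [← h.2]; exact htD _⟩
  · intro i j hij
    have e1 := (hCd i j hij).mono (hCs i) (hCs j)
    have e2 := (hDd (p i) (p j) (fun h => hij (hpinj _ _ h))).mono (hDs _) (hDs _)
    rw [Set.disjoint_union_left, Set.disjoint_union_right, Set.disjoint_union_right]
    exact ⟨⟨e1, kCD i j hij⟩, (kCD j i hij.symm).symm, e2⟩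
theorem menger [Finite V] (G : SimpleGraph V) (A B : Set V) (k : ℕ)
    (h : ∀ X, Sep G A B X → k ≤ X.ncard) : Lk G A B k := by
  induction hn : G.edgeSet.ncard using Nat.strong_induction_on generalizing G A B with
  | _ n ih =>
  by_cases hbot : G = ⊥
  · subst hbot; exact menger_bot A B k h
  obtain ⟨u, v, huv⟩ := SimpleGraph.ne_bot_iff_exists_adj.1 hbot
  set G' := G.deleteEdges {s(u, v)} with hG'
  have hle : G' ≤ G := G.deleteEdges_le _
  have hlt : G'.edgeSet.ncard < n := by
    rw [← hn]
    apply Set.ncard_lt_ncard _ (Set.toFinite _)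
    rw [hG', SimpleGraph.edgeSet_deleteEdges]
    refine ⟨sdiff_subset, fun h => ?_⟩
    exact (h (show s(u, v) ∈ G.edgeSet from huv)).2 rfl
  have hmem : ∀ a b, G.Adj a b → G'.Adj a b ∨ s(a, b) = s(u, v) := by
    intro a b hab
    by_cases h : s(a, b) = s(u, v)
    · exact Or.inr h
    · left; rw [hG', SimpleGraph.deleteEdges_adj]; exact ⟨hab, h⟩
  by_cases hall : ∀ X, Sep G' A B X → k ≤ X.ncard
  · obtain ⟨C, h1, h2⟩ := ih _ hlt G' A B hall rfl
    exact ⟨C, fun i => ⟨(h1 i).1.mono_graph hle, (h1 i).2⟩, h2⟩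
  push Not at hall
  obtain ⟨S, hS, hSk⟩ := hall
  have hnS : ¬ Sep G A B S := fun h' => absurd (h S h') (by omega)
  unfold Sep at hnS
  push Not at hnS
  obtain ⟨a, ha, b, hb, haS, hr⟩ := hnS
  obtain ⟨x, y, hxy, hx, hy, hpx, hpy⟩ := hr.cross (fun v => R G' Sᶜ a v) (R.refl _) (hS a ha b hb haS)
  have e1 : s(x, y) = s(u, v) := by
    rcases hmem x y hxy with h | h
    · exact absurd (hpx.trans (R.adj h hx hy)) hpy
    · exact h
  obtain ⟨y', x', hxy', hx', hy', hqx, hqy⟩ := hr.symm.cross (fun v => R G' Sᶜ v b) (R.refl _)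
    (fun h => hS a ha b hb haS h)
  have e2 : s(x', y') = s(x, y) := by
    rcases hmem y' x' hxy' with h | h
    · exact absurd ((R.adj h hx' hy').symm.trans hqx) hqy
    · rw [e1, ← h]; exact Sym2.eq_swap
  have hyb : R G' Sᶜ y b := by
    rw [Sym2.eq_iff] at e2
    rcases e2 with h | h
    · rw [← h.2]; exact hqx
    · exact absurd (hpx.trans (h.2 ▸ hqx)) (hS a ha b hb haS)
  have hG : ∀ c d, G.Adj c d → G'.Adj c d ∨ (c = x ∧ d = y) ∨ (c = y ∧ d = x) := by
    grind
  have m1 := menger_step hG hS hb hy hyb h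
  have m2 := menger_step (x := y) (y := x) (fun c d hcd => by have := hG c d hcd; tauto) hS.symm ha hx hpx.symm
    (fun X hX => h X hX.symm)
  exact menger_join hle hxy hS hSk ha hb haS hx hy hpx hyb (ih _ hlt G' _ _ m1 rfl) (ih _ hlt G' _ _ m2 rfl)

def Touch (G : SimpleGraph V) (A B : Set V) : Prop := (A ∩ B).Nonempty ∨ ∃ a ∈ A, ∃ b ∈ B, G.Adj a b
theorem Conn.touch_union {A B : Set V} (hA : Conn G A) (hB : Conn G B)
    (h : Touch G A B) : Conn G (A ∪ B) := by
  rcases h with h | ⟨a, ha, b, hb, h⟩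
  · exact hA.union hB h
  · exact hA.union_adj hB ha hb h
def IsBr (G : SimpleGraph V) (ℬ : Set (Set V)) : Prop :=
  (∀ B ∈ ℬ, Conn G B) ∧ ∀ B ∈ ℬ, ∀ B' ∈ ℬ, Touch G B B'
theorem bramble_path [Finite V] {ℬ : Set (Set V)} (h : IsBr G ℬ) (hne : ℬ.Nonempty) :
    ∃ l : List V, l.IsChain G.Adj ∧ l.Nodup ∧ ∀ B ∈ ℬ, ∃ x ∈ l, x ∈ B := by
  by_contra hcon
  push Not at hcon
  let hit : List V → Set (Set V) := fun l => {B | B ∈ ℬ ∧ ∃ x ∈ l, x ∈ B}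
  have key : ∀ n : ℕ, ∃ l B y, l.IsChain G.Adj ∧ l.Nodup ∧ B ∈ ℬ ∧ l.getLast? = some y ∧ y ∈ B ∧
      (∀ x ∈ l, x ∈ B → x = y) ∧ n ≤ (hit l).ncard := by
    intro n
    induction n with
    | zero =>
      obtain ⟨B, hB⟩ := hne
      obtain ⟨y, hy⟩ := (h.1 B hB).1
      exact ⟨[y], B, y, by simp, by simp, hB, by simp, hy, by simp, by simp⟩
    | succ n ih =>
      obtain ⟨l, B, y, h1, h2, h3, h4, h5, h6, h7⟩ := ih
      obtain ⟨B', hB', hl⟩ := hcon l h1 h2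
      have hc := (h.1 B h3).touch_union (h.1 B' hB') (h.2 B h3 B' hB')
      obtain ⟨z, hz⟩ := (h.1 B' hB').1
      obtain ⟨q, x', y', q1, q2, q3, q4, q5, q6, q7, q8⟩ :=
        exists_IP_sets (hc.2 y (Or.inl h5) z (Or.inr hz)) (Or.inl h5) (· = y) (· ∈ B') rfl hz
      subst q4
      obtain ⟨q', rfl⟩ : ∃ q', q = x' :: q' := List.head?_eq_some_iff.1 q2
      have hyl := mLa h4
      have hq' : q' ≠ [] := by
        rintro rfl
        simp at q3
        grind
      have hdisj : ∀ a ∈ l, ∀ b ∈ q', a ≠ b := by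
        rintro a ha _ hb rfl
        rcases q6 a (by simp [hb]) with h | h
        · have e := h6 a ha h
          subst e
          have := q1.nodup
          simp at this
          exact this.1 hb
        · exact hl a ha h
      refine ⟨l ++ q', B', y', ?_, ?_, hB', ?_, q5, ?_, ?_⟩
      · obtain ⟨l', rfl⟩ := List.getLast?_eq_some_iff.1 h4
        have := q1.chain
        exact List.IsChain.append_overlap h1 (by simpa using this) (by simp)
      · rw [List.nodup_append]
        exact ⟨h2, (List.nodup_cons.1 q1.nodup).2, hdisj⟩
      · grind
      · grind
      · refine Nat.succ_le_of_lt (h7.trans_lt (Set.ncard_lt_ncard ?_ (Set.toFinite _)))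
        refine ⟨fun C hC => ⟨hC.1, ?_⟩, fun hsub => ?_⟩
        · obtain ⟨x, hx, hx'⟩ := hC.2
          exact ⟨x, by simp [hx], hx'⟩
        · have hy' : y' ∈ q' := by
            grind
          obtain ⟨x, hx, hx'⟩ := (hsub ⟨hB', ⟨y', by simp [hy'], q5⟩⟩ : B' ∈ hit l).2
          exact hl x hx hx'
  obtain ⟨l, B, y, h1, h2, h3, h4, h5, h6, h7⟩ := key (Nat.card (Set V) + 1)
  have := Set.ncard_le_card (hit l)
  omega
theorem bramble_cut [Finite V] (m : ℕ) (hm : 0 < m) (r : ℕ) : ∀ (l : List V) (ℬ : Set (Set V)),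
    l.IsChain G.Adj → l.Nodup → (∀ B ∈ ℬ, ∃ x ∈ l, x ∈ B) →
    (∀ X : Set V, X.ncard ≤ r * m → ∃ B ∈ ℬ, Disjoint B X) →
    ∃ P : Fin r → Set V, (∀ i, Conn G (P i) ∧ (∀ x ∈ P i, x ∈ l) ∧
      ∀ X : Set V, X.ncard < m → ∃ B ∈ ℬ, (B ∩ P i).Nonempty ∧ Disjoint B X) ∧
      ∀ i j, i ≠ j → Disjoint (P i) (P j) := by
  induction r with
  | zero => intro l ℬ _ _ _ _; exact ⟨fun i => i.elim0, fun i => i.elim0, fun i => i.elim0⟩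
  | succ r ih =>
    intro l ℬ h1 h2 h3 h4
    let good : ℕ → Prop := fun n => ∀ X : Set V, X.ncard < m → ∃ B ∈ ℬ, (∃ x ∈ l.take n, x ∈ B) ∧ Disjoint B X
    have hex : ∃ n, good n := ⟨l.length, fun X hX => by
      grind⟩
    classical
    obtain ⟨n, hn, hmin⟩ : ∃ n, good n ∧ ∀ n' < n, ¬ good n' := ⟨Nat.find hex, Nat.find_spec hex, fun _ h => Nat.find_min hex h⟩
    have hn0 : n ≠ 0 := by
      rintro rfl
      obtain ⟨B, hB, ⟨x, hx, _⟩, _⟩ := hn ∅ (by simpa using hm)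
      simp at hx
    obtain ⟨p, rfl⟩ := Nat.exists_eq_succ_of_ne_zero hn0
    have hp := hmin p (by omega)
    simp only [good] at hp
    push Not at hp
    obtain ⟨Y, hY, hYB⟩ := hp
    obtain ⟨Z, hZ, hZB⟩ : ∃ Z : Set V, Z.ncard ≤ m ∧ ∀ B ∈ ℬ, Disjoint B Z → ∀ x ∈ l.take (p + 1), x ∉ B := by
      by_cases hpl : p < l.length
      · refine ⟨insert l[p] Y, ?_, ?_⟩
        · have := Set.ncard_insert_le l[p] Y
          omega
        · intro B hB hd x hx hxB
          rw [Set.disjoint_insert_right] at hd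
          rw [List.take_add_one, List.mem_append] at hx
          grind
      · refine ⟨Y, hY.le, fun B hB hd x hx hxB => hYB B hB ⟨x, ?_, hxB⟩ hd⟩
        rw [List.take_of_length_le (by omega)] at hx ⊢
        exact hx
    have hsplit : l.take (p + 1) ++ l.drop (p + 1) = l := List.take_append_drop _ _
    have h1' := h1
    have h2' := h2
    rw [← hsplit] at h1' h2'
    rw [List.nodup_append] at h2'
    have hs1 : ∀ B ∈ {B | B ∈ ℬ ∧ Disjoint B Z}, ∃ x ∈ l.drop (p + 1), x ∈ B := by
      rintro B ⟨hB, hd⟩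
      obtain ⟨x, hx, hxB⟩ := h3 B hB
      grind
    have hs2 : ∀ X : Set V, X.ncard ≤ r * m → ∃ B ∈ {B | B ∈ ℬ ∧ Disjoint B Z}, Disjoint B X := by
      intro X hX
      obtain ⟨B, hB, hd⟩ := h4 (X ∪ Z) (by have := Set.ncard_union_le X Z; nlinarith)
      rw [Set.disjoint_union_right] at hd
      exact ⟨B, ⟨hB, hd.2⟩, hd.1⟩
    obtain ⟨P, hP, hPd⟩ := ih (l.drop (p + 1)) {B | B ∈ ℬ ∧ Disjoint B Z} h1'.right_of_append h2'.2.1 hs1 hs2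
    · refine ⟨Fin.cons {x | x ∈ l.take (p + 1)} P, ?_, ?_⟩
      · intro i
        refine Fin.cases ?_ (fun i => ?_) i
        · refine ⟨chain_conn h1'.left_of_append ?_, fun x hx => List.mem_of_mem_take hx, ?_⟩
          · intro h
            obtain ⟨B, hB, ⟨x, hx, _⟩, _⟩ := hn ∅ (by simpa using hm)
            rw [h] at hx
            simp at hx
          · intro X hX
            obtain ⟨B, hB, ⟨x, hx, hxB⟩, hd⟩ := hn X hX
            exact ⟨B, hB, ⟨x, hxB, hx⟩, hd⟩
        · rw [Fin.cons_succ]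
          refine ⟨(hP i).1, fun x hx => List.mem_of_mem_drop ((hP i).2.1 x hx), fun X hX => ?_⟩
          obtain ⟨B, hB, hb⟩ := (hP i).2.2 X hX
          exact ⟨B, hB.1, hb⟩
      · have hd : ∀ i, Disjoint {x | x ∈ l.take (p + 1)} (P i) := fun i =>
          Set.disjoint_left.2 fun x hx hx' => h2'.2.2 x hx x ((hP i).2.1 x hx') rfl
        intro i
        refine Fin.cases ?_ (fun i => ?_) i <;> intro j <;> refine Fin.cases ?_ (fun j => ?_) j
        · simp
        · intro _; exact hd j
        · intro _; exact (hd i).symm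
        · intro hij
          simp only [Fin.cons_succ]
          exact hPd i j (fun h => hij (by rw [h]))
theorem bramble_sets [Finite V] {ℬ : Set (Set V)} (h : IsBr G ℬ) (m r : ℕ) (hm : 0 < m)
    (ho : ∀ X : Set V, X.ncard ≤ r * m → ∃ B ∈ ℬ, Disjoint B X) :
    ∃ P : Fin r → Set V, (∀ i, Conn G (P i)) ∧ (∀ i j, i ≠ j → Disjoint (P i) (P j)) ∧
      ∀ i j, Lk G (P i) (P j) m := by
  obtain ⟨l, h1, h2, h3⟩ := bramble_path h (by obtain ⟨B, hB, _⟩ := ho ∅ (by simp); exact ⟨B, hB⟩)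
  obtain ⟨P, hP, hPd⟩ := bramble_cut m hm r l ℬ h1 h2 h3 ho
  refine ⟨P, fun i => (hP i).1, hPd, fun i j => menger G _ _ m fun X hX => ?_⟩
  by_contra hlt
  push Not at hlt
  obtain ⟨B, hB, ⟨x, hxB, hx⟩, hd⟩ := (hP i).2.2 X hlt
  obtain ⟨B', hB', ⟨x', hxB', hx'⟩, hd'⟩ := (hP j).2.2 X hlt
  refine hX x hx x' hx' (dsj hd hxB) ?_
  refine (((h.1 B hB).touch_union (h.1 B' hB') (h.2 B hB B' hB')).2 x (Or.inl hxB) x' (Or.inr hxB')).mono ?_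
  grind

/-- `H` is a minor of `G` -/
def Minor (G : SimpleGraph V) (H : SimpleGraph W) : Prop :=
  ∃ X : W → Set V, (∀ w, Conn G (X w)) ∧ (∀ w w', w ≠ w' → Disjoint (X w) (X w')) ∧
    ∀ w w', H.Adj w w' → ∃ u ∈ X w, ∃ v ∈ X w', G.Adj u v
def BrickRel (a b : ℕ × ℕ) : Prop :=
  (a.1 = b.1 ∧ a.2 + 1 = b.2) ∨ (a.2 = b.2 ∧ a.1 + 1 = b.1 ∧ (a.1 + a.2) % 2 = 0)
def Brick (n m : ℕ) : SimpleGraph (Fin n × Fin m) :=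
  SimpleGraph.fromRel (fun a b => BrickRel (a.1.val, a.2.val) (b.1.val, b.2.val))
structure GridL (G : SimpleGraph V) (p m : ℕ) (Y : ℕ → ℕ → Set V) (Q : ℕ → Set V) : Prop where
  yc : ∀ j < p, ∀ i < m, Conn G (Y j i)
  yd : ∀ j < p, ∀ i < m, ∀ j' < p, ∀ i' < m, (j ≠ j' ∨ i ≠ i') → Disjoint (Y j i) (Y j' i')
  ya : ∀ j < p, ∀ i, i + 1 < m → ∃ u ∈ Y j i, ∃ v ∈ Y j (i + 1), G.Adj u v
  qc : ∀ i < m, Conn G (Q i)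
  qd : ∀ i < m, ∀ i' < m, i ≠ i' → Disjoint (Q i) (Q i')
  qy : ∀ j < p, ∀ i < m, (Q i ∩ Y j i).Nonempty
  qyd : ∀ j < p, ∀ i < m, ∀ i' < m, i ≠ i' → Disjoint (Q i) (Y j i')
/-- union over an interval of indices -/
def IU (Z : ℕ → Set V) (a b : ℕ) : Set V := {v | ∃ i, a ≤ i ∧ i < b ∧ v ∈ Z i}
theorem IU_conn {Z : ℕ → Set V} {a b : ℕ} (hab : a < b)
    (h : ∀ i, a ≤ i → i < b → Conn G (Z i))
    (h' : ∀ i, a ≤ i → i + 1 < b → ∃ u ∈ Z i, ∃ v ∈ Z (i + 1), G.Adj u v) : Conn G (IU Z a b) := by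
  induction b, hab using Nat.le_induction with
  | base =>
    have : IU Z a (a + 1) = Z a := by
      ext v
      constructor
      · rintro ⟨i, h1, h2, h3⟩
        grind
      · exact fun h => ⟨a, le_rfl, by omega, h⟩
    grind
  | succ b hab ih =>
    have hab' : a < b := hab
    have e : IU Z a (b + 1) = IU Z a b ∪ Z b := by
      ext v
      constructor
      · rintro ⟨i, h1, h2, h3⟩
        by_cases hi : i = b
        · grind
        · exact Or.inl ⟨i, h1, by omega, h3⟩
      · rintro (⟨i, h1, h2, h3⟩ | h)
        · exact ⟨i, h1, by omega, h3⟩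
        · exact ⟨b, by omega, by omega, h⟩
    rw [e]
    obtain ⟨u, hu, v, hv, huv⟩ := h' (b - 1) (by omega) (by omega)
    rw [show b - 1 + 1 = b by omega] at hv
    exact (ih (fun i h1 h2 => h i h1 (by omega)) (fun i h1 h2 => h' i h1 (by omega))).union_adj
      (h b (by omega) (by omega)) ⟨b - 1, by omega, by omega, hu⟩ hv huv
theorem path_or_star {p T : ℕ} (hp : T ^ T < p) (hT : 0 < T) (Γ : SimpleGraph (Fin p)) (hΓ : ∀ a b, R Γ univ a b) :
    ∃ (a : Fin T → Fin p) (c : Fin p), Function.Injective a ∧ ∀ s s' : Fin T, s.val + 1 = s'.val →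
      Γ.Adj (a s) (a s') ∨ (Γ.Adj (a s) c ∧ Γ.Adj c (a s') ∧ ∀ r, a r ≠ c) := by
  classical
  by_cases hdeg : ∃ c, T ≤ (Γ.neighborSet c).ncard
  · obtain ⟨c, hc⟩ := hdeg
    obtain ⟨t, ht, htk⟩ := Set.exists_subset_card_eq hc
    let e : t ≃ Fin T := Finite.equivFinOfCardEq (by rw [Nat.card_coe_set_eq]; exact htk)
    refine ⟨fun i => (e.symm i : Fin p), c, fun i j h => e.symm.injective (Subtype.ext h), fun s s' _ => Or.inr ⟨?_, ?_, ?_⟩⟩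
    · exact (ht (e.symm s).2 : Γ.Adj c _).symm
    · exact (ht (e.symm s').2 : Γ.Adj c _)
    · intro r h
      have : Γ.Adj c (e.symm r : Fin p) := ht (e.symm r).2
      exact this.ne h.symm
  · push Not at hdeg
    let v0 : Fin p := ⟨0, by omega⟩
    let N : ℕ → Finset (Fin p) := fun n => Nat.rec {v0} (fun _ S => S.biUnion fun u => insert u (Finset.univ.filter (Γ.Adj u))) n
    have hNs : ∀ n v, v ∈ N (n + 1) ↔ ∃ u ∈ N n, v = u ∨ Γ.Adj u v := fun n v => by simp [N]
    have hN : ∀ n, (N n).card ≤ T ^ n := by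
      intro n
      induction n with
      | zero => simp [N]
      | succ n ih =>
        have h2 : (N (n + 1)).card ≤ (N n).card * T := Finset.card_biUnion_le_card_mul _ _ _ fun u _ => by
          have h1 := Finset.card_insert_le u (Finset.univ.filter (Γ.Adj u))
          have h3 := hdeg u
          rw [Set.ncard_eq_toFinset_card'] at h3
          have h4 : (Γ.neighborSet u).toFinset = Finset.univ.filter (Γ.Adj u) := by ext; simp
          grind
        exact h2.trans (by rw [pow_succ]; exact Nat.mul_le_mul_right _ ih)
    obtain ⟨w, hw⟩ : ∃ w, w ∉ N T := by
      by_contra h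
      push Not at h
      have : N T = Finset.univ := by ext v; simp [h v]
      have h2 := hN T
      rw [this, Finset.card_univ, Fintype.card_fin] at h2
      omega
    obtain ⟨l, h1, h2, h3, -⟩ := exists_IP (hΓ v0 w) (mem_univ _)
    have hl : ∀ n, ∀ h : n < l.length, l[n] ∈ N n := by
      intro n
      induction n with
      | zero =>
        intro h
        rw [List.head?_eq_getElem?, List.getElem?_eq_getElem h] at h2
        have : l[0] = v0 := by simpa using h2
        rw [this]; exact Finset.mem_singleton_self _
      | succ n ih =>
        intro h
        exact (hNs _ _).2 ⟨l[n], ih (by omega), Or.inr <| List.isChain_iff_getElem.1 h1.chain n h⟩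
    have hmono : ∀ m n, m ≤ n → N m ⊆ N n := fun m n h => by
      induction n, h using Nat.le_induction with
      | base => exact subset_rfl
      | succ n _ ih => grind
    have hlen : T < l.length := by
      by_contra hc
      obtain ⟨l', rfl⟩ := List.getLast?_eq_some_iff.1 h3
      simp at hc
      have := hl l'.length (by simp)
      simp at this
      exact hw (hmono _ _ (by omega) this)
    refine ⟨fun s => l[s.val]'(by omega), v0, ?_, ?_⟩
    · intro s s' h
      exact Fin.ext ((List.Nodup.getElem_inj_iff h1.nodup).1 h)
    · intro s s' h
      left
      have := List.isChain_iff_getElem.1 h1.chain s.val (by omega)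
      simpa only [← h] using this
/-- a piece of row `i` joining columns `a` and `b` -/
def Link (G : SimpleGraph V) (p : ℕ) (Y : ℕ → ℕ → Set V) (Q : ℕ → Set V) (i a b : ℕ) : Prop :=
  ∃ K ⊆ Q i, Conn G K ∧ (K ∩ Y a i).Nonempty ∧ (K ∩ Y b i).Nonempty ∧ ∀ j < p, j ≠ a → j ≠ b → Disjoint K (Y j i)
theorem Link.symm {p : ℕ} {Y : ℕ → ℕ → Set V} {Q : ℕ → Set V} {i a b : ℕ}
    (h : Link G p Y Q i a b) : Link G p Y Q i b a := by
  obtain ⟨K, h1, h2, h3, h4, h5⟩ := h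
  exact ⟨K, h1, h2, h4, h3, fun j h h' h'' => h5 j h h'' h'⟩
theorem GridL.row {p m T : ℕ} {Y : ℕ → ℕ → Set V} {Q : ℕ → Set V} (h : GridL G p m Y Q)
    (hp : T ^ T < p) (hT : 0 < T) {i : ℕ} (hi : i < m) :
    ∃ (a : Fin T → Fin p) (c : Fin p), Function.Injective a ∧ ∀ s s' : Fin T, s.val + 1 = s'.val →
      Link G p Y Q i (a s) (a s') ∨ (Link G p Y Q i (a s) c ∧ Link G p Y Q i c (a s') ∧ ∀ r, a r ≠ c) := by
  let Γ : SimpleGraph (Fin p) := ⟨fun a b => a ≠ b ∧ Link G p Y Q i a b, ⟨fun a b h => ⟨h.1.symm, h.2.symm⟩⟩, ⟨fun a h => h.1 rfl⟩⟩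
  have hΓ : ∀ a b, R Γ univ a b := by
    intro a b
    by_contra hab
    obtain ⟨x, hx, hxa⟩ := h.qy a a.2 i hi
    obtain ⟨y, hy, hyb⟩ := h.qy b b.2 i hi
    obtain ⟨l, x', y', l1, l2, l3, ⟨a', ha', hxa'⟩, ⟨b', hb', hyb'⟩, l6, l7, l8⟩ := exists_IP_sets ((h.qc i hi).2 x hx y hy) hx
      (fun v => ∃ j : Fin p, R Γ univ a j ∧ v ∈ Y j i) (fun v => ∃ j : Fin p, ¬ R Γ univ a j ∧ v ∈ Y j i)
      ⟨a, R.refl _, hxa⟩ ⟨b, hab, hyb⟩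
    apply hb'
    refine ha'.trans (R.adj ⟨?_, ?_⟩ (mem_univ _) (mem_univ _))
    · rintro rfl; exact hb' ha'
    · refine ⟨{v | v ∈ l}, l6, chain_conn l1.chain (by rintro rfl; simp at l2), ⟨x', mHe l2, hxa'⟩,
        ⟨y', mLa l3, hyb'⟩, ?_⟩
      intro j hj hja hjb
      rw [Set.disjoint_left]
      intro v hv hvj
      by_cases hr : R Γ univ a ⟨j, hj⟩
      · have := l7 v hv ⟨_, hr, hvj⟩
        subst this
        exact dsj (h.yd j hj i hi a' a'.2 i hi (Or.inl hja)) hvj hxa'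
      · have := l8 v hv ⟨_, hr, hvj⟩
        subst this
        exact dsj (h.yd j hj i hi b' b'.2 i hi (Or.inl hjb)) hvj hyb'
  obtain ⟨a, c, h1, h2⟩ := path_or_star hp hT Γ hΓ
  exact ⟨a, c, h1, fun s s' h => (h2 s s' h).imp (fun h => h.2) (fun h => ⟨h.1.2, h.2.1.2, h.2.2⟩)⟩

theorem GridL.slot {p m T : ℕ} {Y : ℕ → ℕ → Set V} {Q : ℕ → Set V} (h : GridL G p m Y Q)
    {a : Fin T → Fin p} {c : Fin p} (ha : Function.Injective a) {s s' : Fin T} {i i' : ℕ} (hi' : i' < m) (hii : i ≤ i')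
    (hl : ∀ j, j = i ∨ j = i' → Link G p Y Q j (a s) (a s') ∨ (Link G p Y Q j (a s) c ∧ Link G p Y Q j c (a s') ∧ ∀ r, a r ≠ c)) :
    ∃ K, Conn G K ∧ K ⊆ IU (fun j => Q j ∪ Y c j) i (i' + 1) ∧ (K ∩ IU (Y (a s)) i (i' + 1)).Nonempty ∧
      (K ∩ IU (Y (a s')) i (i' + 1)).Nonempty ∧ ∀ r, r ≠ s → r ≠ s' → ∀ j < m, Disjoint K (Y (a r) j) := by
  have hi : i < m := by omega
  have aux : ∀ K ⊆ Q i, ∀ r : Fin T, Disjoint K (Y (a r) i) → ∀ j < m, Disjoint K (Y (a r) j) := by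
    intro K hK r hd j hj
    by_cases hij : i = j
    · exact hij ▸ hd
    · exact (h.qyd _ (a r).2 i hi j hj hij).mono_left hK
  have aux' : ∀ K ⊆ Q i', ∀ r : Fin T, Disjoint K (Y (a r) i') → ∀ j < m, Disjoint K (Y (a r) j) := by
    intro K hK r hd j hj
    by_cases hij : i' = j
    · exact hij ▸ hd
    · exact (h.qyd _ (a r).2 i' hi' j hj hij).mono_left hK
  have hne : ∀ r r' : Fin T, r ≠ r' → (a r).val ≠ (a r').val := fun r r' h1 h2 => h1 (ha (Fin.ext h2))
  rcases hl i (Or.inl rfl) with ⟨K, h1, h2, ⟨x, h3, h3'⟩, ⟨y, h4, h4'⟩, h5⟩ | ⟨⟨K, h1, h2, ⟨x, h3, h3'⟩, ⟨y, h4, h4'⟩, h5⟩, -, hc⟩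
  · refine ⟨K, h2, fun v hv => ⟨i, le_rfl, by omega, Or.inl (h1 hv)⟩, ⟨x, h3, i, le_rfl, by omega, h3'⟩, ⟨y, h4, i, le_rfl, by omega, h4'⟩, ?_⟩
    grind
  · have hcr : ∀ r, (a r).val ≠ c.val := fun r h => hc r (Fin.ext h)
    rcases hl i' (Or.inr rfl) with ⟨K, h1, h2, ⟨x, h3, h3'⟩, ⟨y, h4, h4'⟩, h5⟩ | ⟨-, ⟨K', h1', h2', ⟨x', e3, e3'⟩, ⟨y', e4, e4'⟩, h5'⟩, -⟩
    · refine ⟨K, h2, fun v hv => ⟨i', hii, by omega, Or.inl (h1 hv)⟩, ⟨x, h3, i', hii, by omega, h3'⟩, ⟨y, h4, i', hii, by omega, h4'⟩, ?_⟩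
      intro r hr hr'
      exact aux' K h1 r (h5 _ (a r).2 (hne _ _ hr) (hne _ _ hr'))
    have hZ : Conn G (IU (Y c) i (i' + 1)) := IU_conn (by omega) (fun j _ _ => h.yc c c.2 j (by omega))
      (fun j _ _ => h.ya c c.2 j (by omega))
    have c1 := (h2.union hZ ⟨y, h4, i, le_rfl, by omega, h4'⟩).union h2' ⟨x', Or.inr ⟨i', hii, by omega, e3'⟩, e3⟩
    refine ⟨_, c1, ?_, ⟨x, Or.inl (Or.inl h3), i, le_rfl, by omega, h3'⟩, ⟨y', Or.inr e4, i', hii, by omega, e4'⟩, ?_⟩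
    · rintro v ((hv | ⟨j, hj1, hj2, hv⟩) | hv)
      · exact ⟨i, le_rfl, by omega, Or.inl (h1 hv)⟩
      · exact ⟨j, hj1, hj2, Or.inr hv⟩
      · exact ⟨i', hii, by omega, Or.inl (h1' hv)⟩
    · intro r hr hr' j hj
      rw [Set.disjoint_union_left, Set.disjoint_union_left]
      refine ⟨⟨aux K h1 r (h5 _ (a r).2 (hne _ _ hr) (hcr r)) j hj, ?_⟩, aux' K' h1' r (h5' _ (a r).2 (hcr r) (hne _ _ hr')) j hj⟩
      rw [Set.disjoint_left]
      rintro v ⟨j', _, hj', hv⟩ hv'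
      exact dsj (h.yd c c.2 j' (by omega) (a r) (a r).2 j hj (Or.inl (hcr r).symm)) hv hv'
theorem brick_of {p m n w : ℕ} {Y : ℕ → ℕ → Set V} {Q : ℕ → Set V} (h : GridL G p m Y Q)
    {a : Fin n → Fin p} {c : Fin p} (ha : Function.Injective a) (ρ : ℕ → ℕ)
    (hρ : ∀ q q', q < q' → q' ≤ 2 * (w * n) → ρ q < ρ q') (hρm : ρ (2 * (w * n)) < m)
    (hl : ∀ q ≤ 2 * (w * n), ∀ s s' : Fin n, s.val + 1 = s'.val → Link G p Y Q (ρ q) (a s) (a s') ∨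
      (Link G p Y Q (ρ q) (a s) c ∧ Link G p Y Q (ρ q) c (a s') ∧ ∀ r, a r ≠ c)) :
    Minor G (Brick n w) := by
  have hρ' : ∀ q q', q ≤ q' → q' ≤ 2 * (w * n) → ρ q ≤ ρ q' := fun q q' h h' => by
    rcases h.lt_or_eq with h | h
    · grind
    · rw [h]
  have hm : ∀ q ≤ 2 * (w * n), ρ q < m := fun q hq => (hρ' _ _ hq le_rfl).trans_lt hρm
  have hdm : ∀ i < m, ∀ i' < m, i ≠ i' → Disjoint (Q i ∪ Y c i) (Q i' ∪ Y c i') := by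
    intro i hi i' hi' hne
    rw [Set.disjoint_union_left, Set.disjoint_union_right, Set.disjoint_union_right]
    exact ⟨⟨h.qd _ hi _ hi' hne, h.qyd _ c.2 _ hi _ hi' hne⟩, (h.qyd _ c.2 _ hi' _ hi hne.symm).symm,
      h.yd _ c.2 _ hi _ c.2 _ hi' (Or.inr hne)⟩
  let D : Fin n → ℕ → Set V := fun r b => IU (Y (a r)) (ρ (2 * (b * n))) (ρ (2 * ((b + 1) * n)))
  have hbn : ∀ b < w, (b + 1) * n ≤ w * n := fun b hb => Nat.mul_le_mul_right _ hb
  have hbn' : ∀ b, (b + 1) * n = b * n + n := fun b => by ring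
  have hDc : ∀ r : Fin n, ∀ b < w, Conn G (D r b) := by
    intro r b hb
    have := hbn b hb
    have := hbn' b
    have := r.2
    have := hm (2 * ((b + 1) * n)) (by omega)
    exact IU_conn (hρ _ _ (by omega) (by omega)) (fun i _ _ => h.yc _ (a r).2 _ (by omega))
      (fun i _ _ => h.ya _ (a r).2 _ (by omega))
  have hDd : ∀ r r' : Fin n, ∀ b < w, ∀ b' < w, (r ≠ r' ∨ b ≠ b') → Disjoint (D r b) (D r' b') := by
    intro r r' b hb b' hb' hne
    rw [Set.disjoint_left]
    rintro v ⟨i, i1, i2, hv⟩ ⟨i', i1', i2', hv'⟩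
    have h1 := hm (2 * ((b + 1) * n)) (by have := hbn b hb; omega)
    have h2 := hm (2 * ((b' + 1) * n)) (by have := hbn b' hb'; omega)
    refine dsj (h.yd _ (a r).2 i (by omega) _ (a r').2 i' (by omega) ?_) hv hv'
    by_contra hcon
    push Not at hcon
    obtain ⟨e1, rfl⟩ := hcon
    have e2 : r = r' := ha (Fin.ext e1)
    have hbb : b ≠ b' := by tauto
    rcases Nat.lt_or_gt_of_ne hbb with hlt | hlt
    · have := Nat.mul_le_mul_right n (Nat.succ_le_of_lt hlt)
      have := hbn b' hb'
      have := hbn' b'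
      have := hρ' (2 * ((b + 1) * n)) (2 * (b' * n)) (by simp only [Nat.succ_eq_add_one] at *; omega) (by omega)
      omega
    · have := Nat.mul_le_mul_right n (Nat.succ_le_of_lt hlt)
      have := hbn b hb
      have := hbn' b
      have := hρ' (2 * ((b' + 1) * n)) (2 * (b * n)) (by simp only [Nat.succ_eq_add_one] at *; omega) (by omega)
      omega
  have hE : ∀ (r : Fin n) (b : ℕ), ∃ E : Set V, (E ⊆ IU (fun j => Q j ∪ Y c j) (ρ (2 * (b * n + r))) (ρ (2 * (b * n + r) + 1) + 1)) ∧
      (∀ hr : r.val + 1 < n, b < w → (Conn G (D r b ∪ E)) ∧ (∃ u ∈ D r b ∪ E, ∃ v ∈ D ⟨r + 1, hr⟩ b, G.Adj u v) ∧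
        ∀ r' : Fin n, r ≠ r' → ∀ b' < w, Disjoint E (D r' b')) := by
    intro r b
    by_cases hrb : r.val + 1 < n ∧ b < w
    swap
    · exact ⟨∅, by simp, fun h1 h2 => absurd ⟨h1, h2⟩ hrb⟩
    obtain ⟨hr, hb⟩ := hrb
    have t1 := hbn b hb
    have t2 := hbn' b
    have t3 : ρ (2 * (b * n)) ≤ ρ (2 * (b * n + r)) := hρ' _ _ (by omega) (by omega)
    have t4 : ρ (2 * (b * n + r) + 1) < ρ (2 * ((b + 1) * n)) := hρ _ _ (by omega) (by omega)
    have t5 := hm (2 * ((b + 1) * n)) (by omega)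
    obtain ⟨K, k1, k2, ⟨x, k3, k3'⟩, ⟨y, k4, k4'⟩, k5⟩ := h.slot ha (s := r) (s' := ⟨r + 1, hr⟩) (c := c) (i := ρ (2 * (b * n + r)))
      (i' := ρ (2 * (b * n + r) + 1)) (hm _ (by omega)) (hρ' _ _ (by omega) (by omega))
      (fun j hj => by rcases hj with rfl | rfl <;> exact hl _ (by omega) _ _ rfl)
    have hz : ∀ r', IU (Y (a r')) (ρ (2 * (b * n + r))) (ρ (2 * (b * n + r) + 1) + 1) ⊆ D r' b := by
      rintro r' v ⟨i, i1, i2, hv⟩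
      exact ⟨i, by omega, by omega, hv⟩
    obtain ⟨l, x', y', l1, l2, l3, l4, l5, l6, l7, l8⟩ := exists_IP_sets (k1.2 x k3 y k4) k3 (· ∈ D r b) (· ∈ D ⟨r + 1, hr⟩ b)
      (hz _ k3') (hz _ k4')
    obtain ⟨l', rfl⟩ := List.getLast?_eq_some_iff.1 l3
    have hrr : r ≠ ⟨r + 1, hr⟩ := fun h => by have := congrArg Fin.val h; simp at this
    have hl' : l' ≠ [] := by
      rintro rfl
      simp at l2
      subst l2
      exact dsj (hDd r _ b hb b hb (Or.inl hrr)) l4 l5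
    have hx' : l'.head? = some x' := by
      cases l' with
      | nil => simp at hl'
      | cons d l' => simpa using l2
    refine ⟨{v | v ∈ l'}, fun v hv => k2 (l6 v (by simp at hv; simp [hv])), fun _ _ => ⟨?_, ?_, ?_⟩⟩
    · exact (hDc r b hb).union (chain_conn l1.left.chain hl') ⟨x', l4, mHe hx'⟩
    · obtain ⟨u, l'', hu⟩ := List.eq_nil_or_concat' l' |>.resolve_left hl'
      refine ⟨l'', Or.inr (by simp [hu]), y', l5, ?_⟩
      have l1' := l1
      rw [hu, List.append_assoc] at l1'
      simpa using l1'.right.chain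
    · intro r' hr' b' hb'
      rw [Set.disjoint_left]
      intro v hv hv'
      have hv1 : v ∈ l' ++ [y'] := List.mem_append_left _ hv
      by_cases e : r' = ⟨r + 1, hr⟩
      · subst e
        have hvU := k2 (l6 v hv1)
        obtain ⟨j, j1, j2, hvj⟩ := hvU
        obtain ⟨j', j1', j2', hvj'⟩ := hv'
        have t6 := hm (2 * ((b' + 1) * n)) (by have := hbn b' hb'; omega)
        by_cases hbb : b = b'
        · subst hbb
          have := l8 v hv1 ⟨j', j1', j2', hvj'⟩
          subst this
          exact (List.nodup_append.1 l1.nodup).2.2 v hv v (by simp) rfl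
        · have hjj : j ≠ j' := by
            rintro rfl
            have w1 := hbn' b'
            have w2 := hbn b' hb'
            rcases Nat.lt_or_gt_of_ne hbb with hlt | hlt
            · have := Nat.mul_le_mul_right n (Nat.succ_le_of_lt hlt)
              have := hρ' (2 * ((b + 1) * n)) (2 * (b' * n)) (by simp only [Nat.succ_eq_add_one] at *; omega) (by omega)
              omega
            · have := Nat.mul_le_mul_right n (Nat.succ_le_of_lt hlt)
              have := hρ' (2 * ((b' + 1) * n)) (2 * (b * n)) (by simp only [Nat.succ_eq_add_one] at *; omega) (by omega)
              omega
          rcases hvj with hvj | hvj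
          · exact dsj (h.qyd _ (a _).2 j (by omega) j' (by omega) hjj) hvj hvj'
          · exact dsj (h.yd _ c.2 j (by omega) _ (a _).2 j' (by omega) (Or.inr hjj)) hvj hvj'
      · obtain ⟨j', j1', j2', hvj'⟩ := hv'
        have t6 := hm (2 * ((b' + 1) * n)) (by have := hbn b' hb'; omega)
        exact dsj (k5 r' hr'.symm e j' (by omega)) (l6 v hv1) hvj'
  choose E hE1 hE2 using hE
  classical
  let F : Fin n → ℕ → Set V := fun r b => if r.val + 1 < n ∧ (r.val + b) % 2 = 0 then E r b else ∅
  have hFE : ∀ r b, F r b ⊆ E r b := fun r b => by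
    simp only [F]; split_ifs <;> simp
  have hFd : ∀ r r' : Fin n, ∀ b < w, ∀ b' < w, (r ≠ r' ∨ b ≠ b') → Disjoint (F r b) (F r' b') := by
    intro r r' b hb b' hb' hne
    rw [Set.disjoint_left]
    intro v hv hv'
    obtain ⟨j, j1, j2, hv⟩ := hE1 _ _ (hFE _ _ hv)
    obtain ⟨j', j1', j2', hv'⟩ := hE1 _ _ (hFE _ _ hv')
    have q1 : b * n + r < w * n := by have := hbn b hb; have := hbn' b; omega
    have q2 : b' * n + r' < w * n := by have := hbn b' hb'; have := hbn' b'; omega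
    have m1 := hm (2 * (b * n + r) + 1) (by omega)
    have m2 := hm (2 * (b' * n + r') + 1) (by omega)
    have hjj : j = j' := by
      by_contra hjj
      exact dsj (hdm j (by omega) j' (by omega) hjj) hv hv'
    subst hjj
    have hq : b * n + r = b' * n + r' := by
      by_contra hq
      rcases Nat.lt_or_gt_of_ne hq with hlt | hlt
      · have := hρ (2 * (b * n + r) + 1) (2 * (b' * n + r')) (by omega) (by omega)
        omega
      · have := hρ (2 * (b' * n + r') + 1) (2 * (b * n + r)) (by omega) (by omega)
        omega
    have hb2 : b = b' := by
      have e1 : (r.val + n * b) / n = b := by rw [Nat.add_mul_div_left _ _ (by omega), Nat.div_eq_of_lt r.2]; simp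
      have e2 : (r'.val + n * b') / n = b' := by rw [Nat.add_mul_div_left _ _ (by omega), Nat.div_eq_of_lt r'.2]; simp
      rw [← e1, ← e2]; congr 1; rw [mul_comm n b, mul_comm n b']; omega
    subst hb2
    have : r = r' := Fin.ext (by omega)
    tauto
  have hFD : ∀ r r' : Fin n, r ≠ r' → ∀ b < w, ∀ b' < w, Disjoint (F r b) (D r' b') := by
    intro r r' hne b hb b' hb'
    simp only [F]
    split_ifs with hc
    · exact (hE2 r b hc.1 hb).2.2 r' hne b' hb'
    · simp
  have hFD2 : ∀ r : Fin n, ∀ b < w, ∀ b' < w, b ≠ b' → Disjoint (F r b) (D r b') := by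
    intro r b hb b' hb' hne
    rw [Set.disjoint_left]
    intro v hv hv'
    obtain ⟨j, j1, j2, hvj⟩ := hE1 _ _ (hFE _ _ hv)
    obtain ⟨j', j1', j2', hvj'⟩ := hv'
    have w1 := hbn' b'
    have w2 := hbn b' hb'
    have w3 := hbn' b
    have w4 := hbn b hb
    have w5 := r.2
    have m1 := hm (2 * (b * n + r) + 1) (by omega)
    have t6 := hm (2 * ((b' + 1) * n)) (by omega)
    have t7 := hρ (2 * (b * n + r) + 1) (2 * ((b + 1) * n)) (by omega) (by omega)
    have t8 := hρ' (2 * (b * n)) (2 * (b * n + r)) (by omega) (by omega)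
    have hjj : j ≠ j' := by
      rintro rfl
      rcases Nat.lt_or_gt_of_ne hne with hlt | hlt
      · have := Nat.mul_le_mul_right n (Nat.succ_le_of_lt hlt)
        have := hρ' (2 * ((b + 1) * n)) (2 * (b' * n)) (by simp only [Nat.succ_eq_add_one] at *; omega) (by omega)
        omega
      · have := Nat.mul_le_mul_right n (Nat.succ_le_of_lt hlt)
        have := hρ' (2 * ((b' + 1) * n)) (2 * (b * n)) (by simp only [Nat.succ_eq_add_one] at *; omega) (by omega)
        omega
    rcases hvj with hvj | hvj
    · exact dsj (h.qyd _ (a _).2 j (by omega) j' (by omega) hjj) hvj hvj'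
    · exact dsj (h.yd _ c.2 j (by omega) _ (a _).2 j' (by omega) (Or.inr hjj)) hvj hvj'
  have hadj : ∀ x y : Fin n × Fin w, BrickRel (x.1.val, x.2.val) (y.1.val, y.2.val) →
      ∃ u ∈ D x.1 x.2 ∪ F x.1 x.2, ∃ v ∈ D y.1 y.2 ∪ F y.1 y.2, G.Adj u v := by
    rintro ⟨r, b⟩ ⟨r', b'⟩ (⟨h1, h2⟩ | ⟨h1, h2, h3⟩)
    · simp only at h1 h2
      have : r' = r := Fin.ext h1.symm
      subst this
      have w1 := hbn' b
      have w2 := hbn b b.2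
      have w3 := hbn b' b'.2
      have w4 := hbn' b'
      have w5 := r'.2
      have e1 : (b : ℕ) * n + n = b' * n := by rw [← hbn', h2]
      have t0 := hρ (2 * (b * n)) (2 * (b' * n)) (by omega) (by omega)
      have t1 := hρ (2 * (b' * n)) (2 * ((b' + 1) * n)) (by omega) (by omega)
      have t2 := hm (2 * ((b' + 1) * n)) (by omega)
      obtain ⟨u, hu, v, hv, huv⟩ := h.ya _ (a r').2 (ρ (2 * (b' * n)) - 1) (by omega)
      rw [show ρ (2 * (b' * n)) - 1 + 1 = ρ (2 * (b' * n)) by omega] at hv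
      refine ⟨u, Or.inl ⟨_, (show ρ (2 * (b.val * n)) ≤ _ by omega), ?_, hu⟩, v, Or.inl ⟨_, le_rfl, t1, hv⟩, huv⟩
      rw [w1, e1]; omega
    · simp only at h1 h2 h3
      have : b' = b := Fin.ext h1.symm
      subst this
      have hr : r.val + 1 < n := by omega
      have hF : F r b' = E r b' := by simp only [F]; rw [if_pos ⟨hr, h3⟩]
      obtain ⟨u, hu, v, hv, huv⟩ := (hE2 r b' hr b'.2).2.1
      have e : r' = ⟨r + 1, hr⟩ := Fin.ext h2.symm
      refine ⟨u, by rw [hF]; exact hu, v, Or.inl (by rw [e]; exact hv), huv⟩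
  refine ⟨fun x => D x.1 x.2 ∪ F x.1 x.2, ?_, ?_, ?_⟩
  · rintro ⟨r, b⟩
    simp only [F]
    split_ifs with hc
    · exact (hE2 r b hc.1 b.2).1
    · simpa using hDc r b b.2
  · rintro ⟨r, b⟩ ⟨r', b'⟩ hne
    have hne' : r ≠ r' ∨ b.val ≠ b'.val := by
      by_contra hcon
      push Not at hcon
      exact hne (Prod.ext hcon.1 (Fin.ext hcon.2))
    have aux : ∀ (r r' : Fin n) (b b' : Fin w), (r ≠ r' ∨ b.val ≠ b'.val) → Disjoint (F r b) (D r' b') := by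
      intro r r' b b' hne
      by_cases hr : r = r'
      · subst hr
        exact hFD2 r b b.2 b' b'.2 (by tauto)
      · exact hFD r r' hr b b.2 b' b'.2
    simp only
    rw [Set.disjoint_union_left, Set.disjoint_union_right, Set.disjoint_union_right]
    refine ⟨⟨hDd _ _ _ b.2 _ b'.2 hne', (aux r' r b' b ?_).symm⟩, aux r r' b b' hne', hFd _ _ _ b.2 _ b'.2 hne'⟩
    rcases hne' with h | h
    · exact Or.inl h.symm
    · exact Or.inr h.symm
  · intro x y hxy
    rcases hxy.2 with h | h
    · exact hadj x y h
    · obtain ⟨u, hu, v, hv, huv⟩ := hadj y x h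
      exact ⟨v, hv, u, hu, huv.symm⟩
theorem GridL.brick (n w : ℕ) (hn : 0 < n) : ∃ p m, ∀ {V : Type} (G : SimpleGraph V) Y Q, GridL G p m Y Q → Minor G (Brick n w) := by
  let p := n ^ n + 1
  let M := 2 * (w * n) + 1
  refine ⟨p, Fintype.card ((Fin n → Fin p) × Fin p) * M, fun {V} G Y Q h => ?_⟩
  set m := Fintype.card ((Fin n → Fin p) × Fin p) * M with hmdef
  choose a c ha hc using fun i : Fin m => h.row (T := n) (Nat.lt_succ_self _) hn i.2
  have : Nonempty ((Fin n → Fin p) × Fin p) := ⟨⟨fun _ => 0, 0⟩⟩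
  classical
  obtain ⟨⟨a0, c0⟩, hac⟩ := Fintype.exists_le_card_fiber_of_mul_le_card (fun i : Fin m => (a i, c i)) (n := M)
    (by rw [Fintype.card_fin])
  obtain ⟨S, hS, hSc⟩ := Finset.exists_subset_card_eq hac
  let e := S.orderEmbOfFin hSc
  have heS : ∀ q, a (e q) = a0 ∧ c (e q) = c0 := fun q => by
    have := hS (S.orderEmbOfFin_mem hSc q)
    simpa using this
  let ρ : ℕ → ℕ := fun q => if hq : q < M then (e ⟨q, hq⟩).val else 0
  have hρ : ∀ q, ∀ hq : q < M, ρ q = (e ⟨q, hq⟩).val := fun q hq => dif_pos hq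
  refine brick_of h (a := a0) (c := c0) ?_ ρ ?_ ?_ ?_
  · rw [← (heS 0).1]; exact ha _
  · intro q q' hqq hq'
    rw [hρ q (by omega), hρ q' (by omega)]
    exact e.strictMono (show (⟨q, _⟩ : Fin M) < ⟨q', _⟩ from hqq)
  · rw [hρ _ (by omega)]; exact (e _).2
  · intro q hq s s' hs
    rw [hρ q (by omega)]
    have := hc (e ⟨q, by omega⟩) s s' hs
    rw [(heS _).1, (heS _).2] at this
    exact this

theorem seg_R {s : Set V} {l : List V} {m n : ℕ} (hmn : m ≤ n) (hn : n < l.length)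
    (h : ∀ i, m ≤ i → ∀ hi : i < n, G.Adj l[i] l[i + 1]) (hs : ∀ i, m ≤ i → ∀ hi : i ≤ n, l[i] ∈ s) :
    R G s l[m] l[n] := by
  induction n, hmn using Nat.le_induction with
  | base => exact R.refl _
  | succ n hmn ih =>
    exact (ih (by omega) (fun i h1 h2 => h i h1 (by omega)) (fun i h1 h2 => hs i h1 (by omega))).trans
      (R.adj (h n hmn (by omega)) (hs n hmn (by omega)) (hs (n + 1) (by omega) le_rfl))
/-- linkage given by lists -/
structure LL (G : SimpleGraph V) (A B : Set V) {k : ℕ} (P : Fin k → List V) : Prop where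
  ch : ∀ j, (P j).IsChain G.Adj
  nd : ∀ j, (P j).Nodup
  hd : ∀ j, ∃ a ∈ A, (P j).head? = some a
  la : ∀ j, ∃ b ∈ B, (P j).getLast? = some b
  dj : ∀ j j', j ≠ j' → ∀ v ∈ P j, v ∉ P j'
theorem Lk.lists {A B : Set V} {k : ℕ} (h : Lk G A B k) :
    ∃ P : Fin k → List V, LL G A B P := by
  obtain ⟨C, hC, hd⟩ := h
  have : ∀ i, ∃ l, IP G l ∧ (∃ a ∈ A, l.head? = some a) ∧ (∃ b ∈ B, l.getLast? = some b) ∧ ∀ x ∈ l, x ∈ C i := by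
    intro i
    obtain ⟨h1, ⟨a, ha, ha'⟩, ⟨b, hb, hb'⟩⟩ := hC i
    obtain ⟨l, l1, l2, l3, l4⟩ := exists_IP (h1.2 a ha b hb) ha
    grind
  choose P h1 h2 h3 h4 using this
  exact ⟨P, fun j => (h1 j).chain, fun j => (h1 j).nodup, h2, h3,
    fun j j' hj v hv hv' => dsj (hd j j' hj) (h4 _ _ hv) (h4 _ _ hv')⟩
theorem LL.toLk {A B : Set V} {k : ℕ} {P : Fin k → List V} (h : LL G A B P) : Lk G A B k := by
  refine ⟨fun j => {v | v ∈ P j}, fun j => ?_, fun i j hij => Set.disjoint_left.2 (h.dj i j hij)⟩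
  obtain ⟨a, ha, ha'⟩ := h.hd j
  obtain ⟨b, hb, hb'⟩ := h.la j
  exact ⟨chain_conn (h.ch j) (by grind), ⟨a, mHe ha', ha⟩, ⟨b, mLa hb', hb⟩⟩
theorem cut [Finite V] {H H' : SimpleGraph V} {A B : Set V} {k : ℕ} {P : Fin k → List V} (hP : LL H A B P)
    (j0 : Fin k) {c : ℕ} (hc0 : 0 < c) (hc : c < (P j0).length)
    (hH' : H' = H.deleteEdges {s((P j0)[c - 1], (P j0)[c])}) (hmin : ¬ Lk H' A B k) :
    ∃ (X D : Set V) (f : Fin k → ℕ), X.ncard < k ∧ (∀ n, ∀ h : n < (P j0).length, (P j0)[n] ∈ D ↔ n < c) ∧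
      (∀ j, j ≠ j0 → f j < (P j).length ∧ ∀ n, ∀ h : n < (P j).length, (P j)[n] ∈ D ↔ n < f j) ∧
      ∀ u v, H'.Adj u v → u ∉ X → v ∉ X → u ∈ D → v ∈ D := by
  have h0 : ¬ ∀ X, Sep H' A B X → k ≤ X.ncard := fun h => hmin (menger H' A B k h)
  push Not at h0
  obtain ⟨X, hX, hXk⟩ := h0
  have hinj : ∀ j, ∀ m n : ℕ, ∀ hm : m < (P j).length, ∀ hn : n < (P j).length, (P j)[m] = (P j)[n] → m = n :=
    fun j m n hm hn h => (List.Nodup.getElem_inj_iff (hP.nd j)).1 h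
  have hadj : ∀ j, j ≠ j0 → ∀ i, ∀ hi : i + 1 < (P j).length, H'.Adj (P j)[i] (P j)[i + 1] := by
    intro j hj i hi
    rw [hH', SimpleGraph.deleteEdges_adj]
    refine ⟨List.isChain_iff_getElem.1 (hP.ch j) i hi, ?_⟩
    intro he
    have he := Set.mem_singleton_iff.1 he
    have h1 : (P j)[i] ∈ P j := List.getElem_mem _
    have h2 := hP.dj j j0 hj _ h1
    grind
  have hadj0 : ∀ i, i + 1 ≠ c → ∀ hi : i + 1 < (P j0).length, H'.Adj (P j0)[i] (P j0)[i + 1] := by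
    intro i hic hi
    rw [hH', SimpleGraph.deleteEdges_adj]
    refine ⟨List.isChain_iff_getElem.1 (hP.ch j0) i hi, ?_⟩
    grind
  have hlen : ∀ j, 0 < (P j).length := fun j => by
    obtain ⟨a, -, h⟩ := hP.hd j
    exact List.length_pos_of_mem (mHe h)
  have hhd : ∀ j, (P j)[0]'(hlen j) ∈ A := fun j => by
    obtain ⟨a, ha, h⟩ := hP.hd j
    rw [List.head?_eq_getElem?, List.getElem?_eq_getElem (hlen j)] at h
    simp at h; exact h ▸ ha
  have hla : ∀ j, (P j)[(P j).length - 1]'(by have := hlen j; omega) ∈ B := fun j => by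
    obtain ⟨a, ha, h⟩ := hP.la j
    grind
  have hex : ∀ j, j ≠ j0 → ∃ n, ∃ h : n < (P j).length, (P j)[n] ∈ X := by
    intro j hj
    by_contra hcon
    push Not at hcon
    exact hX _ (hhd j) _ (hla j) (hcon _ _) (seg_R (by omega) (by have := hlen j; omega)
      (fun i _ hi => hadj j hj i (by omega)) (fun i _ hi => hcon _ _))
  choose! f hf using hex
  have hXu : ∀ v ∈ X, ∃ j, ∃ hj : j ≠ j0, (P j)[f j]'(hf j hj).1 = v := by
    let φ : {j // j ≠ j0} → V := fun j => (P j)[f j]'(hf j j.2).1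
    have hφ : Function.Injective φ := by
      intro j j' h
      by_contra hne
      have h1 : φ j ∈ P j := List.getElem_mem _
      exact hP.dj j j' (fun h => hne (Subtype.ext h)) _ h1 (h ▸ List.getElem_mem _)
    have : Set.range φ = X := by
      apply Set.eq_of_subset_of_ncard_le
      · rintro _ ⟨j, rfl⟩; exact (hf j j.2).2
      · rw [← Set.image_univ, Set.ncard_image_of_injective _ hφ, Set.ncard_univ, Nat.card_eq_fintype_card,
          Fintype.card_subtype_compl, Fintype.card_fin, Fintype.card_subtype_eq]
        omega
      · exact Set.toFinite _
    intro v hv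
    rw [← this] at hv
    obtain ⟨j, hj⟩ := hv
    exact ⟨j, j.2, hj⟩
  have hX0 : ∀ n, ∀ h : n < (P j0).length, (P j0)[n] ∉ X := by
    intro n h hx
    obtain ⟨j, hj, e⟩ := hXu _ hx
    have h1 : (P j)[f j]'(hf j hj).1 ∈ P j := List.getElem_mem _
    exact hP.dj j j0 hj _ h1 (by rw [e]; exact List.getElem_mem _)
  have hXj : ∀ j, j ≠ j0 → ∀ n, ∀ h : n < (P j).length, n ≠ f j → (P j)[n] ∉ X := by
    intro j hj n h hn hx
    obtain ⟨j', hj', e⟩ := hXu _ hx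
    by_cases hjj : j' = j
    · subst hjj
      exact hn (hinj _ _ _ _ _ e).symm
    · have h1 : (P j')[f j']'(hf j' hj').1 ∈ P j' := List.getElem_mem _
      exact hP.dj j' j hjj _ h1 (by rw [e]; exact List.getElem_mem _)
  refine ⟨X, {v | ∃ a ∈ A, a ∉ X ∧ R H' Xᶜ a v}, f, hXk, ?_, ?_, ?_⟩
  · intro n hn
    constructor
    · rintro ⟨a, ha, haX, hr⟩
      by_contra hnc
      exact hX a ha _ (hla j0) haX (hr.trans (seg_R (by omega) (by omega) (fun i _ hi => hadj0 i (by omega) (by omega))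
        (fun i _ hi => hX0 _ _)))
    · intro hnc
      exact ⟨_, hhd j0, hX0 _ _, seg_R (by omega) hn (fun i _ hi => hadj0 i (by omega) (by omega)) (fun i _ hi => hX0 _ _)⟩
  · intro j hj
    refine ⟨(hf j hj).1, fun n hn => ⟨?_, ?_⟩⟩
    · rintro ⟨a, ha, haX, hr⟩
      by_contra hnc
      by_cases e : n = f j
      · subst e
        exact hr.mem haX (hf j hj).2
      · exact hX a ha _ (hla j) haX (hr.trans (seg_R (by omega) (by omega) (fun i _ hi => hadj j hj i (by omega))
          (fun i _ hi => hXj _ hj _ _ (by omega))))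
    · intro hnc
      exact ⟨_, hhd j, hXj j hj _ _ (by omega), seg_R (by omega) hn (fun i _ hi => hadj j hj i (by omega))
        (fun i _ hi => hXj _ hj _ _ (by omega))⟩
  · rintro u v huv hu hv ⟨a, ha, haX, hr⟩
    exact ⟨a, ha, haX, hr.trans (R.adj huv hu hv)⟩

def Qg {ι : Type} (G : SimpleGraph V) (Q : ι → Set V) : SimpleGraph V where
  Adj u v := G.Adj u v ∧ ∃ i, u ∈ Q i ∧ v ∈ Q i
  symm := ⟨fun _ _ h => ⟨h.1.symm, h.2.imp fun _ h => ⟨h.2, h.1⟩⟩⟩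
  loopless := ⟨fun _ h => h.1.ne rfl⟩
structure ML {ι : Type} (G : SimpleGraph V) (Q : ι → Set V) (A B : Set V) (k : ℕ) (H : SimpleGraph V) : Prop where
  qh : Qg G Q ≤ H
  hg : H ≤ G
  lk : Lk H A B k
  mn : ∀ u v, H.Adj u v → ¬ (Qg G Q).Adj u v → ¬ Lk (H.deleteEdges {s(u, v)}) A B k
theorem ML.exists [Finite V] {ι : Type} (Q : ι → Set V) {A B : Set V} {k : ℕ} (h : Lk G A B k) :
    ∃ H, ML G Q A B k H := by
  classical
  obtain ⟨H, hH, hm⟩ := wellFounded_lt.has_min {H : SimpleGraph V | Qg G Q ≤ H ∧ H ≤ G ∧ Lk H A B k}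
    ⟨G, fun _ _ h => h.1, le_rfl, h⟩
  refine ⟨H, hH.1, hH.2.1, hH.2.2, fun u v huv hq hL => ?_⟩
  refine hm (H.deleteEdges {s(u, v)}) ⟨fun a b hab => ?_, fun a b hab => hH.2.1 ?_, hL⟩ (lt_of_le_of_ne ?_ ?_)
  · rw [SimpleGraph.deleteEdges_adj]
    refine ⟨hH.1 hab, fun he => hq ?_⟩
    rcases Sym2.eq_iff.1 (Set.mem_singleton_iff.1 he) with ⟨rfl, rfl⟩ | ⟨rfl, rfl⟩
    · exact hab
    · exact hab.symm
  · exact (SimpleGraph.deleteEdges_adj.1 hab).1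
  · exact SimpleGraph.deleteEdges_le _
  · intro e
    rw [← e, SimpleGraph.deleteEdges_adj] at huv
    exact huv.2 rfl
theorem sorted_seq {ι : Type} (I : Finset ι) (τ : ι → ℕ) (hτ : ∀ i ∈ I, ∀ j ∈ I, τ i = τ j → i = j) (hne : I.Nonempty) :
    ∃ σ : ℕ → ι, (∀ n < I.card, σ n ∈ I) ∧ ∀ n n', n < n' → n' < I.card → τ (σ n) < τ (σ n') := by
  classical
  obtain ⟨i0, hi0⟩ := hne
  have hc : (I.image τ).card = I.card := Finset.card_image_of_injOn hτ
  have : ∀ n : ℕ, ∃ i, ∀ h : n < I.card, i ∈ I ∧ τ i = (I.image τ).orderEmbOfFin hc ⟨n, h⟩ := by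
    intro n
    by_cases h : n < I.card
    · obtain ⟨i, hi, e⟩ := Finset.mem_image.1 ((I.image τ).orderEmbOfFin_mem hc ⟨n, h⟩)
      grind
    · grind
  choose σ hσ using this
  refine ⟨σ, fun n h => (hσ n h).1, fun n n' h h' => ?_⟩
  rw [(hσ n (h.trans h')).2, (hσ n' h').2]
  exact (Finset.orderEmbOfFin _ hc).strictMono h
theorem pick_free [Finite V] {ι : Type} (Q : ι → Set V) (I : Finset ι)
    (hd : ∀ i ∈ I, ∀ j ∈ I, i ≠ j → Disjoint (Q i) (Q j)) (X : Set V) (h : X.ncard < I.card) :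
    ∃ i ∈ I, Disjoint (Q i) X := by
  classical
  by_contra hc
  push Not at hc
  have : ∀ i : I, ∃ v, v ∈ Q i ∧ v ∈ X := fun i => Set.not_disjoint_iff.1 (hc i i.2)
  choose φ h1 h2 using this
  have hinj : Function.Injective φ := by
    intro i j e
    grind
  have : (Set.range φ).ncard ≤ X.ncard := Set.ncard_le_ncard (by rintro _ ⟨i, rfl⟩; exact h2 i) (Set.toFinite _)
  rw [← Set.image_univ, Set.ncard_image_of_injective _ hinj, Set.ncard_univ, Nat.card_eq_fintype_card, Fintype.card_coe] at this
  omega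
theorem lemC [Finite V] {ι : Type} {G H : SimpleGraph V} {Q : ι → Set V} {A B : Set V} {k p m : ℕ} {P : Fin k → List V}
    (I : Finset ι) (hQc : ∀ i ∈ I, Conn G (Q i)) (hQd : ∀ i j, i ≠ j → Disjoint (Q i) (Q j))
    (hH : ML G Q A B k H) (hP : LL H A B P) (jc : ℕ → Fin k)
    (hj : ∀ r < p, ∀ r' < p, jc r = jc r' → r = r') (j0 : Fin k) (hj0 : ∀ r < p, jc r ≠ j0)
    (hI : 2 * k * (m + 2) + 1 ≤ I.card)
    (h0 : ∀ i ∈ I, ∃ v ∈ P j0, v ∈ Q i) (hit : ∀ i ∈ I, ∀ r < p, ∃ v ∈ P (jc r), v ∈ Q i) :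
    ∃ Y Q', GridL G p m Y Q' := by
  classical
  have hk : 0 < k := j0.pos
  have hτ : ∀ i, ∃ n, i ∈ I → ∃ h : n < (P j0).length, (P j0)[n] ∈ Q i ∧ ∀ n', ∀ h : n' < n, (P j0)[n'] ∉ Q i := by
    intro i
    by_cases hi : i ∈ I
    · have hex : ∃ n, ∃ h : n < (P j0).length, (P j0)[n] ∈ Q i := by
        obtain ⟨v, hv, hv'⟩ := h0 i hi
        obtain ⟨n, hn, rfl⟩ := List.getElem_of_mem hv
        exact ⟨n, hn, hv'⟩
      obtain ⟨h1, h2⟩ := Nat.find_spec hex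
      exact ⟨Nat.find hex, fun _ => ⟨h1, h2, fun n' h h' => Nat.find_min hex h ⟨h.trans h1, h'⟩⟩⟩
    · exact ⟨0, fun h => absurd h hi⟩
  choose τ hτ using hτ
  have hQe : ∀ i j v, v ∈ Q i → v ∈ Q j → i = j := fun i j v h h' => by
    by_contra hne; exact dsj (hQd i j hne) h h'
  obtain ⟨σ, hσI, hσ⟩ := sorted_seq I τ (fun i hi j hj e => by
    grind) (Finset.card_pos.1 (by omega))
  have hσle : ∀ n n', n ≤ n' → n' < I.card → τ (σ n) ≤ τ (σ n') := fun n n' h h' => by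
    rcases h.eq_or_lt with rfl | h
    · exact le_rfl
    · exact (hσ n n' h h').le
  have hbound : ∀ i ≤ m, 2 * k * (i + 1) < I.card ∧ 2 * k * (i + 2) < I.card := fun i hi => by
    have h1 : 2 * k * (i + 1) ≤ 2 * k * (m + 2) := Nat.mul_le_mul_left _ (by omega)
    have h2 : 2 * k * (i + 2) ≤ 2 * k * (m + 2) := Nat.mul_le_mul_left _ (by omega)
    omega
  have hcut : ∀ i, ∃ (X D : Set V) (f : Fin k → ℕ), i ≤ m → X.ncard < k ∧
      (∀ r < p, f (jc r) < (P (jc r)).length ∧ ∀ n, ∀ h : n < (P (jc r)).length, (P (jc r))[n] ∈ D ↔ n < f (jc r)) ∧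
      ∀ q < I.card, Disjoint (Q (σ q)) X → (2 * k * (i + 1) ≤ q → Disjoint (Q (σ q)) D) ∧ (q < 2 * k * (i + 1) → Q (σ q) ⊆ D) := by
    intro i
    by_cases hi : i ≤ m
    swap
    · exact ⟨∅, ∅, fun _ => 0, fun h => absurd h hi⟩
    have hb := (hbound i hi).1
    obtain ⟨c1, c2, c3⟩ := hτ _ (hσI _ hb)
    set c := τ (σ (2 * k * (i + 1))) with hcdef
    have hc0 : 0 < c := by
      have := hσ 0 (2 * k * (i + 1)) (by positivity) hb
      omega
    have hnq : ¬ (Qg G Q).Adj ((P j0)[c - 1]) ((P j0)[c]) := by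
      rintro ⟨-, i', h1, h2⟩
      grind
    have hadj : H.Adj ((P j0)[c - 1]) ((P j0)[c]) := by
      have := List.isChain_iff_getElem.1 (hP.ch j0) (c - 1) (by omega)
      grind
    obtain ⟨X, D, f, hX, hD0, hDj, hcl⟩ := cut hP j0 hc0 c1 rfl (hH.mn _ _ hadj hnq)
    refine ⟨X, D, f, fun _ => ⟨hX, fun r hr => hDj _ (hj0 r hr), fun q hq hqX => ?_⟩⟩
    obtain ⟨q1, q2, q3⟩ := hτ _ (hσI _ hq)
    have hst : ∀ u ∈ Q (σ q), ∀ v ∈ Q (σ q), u ∈ D → v ∈ D := by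
      intro u hu v hv huD
      have hR := (hQc _ (hσI q hq)).2 u hu v hv
      refine hR.prop (· ∈ D) (fun a b hab ha hb haD => ?_) huD
      refine hcl a b ?_ (dsj hqX ha) (dsj hqX hb) haD
      rw [SimpleGraph.deleteEdges_adj]
      refine ⟨hH.qh ⟨hab, _, ha, hb⟩, fun he => hnq ?_⟩
      rcases Sym2.eq_iff.1 (Set.mem_singleton_iff.1 he) with ⟨e, e'⟩ | ⟨e, e'⟩
      · rw [← e, ← e']; exact ⟨hab, _, ha, hb⟩
      · rw [← e, ← e']; exact ⟨hab.symm, _, hb, ha⟩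
    constructor
    · intro hle
      refine Set.disjoint_left.2 fun v hv hvD => ?_
      have := (hD0 _ q1).1 (hst v hv _ q2 hvD)
      have := hσle _ _ hle hq
      omega
    · intro hlt v hv
      exact hst _ q2 v hv ((hD0 _ q1).2 (hσ _ _ hlt hb))
  choose X D f hF using hcut
  have hrow : ∀ i, ∃ q, i < m → q < I.card ∧ Disjoint (Q (σ q)) (D i) ∧ Q (σ q) ⊆ D (i + 1) ∧ 2 * k * (i + 1) ≤ q ∧ q < 2 * k * (i + 2) := by
    intro i
    by_cases hi : i < m
    swap
    · exact ⟨0, fun h => absurd h hi⟩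
    have hb := (hbound i hi.le).2
    have e : 2 * k * (i + 2) = 2 * k * (i + 1) + 2 * k := by ring
    have hX := Set.ncard_union_le (X i) (X (i + 1))
    have h1 := (hF i hi.le).1
    have h2 := (hF (i + 1) hi).1
    obtain ⟨q, hq, hqd⟩ := pick_free (fun q => Q (σ q)) (Finset.Ico (2 * k * (i + 1)) (2 * k * (i + 2))) (by
      intro a ha b hb' hab
      rw [Finset.mem_Ico] at ha hb'
      refine hQd _ _ fun e => ?_
      rcases lt_or_gt_of_ne hab with h | h
      · have := hσ _ _ h (by omega); rw [e] at this; omega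
      · have := hσ _ _ h (by omega); rw [e] at this; omega) (X i ∪ X (i + 1)) (by rw [Nat.card_Ico]; omega)
    rw [Finset.mem_Ico] at hq
    rw [Set.disjoint_union_right] at hqd
    grind
  choose q hq using hrow
  have hhit : ∀ i < m, ∀ r < p, ∃ n, ∃ h : n < (P (jc r)).length, (P (jc r))[n] ∈ Q (σ (q i)) ∧ f i (jc r) ≤ n ∧ n < f (i + 1) (jc r) := by
    intro i hi r hr
    obtain ⟨q1, q2, q3, -⟩ := hq i hi
    obtain ⟨v, hv, hv'⟩ := hit _ (hσI _ q1) r hr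
    obtain ⟨n, hn, rfl⟩ := List.getElem_of_mem hv
    refine ⟨n, hn, hv', ?_, ?_⟩
    · by_contra hcon
      exact dsj q2 hv' ((((hF i hi.le).2.1 r hr).2 n hn).2 (by omega))
    · exact (((hF (i + 1) hi).2.1 r hr).2 n hn).1 (q3 hv')
  have hmono : ∀ r < p, ∀ i i', i ≤ i' → i' ≤ m → f i (jc r) ≤ f i' (jc r) := by
    intro r hr i i' h
    induction i', h using Nat.le_induction with
    | base => exact fun _ => le_rfl
    | succ n hn ih =>
      intro h'
      obtain ⟨_, _, _, h1, h2⟩ := hhit n (by omega) r hr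
      have := ih (by omega)
      omega
  have hQne : ∀ i < m, ∀ i' < m, i ≠ i' → Disjoint (Q (σ (q i))) (Q (σ (q i'))) := by
    have key : ∀ i < m, ∀ i' < m, i < i' → Disjoint (Q (σ (q i))) (Q (σ (q i'))) := by
      intro i hi i' hi' hlt
      refine hQd _ _ fun e => ?_
      have h1 := (hq i hi).2.2.2.2
      have h2 := (hq i' hi').2.2.2.1
      have h3 : 2 * k * (i + 2) ≤ 2 * k * (i' + 1) := Nat.mul_le_mul_left _ (by omega)
      have := hσ (q i) (q i') (by omega) (hq i' hi').1
      rw [e] at this; omega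
    intro i hi i' hi' hne
    rcases lt_or_gt_of_ne hne with h | h
    · exact key i hi i' hi' h
    · exact (key i' hi' i hi h).symm
  refine ⟨fun r i => {v | ∃ n, ∃ h : n < (P (jc r)).length, f i (jc r) ≤ n ∧ n < f (i + 1) (jc r) ∧ (P (jc r))[n] = v},
    fun i => Q (σ (q i)), ?_, ?_, ?_, fun i hi => hQc _ (hσI _ (hq i hi).1), hQne, ?_, ?_⟩
  · intro r hr i hi
    have key : ∀ n n', ∀ hn : n ≤ n', ∀ h : n' < (P (jc r)).length, f i (jc r) ≤ n → n' < f (i + 1) (jc r) →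
      R G {v | ∃ n, ∃ h : n < (P (jc r)).length, f i (jc r) ≤ n ∧ n < f (i + 1) (jc r) ∧ (P (jc r))[n] = v} ((P (jc r))[n]'(hn.trans_lt h)) (P (jc r))[n'] := by
      intro n n' hn h h1 h2
      exact seg_R hn h (fun a ha ha' => hH.hg (List.isChain_iff_getElem.1 (hP.ch _) a (by omega)))
        (fun a ha ha' => ⟨a, by omega, by omega, by omega, rfl⟩)
    constructor
    · obtain ⟨n, h, h1, h2, h3⟩ := hhit i hi r hr
      exact ⟨_, n, h, h2, h3, rfl⟩
    · rintro _ ⟨n, h, h1, h2, rfl⟩ _ ⟨n', h', h1', h2', rfl⟩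
      rcases le_total n n' with hle | hle
      · exact key _ _ hle h' h1 h2'
      · exact (key _ _ hle h h1' h2).symm
  · intro r hr i hi r' hr' i' hi' hne
    refine Set.disjoint_left.2 ?_
    rintro v ⟨n, h, h1, h2, rfl⟩ ⟨n', h', h1', h2', e⟩
    by_cases hrr : r = r'
    · subst hrr
      have hii : i ≠ i' := by simpa using hne
      have := (List.Nodup.getElem_inj_iff (hP.nd _)).1 e
      rcases lt_or_gt_of_ne hii with hl | hl
      · have := hmono r hr (i + 1) i' hl (by omega); omega
      · have := hmono r hr (i' + 1) i hl (by omega); omega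
    · have hm : (P (jc r'))[n'] ∈ P (jc r') := List.getElem_mem _
      exact hP.dj (jc r') (jc r) (fun e => hrr (hj r hr r' hr' e.symm)) _ hm (by rw [e]; exact List.getElem_mem _)
  · intro r hr i hi
    obtain ⟨n, h, -, h2, h3⟩ := hhit i (by omega) r hr
    obtain ⟨n', h', -, h2', h3'⟩ := hhit (i + 1) (by omega) r hr
    have hl := ((hF (i + 1) (by omega)).2.1 r hr).1
    refine ⟨(P (jc r))[f (i + 1) (jc r) - 1], ⟨_, by omega, by omega, by omega, rfl⟩, (P (jc r))[f (i + 1) (jc r)],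
      ⟨_, by omega, by omega, by omega, rfl⟩, hH.hg ?_⟩
    have := List.isChain_iff_getElem.1 (hP.ch (jc r)) (f (i + 1) (jc r) - 1) (by omega)
    simpa only [show f (i + 1) (jc r) - 1 + 1 = f (i + 1) (jc r) by omega] using this
  · intro r hr i hi
    obtain ⟨n, h, h1, h2, h3⟩ := hhit i hi r hr
    exact ⟨_, h1, n, h, h2, h3, rfl⟩
  · intro r hr i hi i' hi' hne
    obtain ⟨-, q2, q3, -⟩ := hq i hi
    refine Set.disjoint_left.2 ?_
    rintro v hv ⟨n, h, h1, h2, rfl⟩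
    rcases lt_or_gt_of_ne hne with hl | hl
    · have := (((hF (i + 1) hi).2.1 r hr).2 n h).1 (q3 hv)
      have := hmono r hr (i + 1) i' hl (by omega)
      omega
    · have := hmono r hr (i' + 1) i hl (by omega)
      exact dsj q2 hv ((((hF i hi.le).2.1 r hr).2 n h).2 (by omega))

def NG (G : SimpleGraph V) (p m : ℕ) : Prop := ∀ Y Q, ¬ GridL G p m Y Q
theorem NG.mono {G G' : SimpleGraph V} {p m : ℕ} (h : NG G p m) (hg : G' ≤ G) : NG G' p m := by
  rintro Y Q ⟨h1, h2, h3, h4, h5, h6, h7⟩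
  refine h Y Q ⟨fun j hj i hi => (h1 j hj i hi).mono_graph hg, h2, fun j hj i hi => ?_,
    fun i hi => (h4 i hi).mono_graph hg, h5, h6, h7⟩
  obtain ⟨u, hu, v, hv, huv⟩ := h3 j hj i hi
  exact ⟨u, hu, v, hv, hg huv⟩
theorem Lk.of_le {A B : Set V} {k k' : ℕ} (h : Lk G A B k) (hk : k' ≤ k) : Lk G A B k' := by
  obtain ⟨C, h1, h2⟩ := h
  exact ⟨fun i => C (Fin.castLE hk i), fun i => h1 _, fun i j hij => h2 _ _ fun e => hij (Fin.castLE_injective hk e)⟩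
/-- few `Q i` meet many paths -/
theorem few_bad [Finite V] {ι : Type} {G H : SimpleGraph V} {Q : ι → Set V} {A B : Set V} {k p m : ℕ} {P : Fin k → List V}
    (hng : NG G p m) (hQc : ∀ i, Conn G (Q i)) (hQd : ∀ i j, i ≠ j → Disjoint (Q i) (Q j))
    (hH : ML G Q A B k H) (hP : LL H A B P) (I : Finset ι)
    (hI : ∀ i ∈ I, p + 1 ≤ {j | ∃ v ∈ P j, v ∈ Q i}.ncard) : I.card ≤ 2 ^ k * (2 * k * (m + 2) + 1) := by
  classical
  by_contra hc
  push Not at hc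
  let S : ι → Finset (Fin k) := fun i => Finset.univ.filter fun j => ∃ v ∈ P j, v ∈ Q i
  have hS : ∀ i ∈ I, p + 1 ≤ (S i).card := fun i hi => by
    have := hI i hi
    rwa [show {j | ∃ v ∈ P j, v ∈ Q i} = (S i : Set (Fin k)) by ext; simp [S], Set.ncard_coe_finset] at this
  obtain ⟨T, -, hT⟩ := Finset.exists_lt_card_fiber_of_mul_lt_card_of_maps_to (s := I) (t := Finset.univ) (f := S)
    (n := 2 * k * (m + 2) + 1) (fun _ _ => Finset.mem_univ _) (by simpa using hc)
  obtain ⟨i0, hi0⟩ := Finset.card_pos.1 (lt_of_le_of_lt (Nat.zero_le _) hT)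
  have hTc : p + 1 ≤ T.card := by
    grind
  have hTp : ∀ j ∈ T, ∀ i ∈ I.filter (fun i => S i = T), ∃ v ∈ P j, v ∈ Q i := by
    grind
  let e : Fin (p + 1) → Fin k := fun a => T.orderEmbOfFin rfl (Fin.castLE hTc a)
  have he : Function.Injective e := fun a b h => Fin.castLE_injective hTc ((T.orderEmbOfFin rfl).injective h)
  have heT : ∀ a, e a ∈ T := fun a => T.orderEmbOfFin_mem rfl _
  obtain ⟨Y, Q', h⟩ := lemC (p := p) (m := m) (I.filter fun i => S i = T) (fun i _ => hQc i) hQd hH hP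
    (fun r => e (Fin.ofNat (p + 1) r))
    (fun r hr r' hr' h => by
      have := congrArg Fin.val (he h)
      simpa [Nat.mod_eq_of_lt (show r < p + 1 by omega), Nat.mod_eq_of_lt (show r' < p + 1 by omega)] using this)
    (e (Fin.last p)) (fun r hr h => by
      have := congrArg Fin.val (he h)
      simp [Nat.mod_eq_of_lt (show r < p + 1 by omega)] at this
      omega) hT.le (hTp _ (heT _)) (fun i hi r _ => hTp _ (heT _) i hi)
  exact hng _ _ h
def delV (G : SimpleGraph V) (Q : Set V) : SimpleGraph V where
  Adj u v := G.Adj u v ∧ u ∉ Q ∧ v ∉ Q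
  symm := ⟨fun _ _ h => ⟨h.1.symm, h.2.2, h.2.1⟩⟩
  loopless := ⟨fun _ h => h.1.ne rfl⟩
theorem delV_le (G : SimpleGraph V) (Q : Set V) : delV G Q ≤ G := fun _ _ h => h.1
theorem Conn.delV {Q C : Set V} (h : Conn G C) (hd : Disjoint C Q) : Conn (delV G Q) C := by
  refine ⟨h.1, fun a ha b hb => ?_⟩
  refine (h.2 a ha b hb).prop (fun x => R (Paper.delV G Q) C a x) (fun x y hxy hx hy hr => hr.trans (R.adj ?_ hx hy)) (R.refl _)
  exact ⟨hxy, dsj hd hx, dsj hd hy⟩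
theorem Conn.delV_disj {Q C : Set V} (h : Conn (Paper.delV G Q) C) {a : V} (ha : a ∈ C) (haQ : a ∉ Q) :
    Disjoint C Q := by
  refine Set.disjoint_left.2 fun b hb => ?_
  exact (h.2 a ha b hb).prop (fun x => x ∉ Q) (fun x y hxy hx hy hr => hxy.2.2) haQ
/-- paths missing few hit paths -/
theorem sub_idx {k M h : ℕ} (S : Set (Fin k)) (hS : S.ncard ≤ h) (hk : M + h ≤ k) :
    ∃ e : Fin M → Fin k, Function.Injective e ∧ ∀ i, e i ∉ S := by
  classical
  have h1 : M ≤ (Sᶜ.toFinset).card := by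
    have := Set.ncard_add_ncard_compl S
    rw [Nat.card_eq_fintype_card, Fintype.card_fin] at this
    rw [← Set.ncard_eq_toFinset_card']
    omega
  exact ⟨fun a => (Sᶜ.toFinset).orderEmbOfFin rfl (Fin.castLE h1 a),
    fun a b h => Fin.castLE_injective _ ((Finset.orderEmbOfFin _ rfl).injective h),
    fun a => Set.mem_toFinset.1 ((Sᶜ.toFinset).orderEmbOfFin_mem rfl (Fin.castLE h1 a))⟩
theorem sel (p m N : ℕ) : ∃ M, ∀ {V : Type} [Finite V] (G : SimpleGraph V) {α : Type} (F : Finset α) (A B : α → Set V),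
    F.card ≤ N → NG G p m → (∀ f ∈ F, Lk G (A f) (B f) M) → ∃ R : α → Set V,
      (∀ f ∈ F, Conn G (R f) ∧ (R f ∩ A f).Nonempty ∧ (R f ∩ B f).Nonempty) ∧
      ∀ f ∈ F, ∀ f' ∈ F, f ≠ f' → Disjoint (R f) (R f') := by
  classical
  induction N with
  | zero =>
    refine ⟨0, fun {V} _ G {α} F A B hF _ _ => ⟨fun _ => ∅, ?_, ?_⟩⟩ <;>
    · grind
  | succ N ih =>
    obtain ⟨M', hM'⟩ := ih
    let k := M' + p
    let b := 2 ^ k * (2 * k * (m + 2) + 1)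
    refine ⟨k + N * b + 1, fun {V} _ G {α} F A B hF hng hL => ?_⟩
    rcases F.eq_empty_or_nonempty with rfl | ⟨f0, hf0⟩
    · exact ⟨fun _ => ∅, by simp, by simp⟩
    obtain ⟨Q, hQ1, hQ2⟩ := hL f0 hf0
    have hH : ∀ f, ∃ H, ∃ P : Fin k → List V, f ∈ F → ML G Q (A f) (B f) k H ∧ LL H (A f) (B f) P := by
      intro f
      by_cases hf : f ∈ F
      · obtain ⟨H, hH⟩ := ML.exists Q ((hL f hf).of_le (show k ≤ _ by omega))
        obtain ⟨P, hP⟩ := hH.lk.lists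
        exact ⟨H, P, fun _ => ⟨hH, hP⟩⟩
      · exact ⟨⊥, fun _ => [], fun h => absurd h hf⟩
    choose H P hHP using hH
    let bad : α → Finset (Fin (k + N * b + 1)) := fun f => Finset.univ.filter fun i => p + 1 ≤ {j | ∃ v ∈ P f j, v ∈ Q i}.ncard
    have hbad : ∀ f ∈ F, (bad f).card ≤ b := fun f hf =>
      few_bad hng (fun i => (hQ1 i).1) hQ2 (hHP f hf).1 (hHP f hf).2 _ (fun i hi => (Finset.mem_filter.1 hi).2)
    have hFe : (F.erase f0).card ≤ N := by rw [Finset.card_erase_of_mem hf0]; omega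
    have hex : ∃ i, ∀ f ∈ F.erase f0, i ∉ bad f := by
      by_contra hc
      push Not at hc
      have h1 : (Finset.univ : Finset (Fin (k + N * b + 1))) ⊆ (F.erase f0).biUnion bad := fun i _ => by
        obtain ⟨f, hf, hi⟩ := hc i
        exact Finset.mem_biUnion.2 ⟨f, hf, hi⟩
      have h2 := (Finset.card_le_card h1).trans Finset.card_biUnion_le
      have h3 := Finset.sum_le_card_nsmul (F.erase f0) (fun f => (bad f).card) b (fun f hf => hbad f (Finset.mem_of_mem_erase hf))
      rw [Finset.card_univ, Fintype.card_fin] at h2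
      rw [smul_eq_mul] at h3
      have := Nat.mul_le_mul_right b hFe
      omega
    obtain ⟨i, hi⟩ := hex
    obtain ⟨R', hR1, hR2⟩ := hM' (delV G (Q i)) (F.erase f0) (fun f => A f \ Q i) (fun f => B f \ Q i) hFe (hng.mono (delV_le _ _)) (by
      intro f hf
      have hnb := hi f hf
      obtain ⟨hH, hP⟩ := hHP f (Finset.mem_of_mem_erase hf)
      obtain ⟨e, he, heS⟩ := sub_idx (M := M') (h := p) {j | ∃ v ∈ P f j, v ∈ Q i} (by
        by_contra hcon
        exact hnb (Finset.mem_filter.2 ⟨Finset.mem_univ _, by omega⟩)) le_rfl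
      obtain ⟨C, hC⟩ : ∃ C : Fin M' → Set V, C = fun a => {v | v ∈ P f (e a)} := ⟨_, rfl⟩
      have hCd : ∀ a, Disjoint (C a) (Q i) := fun a => Set.disjoint_left.2 fun v hv hv' => heS a ⟨v, by simpa [hC] using hv, hv'⟩
      refine ⟨C, fun a => ?_, fun a a' haa => ?_⟩
      · obtain ⟨x, hx, hx'⟩ := hP.hd (e a)
        obtain ⟨y, hy, hy'⟩ := hP.la (e a)
        have hxC : x ∈ C a := by rw [hC]; exact mHe hx'
        have hyC : y ∈ C a := by rw [hC]; exact mLa hy'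
        refine ⟨Conn.delV ?_ (hCd a), ⟨x, hxC, hx, dsj (hCd a) hxC⟩, ⟨y, hyC, hy, dsj (hCd a) hyC⟩⟩
        rw [hC]
        exact (chain_conn (hP.ch _) (by rintro h; simp [h] at hx')).mono_graph hH.hg
      · rw [hC]
        exact Set.disjoint_left.2 (hP.dj _ _ fun h => haa (he h)))
    have hRQ : ∀ f ∈ F.erase f0, Disjoint (R' f) (Q i) := fun f hf => by
      obtain ⟨h1, ⟨a, ha, ha'⟩, -⟩ := hR1 f hf
      exact h1.delV_disj ha ha'.2
    refine ⟨Function.update R' f0 (Q i), fun f hf => ?_, fun f hf f' hf' hne => ?_⟩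
    · by_cases e : f = f0
      · subst e; simpa using hQ1 i
      · rw [Function.update_of_ne e]
        obtain ⟨h1, h2, h3⟩ := hR1 f (Finset.mem_erase.2 ⟨e, hf⟩)
        exact ⟨h1.mono_graph (delV_le _ _), h2.mono fun x hx => ⟨hx.1, hx.2.1⟩, h3.mono fun x hx => ⟨hx.1, hx.2.1⟩⟩
    · grind
theorem pick_map {r r' b : ℕ} (Bad : Fin r → Fin r → Finset (Fin r)) (hb : ∀ i j, (Bad i j).card ≤ b)
    (hr : r' * (r' + r' * (r' * b)) < r) : ∃ φ : Fin r' → Fin r, ∀ c i, i ≠ c → φ c ≠ φ i ∧ ∀ j, j ≠ c → φ c ∉ Bad (φ i) (φ j) := by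
  classical
  by_contra hcon
  push Not at hcon
  let K : Fin r' → (Fin r' → Fin r) → Finset (Fin r) := fun c φ =>
    (Finset.univ.erase c).image φ ∪ (Finset.univ.erase c).biUnion fun i => (Finset.univ.erase c).biUnion fun j => Bad (φ i) (φ j)
  have hKc : ∀ c φ, (K c φ).card ≤ r' + r' * (r' * b) := by
    intro c φ
    have he : ((Finset.univ : Finset (Fin r')).erase c).card ≤ r' := (Finset.card_le_univ _).trans_eq (Fintype.card_fin _)
    refine (Finset.card_union_le _ _).trans (Nat.add_le_add (Finset.card_image_le.trans he) ?_)
    refine (Finset.card_biUnion_le_card_mul _ _ (r' * b) fun i _ => ?_).trans (Nat.mul_le_mul_right _ he)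
    exact (Finset.card_biUnion_le_card_mul _ _ b fun j _ => hb _ _).trans (Nat.mul_le_mul_right _ he)
  let T : Fin r' → Finset (Fin r' → Fin r) := fun c => Finset.univ.filter fun φ => φ c ∈ K c φ
  have hcov : (Finset.univ : Finset (Fin r' → Fin r)) ⊆ Finset.univ.biUnion T := by
    intro φ _
    obtain ⟨c, i, hic, h⟩ := hcon φ
    refine Finset.mem_biUnion.2 ⟨c, Finset.mem_univ _, Finset.mem_filter.2 ⟨Finset.mem_univ _, ?_⟩⟩
    by_cases e : φ c = φ i
    · exact Finset.mem_union_left _ (Finset.mem_image.2 ⟨i, by simp [hic], e.symm⟩)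
    · obtain ⟨j, hj, hB⟩ := h e
      exact Finset.mem_union_right _ (Finset.mem_biUnion.2 ⟨i, by simp [hic], Finset.mem_biUnion.2 ⟨j, by simp [hj], hB⟩⟩)
  have hT : ∀ c, (T c).card ≤ (r' + r' * (r' * b)) * r ^ (r' - 1) := by
    intro c
    let ρ : (Fin r' → Fin r) → ({x // x ≠ c} → Fin r) := fun φ x => φ x
    have hfib : ∀ g ∈ (Finset.univ : Finset ({x // x ≠ c} → Fin r)), ((T c).filter fun φ => ρ φ = g).card ≤ r' + r' * (r' * b) := by
      intro g _
      rcases ((T c).filter fun φ => ρ φ = g).eq_empty_or_nonempty with hne | ⟨φ0, h0⟩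
      · rw [hne]; simp
      rw [Finset.mem_filter] at h0
      have hag : ∀ φ, ρ φ = g → ∀ x, x ≠ c → φ x = φ0 x := fun φ hφ x hx => congrFun (hφ.trans h0.2.symm) ⟨x, hx⟩
      refine (Finset.card_le_card_of_injOn (fun φ => φ c) (fun φ hφ => ?_) (fun φ hφ φ' hφ' e => ?_)).trans (hKc c φ0)
      · have hφ := Finset.mem_filter.1 hφ
        have h2 := (Finset.mem_filter.1 hφ.1).2
        have h3 := hag φ hφ.2
        have : K c φ = K c φ0 := by
          simp only [K]
          congr 1
          · exact Finset.image_congr fun x hx => h3 x (by simpa using hx)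
          · refine Finset.biUnion_congr rfl fun i hi => Finset.biUnion_congr rfl fun j hj => ?_
            rw [h3 i (by simpa using hi), h3 j (by simpa using hj)]
        rw [← this]; exact h2
      · funext x
        by_cases hx : x = c
        · rw [hx]; exact e
        · rw [hag φ (Finset.mem_filter.1 hφ).2 x hx, hag φ' (Finset.mem_filter.1 hφ').2 x hx]
    have h1 := Finset.card_le_mul_card_image_of_maps_to (f := ρ) (fun _ _ => Finset.mem_univ _) _ hfib
    simpa [Fintype.card_subtype_compl, Fintype.card_subtype_eq] using h1
  have h1 := (Finset.card_le_card hcov).trans (Finset.card_biUnion_le_card_mul _ _ _ fun c _ => hT c)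
  simp only [Finset.card_univ, Fintype.card_fun, Fintype.card_fin] at h1
  rcases Nat.eq_zero_or_pos r' with rfl | hr'
  · simp at h1
  · obtain ⟨q, rfl⟩ : ∃ q, r' = q + 1 := ⟨r' - 1, by omega⟩
    rw [Nat.add_sub_cancel, pow_succ, ← mul_assoc, mul_comm (r ^ q)] at h1
    have := Nat.le_of_mul_le_mul_right h1 (Nat.pow_pos (lt_of_le_of_lt (Nat.zero_le _) hr))
    omega

theorem Conn.star {ι : Type} {Z : Set V} {T : ι → Set V} {q : ι → Prop} (hZ : Conn G Z)
    (hT : ∀ i, q i → Conn G (T i)) (ha : ∀ i, q i → ∃ u ∈ Z, ∃ v ∈ T i, G.Adj u v) :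
    Conn G (Z ∪ {v | ∃ i, q i ∧ v ∈ T i}) := by
  obtain ⟨z, hz⟩ := hZ.1
  refine Conn.of_center (Or.inl hz) fun v hv => ?_
  rcases hv with hv | ⟨i, hi, hv⟩
  · exact (hZ.2 z hz v hv).mono Set.subset_union_left
  · obtain ⟨u, hu, w, hw, huw⟩ := ha i hi
    refine ((hZ.2 z hz u hu).mono Set.subset_union_left).trans ((R.adj huw (Or.inl hu) (Or.inr ⟨i, hi, hw⟩)).trans ?_)
    exact ((hT i hi).2 w hw v hv).mono fun x hx => Or.inr ⟨i, hi, hx⟩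
theorem clique_minor (p m0 r' : ℕ) : ∃ m r, 0 < m ∧ ∀ {V : Type} [Finite V] (G : SimpleGraph V) (P : Fin r → Set V), NG G p m0 →
    (∀ i, Conn G (P i)) → (∀ i j, i ≠ j → Disjoint (P i) (P j)) → (∀ i j, i ≠ j → Lk G (P i) (P j) m) →
    ∃ X : Fin r' → Set V, (∀ a, Conn G (X a)) ∧ (∀ a b, a ≠ b → Disjoint (X a) (X b)) ∧
      ∀ a b, a ≠ b → ∃ u ∈ X a, ∃ v ∈ X b, G.Adj u v := by
  classical
  obtain ⟨M, hM⟩ := sel p m0 (r' * r')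
  let m := M + 1 + r' * p
  let b := 2 ^ m * (2 * m * (m0 + 2) + 1)
  refine ⟨m, r' * (r' + r' * (r' * b)) + 1, by omega, fun {V} _ G P hng hPc hPd hL => ?_⟩
  have hH : ∀ i j, ∃ H, ∃ L : Fin m → List V, i ≠ j → ML G P (P i) (P j) m H ∧ LL H (P i) (P j) L := by
    intro i j
    by_cases hf : i ≠ j
    · obtain ⟨H, hH⟩ := ML.exists P (hL i j hf)
      obtain ⟨L, hP⟩ := hH.lk.lists
      exact ⟨H, L, fun _ => ⟨hH, hP⟩⟩
    · exact ⟨⊥, fun _ => [], fun h => absurd h hf⟩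
  choose H L hHL using hH
  obtain ⟨φ, hφ⟩ := pick_map (r' := r') (b := b) (fun i j => if i = j then ∅ else Finset.univ.filter fun c => p + 1 ≤ {l | ∃ v ∈ L i j l, v ∈ P c}.ncard)
    (fun i j => by
      split_ifs with h
      · simp
      · exact few_bad hng hPc hPd (hHL i j h).1 (hHL i j h).2 _ (fun i hi => (Finset.mem_filter.1 hi).2)) (Nat.lt_succ_self _)
  have hinj : ∀ a b, a ≠ b → φ a ≠ φ b := fun a b h => (hφ a b h.symm).1
  let Z : Fin r' → Set V := fun a => P (φ a)
  let U : Set V := {v | ∃ a, v ∈ Z a}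
  have hZd : ∀ a b, a ≠ b → Disjoint (Z a) (Z b) := fun a b h => hPd _ _ (hinj a b h)
  let Dir : Fin r' → Fin r' → Prop := fun a b => ∃ u ∈ Z a, ∃ v ∈ Z b, G.Adj u v
  let F : Finset (Fin r' × Fin r') := Finset.univ.filter fun x => x.1 < x.2 ∧ ¬ Dir x.1 x.2
  have hlink : ∀ x ∈ F, Lk (delV G U) {v | v ∉ U ∧ ∃ u ∈ Z x.1, G.Adj u v} {v | v ∉ U ∧ ∃ u ∈ Z x.2, G.Adj u v} M := by
    rintro ⟨a, c⟩ hx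
    obtain ⟨-, hlt, hnd⟩ := Finset.mem_filter.1 hx
    have hac : a ≠ c := hlt.ne
    obtain ⟨hMl, hP⟩ := hHL _ _ (hinj a c hac)
    have hfew : {l | ∃ d, d ≠ a ∧ d ≠ c ∧ ∃ v ∈ L (φ a) (φ c) l, v ∈ Z d}.ncard ≤ r' * p := by
      have h1 : {l | ∃ d, d ≠ a ∧ d ≠ c ∧ ∃ v ∈ L (φ a) (φ c) l, v ∈ Z d} ⊆
        ((Finset.univ.biUnion fun d => Finset.univ.filter fun l => d ≠ a ∧ d ≠ c ∧ ∃ v ∈ L (φ a) (φ c) l, v ∈ Z d : Finset (Fin m)) : Set (Fin m)) := by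
        rintro l ⟨d, hd⟩
        simp only [Finset.coe_biUnion, Set.mem_iUnion, Finset.coe_filter]
        exact ⟨d, Finset.mem_univ _, Finset.mem_univ _, hd⟩
      refine (Set.ncard_le_ncard h1 (Set.toFinite _)).trans ?_
      rw [Set.ncard_coe_finset]
      refine (Finset.card_biUnion_le_card_mul _ _ p fun d _ => ?_).trans_eq (by simp)
      by_cases hd : d ≠ a ∧ d ≠ c
      · have h2 := (hφ d a hd.1.symm).2 c hd.2.symm
        rw [if_neg (hinj a c hac)] at h2
        have h3 : ¬ p + 1 ≤ {l | ∃ v ∈ L (φ a) (φ c) l, v ∈ P (φ d)}.ncard := fun h => h2 (Finset.mem_filter.2 ⟨Finset.mem_univ _, h⟩)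
        rw [← Set.ncard_coe_finset]
        refine (Set.ncard_le_ncard (fun l hl => ?_) (Set.toFinite _)).trans (by omega : {l | ∃ v ∈ L (φ a) (φ c) l, v ∈ P (φ d)}.ncard ≤ p)
        exact (Finset.mem_filter.1 (Finset.mem_coe.1 hl)).2.2.2
      · rw [Finset.filter_false_of_mem fun l _ h => hd ⟨h.1, h.2.1⟩]; simp
    obtain ⟨e, he, heS⟩ := sub_idx (M := M) _ hfew (show M + r' * p ≤ m by omega)
    have key : ∀ i, ∃ C : Set V, (∀ v ∈ C, v ∈ L (φ a) (φ c) (e i)) ∧ Conn (delV G U) C ∧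
        (C ∩ {v | v ∉ U ∧ ∃ u ∈ Z a, G.Adj u v}).Nonempty ∧ (C ∩ {v | v ∉ U ∧ ∃ u ∈ Z c, G.Adj u v}).Nonempty := by
      intro i
      obtain ⟨x, hx, hx'⟩ := hP.hd (e i)
      obtain ⟨y, hy, hy'⟩ := hP.la (e i)
      have hx' := mHe hx'
      have hy' := mLa hy'
      have hR : R G {v | v ∈ L (φ a) (φ c) (e i)} x y :=
        ((chain_conn (hP.ch _) (List.ne_nil_of_mem hx')).mono_graph hMl.hg).2 x hx' y hy'
      obtain ⟨l, x, y, hl, hlx, hly, hxZ, hyZ, hls, hox, hoy⟩ := exists_IP_sets hR hx' (· ∈ Z a) (· ∈ Z c) hx hy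
      obtain ⟨l1, rfl⟩ := List.head?_eq_some_iff.1 hlx
      have hxy : x ≠ y := fun h => dsj (hZd a c hac) hxZ (h ▸ hyZ)
      rcases List.eq_nil_or_concat' l1 with rfl | ⟨l2, y', rfl⟩
      · simp at hly; exact absurd hly hxy
      obtain rfl : y' = y := by
        rw [← List.cons_append, List.getLast?_concat] at hly; simpa using hly
      have hnd' := hl.nodup
      simp only [List.nodup_cons, List.nodup_append, List.mem_append, List.mem_singleton] at hnd'
      rcases List.eq_nil_or_concat' l2 with rfl | ⟨l3, z, hz⟩
      · exact absurd ⟨x, hxZ, y', hyZ, by simpa using hl.chain⟩ hnd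
      have hne : l2 ≠ [] := by simp [hz]
      have hU : ∀ v ∈ l2, v ∉ U := by
        rintro v hv ⟨d, hd⟩
        by_cases hda : d = a
        · subst hda
          have : v = x := hox v (by simp [hv]) hd
          exact hnd'.1 (Or.inl (this ▸ hv))
        by_cases hdc : d = c
        · subst hdc
          have : v = y' := hoy v (by simp [hv]) hd
          exact hnd'.2.2.2 v hv y' rfl this
        exact heS i ⟨d, hda, hdc, v, hls v (by simp [hv]), hd⟩
      have hch := hl.chain
      rw [List.isChain_cons, List.isChain_append] at hch
      have hz2 : z ∈ l2 := by simp [hz]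
      refine ⟨{v | v ∈ l2}, fun v hv => hls v (by simp [show v ∈ l2 from hv]), ?_, ?_, ⟨z, hz2, hU z hz2, y', hyZ, ?_⟩⟩
      · exact (chain_conn hch.2.1 hne).delV (Set.disjoint_left.2 hU)
      · obtain ⟨w, l4, h4⟩ := List.exists_cons_of_ne_nil hne
        have hw : w ∈ l2 := by simp [h4]
        exact ⟨w, hw, hU w hw, x, hxZ, hch.1 w (by simp [h4])⟩
      · exact (hch.2.2.2 z (by simp [hz]) y' (by simp)).symm
    choose C hC1 hC2 using key
    refine ⟨C, hC2, fun i j hij => Set.disjoint_left.2 fun v hv hv' => ?_⟩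
    exact hP.dj _ _ (fun h => hij (he h)) v (hC1 _ _ hv) (hC1 _ _ hv')
  obtain ⟨T, hT1, hT2⟩ := hM (delV G U) F _ _ (by
    refine (Finset.card_le_univ _).trans_eq (by simp)) (hng.mono (delV_le _ _)) hlink
  have hTU : ∀ x ∈ F, Disjoint (T x) U := fun x hx => by
    obtain ⟨h1, ⟨a, ha, ha'⟩, -⟩ := hT1 x hx
    exact h1.delV_disj ha ha'.1
  refine ⟨fun a => Z a ∪ {v | ∃ c, (a, c) ∈ F ∧ v ∈ T (a, c)}, fun a => Conn.star (hPc _) (fun c hc => ?_) (fun c hc => ?_), ?_, ?_⟩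
  · exact (hT1 _ hc).1.mono_graph (delV_le _ _)
  · obtain ⟨v, hv, -, u, hu, huv⟩ := (hT1 _ hc).2.1
    exact ⟨u, hu, v, hv, huv⟩
  · intro a a' haa
    rw [Set.disjoint_left]
    rintro v (hv | ⟨c, hc, hv⟩) (hv' | ⟨c', hc', hv'⟩)
    · exact dsj (hZd a a' haa) hv hv'
    · exact dsj (hTU _ hc') hv' ⟨_, hv⟩
    · exact dsj (hTU _ hc) hv ⟨_, hv'⟩
    · exact dsj (hT2 _ hc _ hc' (by simp [haa])) hv hv'
  · have key : ∀ a c, a < c → ∃ u ∈ Z a ∪ {v | ∃ d, (a, d) ∈ F ∧ v ∈ T (a, d)}, ∃ v ∈ Z c ∪ {v | ∃ d, (c, d) ∈ F ∧ v ∈ T (c, d)}, G.Adj u v := by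
      intro a c hac
      by_cases hD : Dir a c
      · obtain ⟨u, hu, v, hv, huv⟩ := hD
        exact ⟨u, Or.inl hu, v, Or.inl hv, huv⟩
      · have hF : (a, c) ∈ F := Finset.mem_filter.2 ⟨Finset.mem_univ _, hac, hD⟩
        obtain ⟨v, hv, -, u, hu, huv⟩ := (hT1 _ hF).2.2
        exact ⟨v, Or.inr ⟨c, hF, hv⟩, u, Or.inl hu, huv.symm⟩
    intro a c hac
    rcases lt_or_gt_of_ne hac with h | h
    · exact key a c h
    · obtain ⟨u, hu, v, hv, huv⟩ := key c a h
      exact ⟨v, hv, u, hu, huv.symm⟩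
theorem grid_thm (n w : ℕ) (hn : 0 < n) : ∃ k, ∀ {V : Type} [Finite V] (G : SimpleGraph V) (ℬ : Set (Set V)), IsBr G ℬ →
    (∀ X : Set V, X.ncard ≤ k → ∃ B ∈ ℬ, Disjoint B X) → Minor G (Brick n w) := by
  obtain ⟨p, m0, hb⟩ := GridL.brick n w hn
  obtain ⟨m, r, hm, hc⟩ := clique_minor p m0 (n * w)
  refine ⟨r * m, fun {V} _ G ℬ hB ho => ?_⟩
  by_contra hno
  obtain ⟨P, h1, h2, h3⟩ := bramble_sets hB m r hm ho
  obtain ⟨X, x1, x2, x3⟩ := hc G P (fun Y Q h => hno (hb G Y Q h)) h1 h2 (fun i j _ => h3 i j)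
  exact hno ⟨fun w => X (finProdFinEquiv w), fun w => x1 _, fun w w' h => x2 _ _ fun e => h (finProdFinEquiv.injective e),
    fun w w' h => x3 _ _ fun e => h.ne (finProdFinEquiv.injective e)⟩

theorem R.induce {s C : Set V} {a b : V} (h : R G C a b) (hC : C ⊆ s) (ha : a ∈ s) (hb : b ∈ s) :
    R (G.induce s) (Subtype.val ⁻¹' C) ⟨a, ha⟩ ⟨b, hb⟩ := by
  refine h.prop (fun x => ∀ hx : x ∈ s, R (G.induce s) (Subtype.val ⁻¹' C) ⟨a, ha⟩ ⟨x, hx⟩) ?_ (fun _ => R.refl _) hb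
  intro u v huv hu hv hr hvs
  exact (hr (hC hu)).trans (R.adj (by simpa using huv) hu hv)
theorem Conn.induce {s C : Set V} (h : Conn G C) (hC : C ⊆ s) :
    Conn (G.induce s) (Subtype.val ⁻¹' C) := by
  obtain ⟨⟨a, ha⟩, h2⟩ := h
  exact ⟨⟨⟨a, hC ha⟩, ha⟩, fun x hx y hy => (h2 x hx y hy).induce hC x.2 y.2⟩
theorem R.of_induce {s : Set V} {C : Set s} {a b : s} (h : R (G.induce s) C a b) :
    R G (Subtype.val '' C) a b :=
  h.prop (fun x => R G (Subtype.val '' C) a x) (fun u v huv hu hv hr =>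
    hr.trans (R.adj (by simpa using huv) ⟨u, hu, rfl⟩ ⟨v, hv, rfl⟩)) (R.refl _)
theorem Conn.of_induce {s : Set V} {C : Set s} (h : Conn (G.induce s) C) : Conn G (Subtype.val '' C) := by
  refine ⟨h.1.image _, ?_⟩
  rintro _ ⟨x, hx, rfl⟩ _ ⟨y, hy, rfl⟩
  exact (h.2 x hx y hy).of_induce
theorem Conn.connected {s : Set V} (h : Conn G s) : (G.induce s).Connected := by
  obtain ⟨⟨a, ha⟩, h2⟩ := h
  have : Nonempty s := ⟨⟨a, ha⟩⟩
  refine ⟨fun x y => ?_⟩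
  have := (h2 x x.2 y y.2).induce subset_rfl x.2 y.2
  exact this.prop (fun z => (G.induce s).Reachable x z) (fun u v huv _ _ hr => hr.trans huv.reachable) (SimpleGraph.Reachable.refl _)
structure PT (G : SimpleGraph V) (K : ℕ) (S : Set V) (n : ℕ) (T : SimpleGraph ℕ) (χ : ℕ → Set V) : Prop where
  ac : T.IsAcyclic
  ad : ∀ i j, T.Adj i j → i < n ∧ j < n
  cn : Conn T {i | i < n}
  cd : ∀ i < n, (χ i).ncard ≤ 4 * K + 1
  sb : ∀ i < n, χ i ⊆ S
  bc : ∀ v ∈ S, Conn T {i | i < n ∧ v ∈ χ i}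
  be : ∀ u ∈ S, ∀ v ∈ S, G.Adj u v → ∃ i < n, u ∈ χ i ∧ v ∈ χ i
  ex : ∀ a ∉ S, (nbhdOfSet G (comp G Sᶜ a)).ncard ≤ 3 * K ∧ ∃ i < n, nbhdOfSet G (comp G Sᶜ a) ⊆ χ i
theorem PT.step [Finite V] {K : ℕ} (hK : 0 < K)
    (HS : ∀ W : Set V, W.ncard ≤ 3 * K → ∃ X : Set V, X.ncard ≤ K ∧ ∀ C, Conn G C → Disjoint C X → 2 * (C ∩ W).ncard ≤ W.ncard)
    {S n T χ} (h : PT G K S n T χ) {a : V} (ha : a ∉ S) : ∃ S' n' T' χ', S ⊂ S' ∧ PT G K S' n' T' χ' := by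
  classical
  obtain ⟨hW, t, ht, hWt⟩ := h.ex a ha
  have haS : a ∈ Sᶜ := ha
  set D := comp G Sᶜ a with hD
  set W := nbhdOfSet G D with hWd
  have hDc : Conn G D := comp_conn haS
  have hDS : D ⊆ Sᶜ := comp_sub
  have hWS : W ⊆ S := by
    rintro v ⟨hv, d, hd, hvd⟩
    by_contra hvS
    exact hv (comp_step hd hvS hvd.symm)
  obtain ⟨X, hX, hXC⟩ := HS W hW
  -- bound for subsets
  have hb1 : ∀ D', Conn G D' → D' ⊆ D → Disjoint D' X → (nbhdOfSet G D' ∩ W) \ X ⊆ W → 2 * ((nbhdOfSet G D' ∩ W) \ X).ncard ≤ 3 * K := by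
    intro D' hc hs hd _
    have hC : Conn G (D' ∪ {v | ∃ i : V, (i ∈ (nbhdOfSet G D' ∩ W) \ X) ∧ v ∈ ({i} : Set V)}) := by
      refine Conn.star hc (fun i _ => Conn.single i) fun i hi => ?_
      obtain ⟨⟨⟨-, d, hd, hid⟩, -⟩, -⟩ := hi
      exact ⟨d, hd, i, rfl, hid.symm⟩
    have h1 := hXC _ hC (by
      rw [Set.disjoint_left]
      rintro v (hv | ⟨i, hi, rfl⟩)
      · exact dsj hd hv
      · exact hi.2)
    have h2 : ((nbhdOfSet G D' ∩ W) \ X).ncard ≤ ((D' ∪ {v | ∃ i : V, (i ∈ (nbhdOfSet G D' ∩ W) \ X) ∧ v ∈ ({i} : Set V)}) ∩ W).ncard :=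
      Set.ncard_le_ncard (fun v hv => ⟨Or.inr ⟨v, hv, rfl⟩, hv.1.2⟩) (Set.toFinite _)
    omega
  have hX' : ∃ X' : Set V, X' ⊆ D ∧ X'.Nonempty ∧ (W ∪ X').ncard ≤ 4 * K + 1 ∧
      ∀ D', Conn G D' → D' ⊆ D → Disjoint D' X' → nbhdOfSet G D' ⊆ W ∪ X' → (nbhdOfSet G D').ncard ≤ 3 * K := by
    by_cases hne : (X ∩ D).Nonempty
    · refine ⟨X ∩ D, Set.inter_subset_right, hne, ?_, fun D' hc hs hd hN => ?_⟩
      · have h1 := Set.ncard_union_le W (X ∩ D)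
        have h2 : (X ∩ D).ncard ≤ X.ncard := Set.ncard_le_ncard Set.inter_subset_left (Set.toFinite _)
        omega
      · have h1 := hb1 D' hc hs (Set.disjoint_left.2 fun v hv hvX => dsj hd hv ⟨hvX, hs hv⟩) (fun v hv => hv.1.2)
        have h2 : (nbhdOfSet G D').ncard ≤ (((nbhdOfSet G D' ∩ W) \ X) ∪ X).ncard := Set.ncard_le_ncard (by
          intro v hv
          grind) (Set.toFinite _)
        have h3 := Set.ncard_union_le ((nbhdOfSet G D' ∩ W) \ X) X
        omega
    · have hdj : Disjoint D X := Set.disjoint_left.2 fun v hv hvX => hne ⟨v, hvX, hv⟩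
      have h1 := hb1 D hDc subset_rfl hdj (fun v hv => hv.1.2)
      have h2 : W.ncard ≤ (((nbhdOfSet G D ∩ W) \ X) ∪ X).ncard := Set.ncard_le_ncard (by
        intro v hv
        by_cases hvX : v ∈ X
        · exact Or.inr hvX
        · exact Or.inl ⟨⟨hv, hv⟩, hvX⟩) (Set.toFinite _)
      have h3 := Set.ncard_union_le ((nbhdOfSet G D ∩ W) \ X) X
      have h6 := hXC D hDc hdj
      have h4 : 2 * W.ncard ≤ 4 * K := by
        have h7 := hXC (D ∪ {v | ∃ i : V, (i ∈ W \ X) ∧ v ∈ ({i} : Set V)}) (Conn.star hDc (fun i _ => Conn.single i) fun i hi => by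
          obtain ⟨⟨-, d, hd, hid⟩, -⟩ := hi
          exact ⟨d, hd, i, rfl, hid.symm⟩) (by
          rw [Set.disjoint_left]
          rintro v (hv | ⟨i, hi, rfl⟩)
          · exact dsj hdj hv
          · exact hi.2)
        have h8 : (W \ X).ncard ≤ ((D ∪ {v | ∃ i : V, (i ∈ W \ X) ∧ v ∈ ({i} : Set V)}) ∩ W).ncard :=
          Set.ncard_le_ncard (fun v hv => ⟨Or.inr ⟨v, hv, rfl⟩, hv.1⟩) (Set.toFinite _)
        have h9 := Set.ncard_le_ncard_sdiff_add_ncard W X (Set.toFinite _)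
        omega
      have h5 := Set.ncard_union_le W {a}
      rw [Set.ncard_singleton] at h5
      refine ⟨{a}, by simpa using mem_comp haS, by simp, by omega, fun D' hc hs hd hN => ?_⟩
      have := Set.ncard_le_ncard hN (Set.toFinite _)
      omega
  obtain ⟨X', hX'D, hX'n, hX'c, hX'b⟩ := hX'
  have hX'S : ∀ v ∈ X', v ∉ S := fun v hv => hDS (hX'D hv)
  have hnT : ∀ i, ¬ T.Adj n i := fun i hi => absurd (h.ad _ _ hi).1 (lt_irrefl _)
  have hnr : ¬ T.Reachable t n := fun hr => by
    obtain ⟨p⟩ := hr.symm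
    cases p with
    | nil => exact lt_irrefl _ ht
    | cons hh _ => exact hnT _ hh
  have hadj : ∀ i j, (T ⊔ SimpleGraph.edge t n).Adj i j → i < n + 1 ∧ j < n + 1 := by
    intro i j hij
    rcases hij with hij | hij
    · have := h.ad _ _ hij; omega
    · rw [SimpleGraph.edge_adj] at hij; omega
  have htn : (T ⊔ SimpleGraph.edge t n).Adj t n := Or.inr (by rw [SimpleGraph.edge_adj]; exact ⟨Or.inl ⟨rfl, rfl⟩, ht.ne⟩)
  have hle : T ≤ T ⊔ SimpleGraph.edge t n := le_sup_left
  refine ⟨S ∪ X', n + 1, T ⊔ SimpleGraph.edge t n, Function.update χ n (W ∪ X'), ?_, ?_⟩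
  · refine ⟨Set.subset_union_left, fun hs => ?_⟩
    obtain ⟨x, hx⟩ := hX'n
    exact hX'S x hx (hs (Or.inr hx))
  have hχ : ∀ i < n, Function.update χ n (W ∪ X') i = χ i := fun i hi => Function.update_of_ne hi.ne _ _
  refine ⟨h.ac.sup_edge_of_not_reachable hnr, hadj, ?_, ?_, ?_, ?_, ?_, ?_⟩
  · have e : {i | i < n + 1} = {i | i < n} ∪ {n} := by ext i; simp; omega
    rw [e]
    exact (h.cn.mono_graph hle).union_adj (Conn.single n) ht rfl htn
  · intro i hi
    by_cases e : i = n
    · rw [e, Function.update_self]; exact hX'c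
    · rw [hχ i (by omega)]; exact h.cd i (by omega)
  · intro i hi
    by_cases e : i = n
    · rw [e, Function.update_self]; exact Set.union_subset_union_left _ hWS
    · rw [hχ i (by omega)]; exact (h.sb i (by omega)).trans Set.subset_union_left
  · have e : ∀ v, {i | i < n + 1 ∧ v ∈ Function.update χ n (W ∪ X') i} = {i | i < n ∧ v ∈ χ i} ∪ {i | i = n ∧ v ∈ W ∪ X'} := by
      intro v
      ext i
      show (i < n + 1 ∧ v ∈ Function.update χ n (W ∪ X') i) ↔ ((i < n ∧ v ∈ χ i) ∨ (i = n ∧ v ∈ W ∪ X'))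
      by_cases e : i = n
      · subst e; simp
      · grind
    intro v hv
    rw [e]
    by_cases hvX : v ∈ X'
    · rw [show {i | i < n ∧ v ∈ χ i} = ∅ from Set.eq_empty_of_forall_notMem fun i hi => hX'S v hvX (h.sb i hi.1 hi.2), Set.empty_union,
        show {i | i = n ∧ v ∈ W ∪ X'} = {n} by ext i; simp [hvX]]
      exact Conn.single n
    have hvS := hv.resolve_right hvX
    by_cases hvW : v ∈ W
    · rw [show {i | i = n ∧ v ∈ W ∪ X'} = {n} by ext i; simp [hvW]]
      exact ((h.bc v hvS).mono_graph hle).union_adj (Conn.single n) ⟨ht, hWt hvW⟩ rfl htn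
    · rw [show {i | i = n ∧ v ∈ W ∪ X'} = ∅ by ext i; simp [hvW, hvX], Set.union_empty]
      exact (h.bc v hvS).mono_graph hle
  · have key : ∀ u ∈ X', ∀ v ∈ S ∪ X', G.Adj u v → v ∈ W ∪ X' := by
      intro u hu v hv huv
      rcases hv with hv | hv
      · exact Or.inl ⟨fun h => hDS h hv, u, hX'D hu, huv.symm⟩
      · exact Or.inr hv
    intro u hu v hv huv
    by_cases huX : u ∈ X'
    · exact ⟨n, by omega, by rw [Function.update_self]; exact ⟨Or.inr huX, key u huX v hv huv⟩⟩
    by_cases hvX : v ∈ X'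
    · exact ⟨n, by omega, by rw [Function.update_self]; exact ⟨key v hvX u hu huv.symm, Or.inr hvX⟩⟩
    obtain ⟨i, hi, h1, h2⟩ := h.be u (hu.resolve_right huX) v (hv.resolve_right hvX) huv
    exact ⟨i, by omega, by rw [hχ i hi]; exact ⟨h1, h2⟩⟩
  · intro b hb
    have hbS : b ∈ Sᶜ := fun h => hb (Or.inl h)
    have hSS : (S ∪ X')ᶜ ⊆ Sᶜ := Set.compl_subset_compl.2 Set.subset_union_left
    have hD'c : Conn G (comp G (S ∪ X')ᶜ b) := comp_conn hb
    by_cases hbD : b ∈ D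
    · have hsub : comp G (S ∪ X')ᶜ b ⊆ D := hD'c.sub_comp (comp_sub.trans hSS) ⟨b, mem_comp hb, hbD⟩
      have hN : nbhdOfSet G (comp G (S ∪ X')ᶜ b) ⊆ W ∪ X' := by
        rintro v ⟨hv, d, hd, hvd⟩
        by_cases hvX : v ∈ X'
        · exact Or.inr hvX
        by_cases hvS : v ∈ S
        · exact Or.inl ⟨fun h => hDS h hvS, d, hsub hd, hvd⟩
        · exact absurd (comp_step hd (by rintro (h | h); exacts [hvS h, hvX h]) hvd.symm) hv
      exact ⟨hX'b _ hD'c hsub (Set.disjoint_left.2 fun v hv hvX => comp_sub hv (Or.inr hvX)) hN, n, by omega,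
        by rw [Function.update_self]; exact hN⟩
    · have e : comp G (S ∪ X')ᶜ b = comp G Sᶜ b := by
        apply Set.Subset.antisymm
        · exact hD'c.sub_comp (comp_sub.trans hSS) ⟨b, mem_comp hb, mem_comp hbS⟩
        · refine (comp_conn hbS).sub_comp (fun v hv => ?_) ⟨b, mem_comp hbS, mem_comp hb⟩
          rintro (h1 | h1)
          · exact comp_sub hv h1
          · exact hbD ((comp_conn hbS).sub_comp comp_sub ⟨v, hv, hX'D h1⟩ (mem_comp hbS))
      rw [e]
      obtain ⟨h1, i, hi, h2⟩ := h.ex b hbS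
      exact ⟨h1, i, by omega, by rw [hχ i hi]; exact h2⟩
theorem tw_of_sep [Finite V] {K : ℕ} (hK : 0 < K)
    (HS : ∀ W : Set V, W.ncard ≤ 3 * K → ∃ X : Set V, X.ncard ≤ K ∧ ∀ C, Conn G C → Disjoint C X → 2 * (C ∩ W).ncard ≤ W.ncard) :
    HasTreewidthAtMost G (4 * K) := by
  classical
  have h0 : ∃ n T χ, PT G K ∅ n T χ := by
    have hN : ∀ a, nbhdOfSet G (comp G (∅ : Set V)ᶜ a) = ∅ := fun a => by
      ext v
      simp only [Set.mem_empty_iff_false, iff_false]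
      rintro ⟨hv, d, hd, hvd⟩
      exact hv (comp_step hd (by simp) hvd.symm)
    refine ⟨1, ⊥, fun _ => ∅, SimpleGraph.isAcyclic_bot, by simp, ?_, by simp, by simp, by simp, by simp, fun a _ => ?_⟩
    · rw [show {i | i < 1} = {0} by ext; simp]; exact Conn.single 0
    · rw [hN]; exact ⟨by simp, 0, by simp, le_rfl⟩
  obtain ⟨S, ⟨n, T, χ, h⟩, hmax⟩ := (Set.toFinite {S : Set V | ∃ n T χ, PT G K S n T χ}).exists_maximal ⟨∅, h0⟩
  have hS : ∀ a, a ∈ S := by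
    by_contra hc
    push Not at hc
    obtain ⟨a, ha⟩ := hc
    obtain ⟨S', n', T', χ', hlt, h'⟩ := h.step hK HS ha
    grind
  refine ⟨{i | i < n}, T.induce {i | i < n}, fun i => (Set.toFinite (χ i)).toFinset, ⟨h.cn.connected, h.ac.induce _⟩, fun v => ?_, fun u v huv => ?_, fun v => ?_, fun i => ?_⟩
  · obtain ⟨i, hi, hv⟩ := (h.bc v (hS v)).1
    exact ⟨⟨i, hi⟩, by simpa using hv⟩
  · obtain ⟨i, hi, h1, h2⟩ := h.be u (hS u) v (hS v) huv
    exact ⟨⟨i, hi⟩, by simpa using h1, by simpa using h2⟩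
  · have := ((h.bc v (hS v)).induce (s := {i | i < n}) fun i hi => hi.1).connected
    rwa [show {t : {i | i < n} | v ∈ (Set.toFinite (χ t)).toFinset} = Subtype.val ⁻¹' {i | i < n ∧ v ∈ χ i} by
      ext i; simp only [Set.Finite.mem_toFinset]; grind]
  · rw [← Set.ncard_eq_toFinset_card]; exact h.cd i i.2
theorem tw_bramble [Finite V] {K : ℕ} (hK : 0 < K) (h : ¬ HasTreewidthAtMost G (4 * K)) :
    ∃ ℬ, IsBr G ℬ ∧ ∀ X : Set V, X.ncard ≤ K → ∃ B ∈ ℬ, Disjoint B X := by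
  have h1 : ¬ ∀ W : Set V, W.ncard ≤ 3 * K → ∃ X : Set V, X.ncard ≤ K ∧ ∀ C, Conn G C → Disjoint C X → 2 * (C ∩ W).ncard ≤ W.ncard :=
    fun H => h (tw_of_sep hK H)
  push Not at h1
  obtain ⟨W, -, hW⟩ := h1
  refine ⟨{C | Conn G C ∧ W.ncard < 2 * (C ∩ W).ncard}, ⟨fun B hB => hB.1, fun B hB B' hB' => Or.inl ?_⟩, fun X hX => ?_⟩
  · by_contra hne
    have hd : Disjoint (B ∩ W) (B' ∩ W) := by
      rw [Set.disjoint_left]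
      exact fun v hv hv' => hne ⟨v, hv.1, hv'.1⟩
    have h2 := Set.ncard_union_eq hd (Set.toFinite _) (Set.toFinite _)
    have h3 : ((B ∩ W) ∪ (B' ∩ W)).ncard ≤ W.ncard := Set.ncard_le_ncard (by rintro v (h | h) <;> exact h.2) (Set.toFinite _)
    grind
  · grind

theorem bypass {B D F : Set V} (hB : Conn G B) (hF : B \ D ⊆ F)
    (h : ∀ c ∈ B \ D, ∀ c' ∈ B \ D, (∃ d ∈ D, G.Adj c d) → (∃ d ∈ D, G.Adj c' d) → R G F c c') :
    ∀ u ∈ B \ D, ∀ v ∈ B \ D, R G F u v := by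
  intro u hu v hv
  have := (hB.2 u hu.1 v hv.1).prop (fun w => (w ∉ D → R G F u w) ∧
    (w ∈ D → ∃ c ∈ B \ D, (∃ d ∈ D, G.Adj c d) ∧ R G F u c)) ?_ ⟨fun _ => R.refl _, fun h => absurd h hu.2⟩
  · grind
  rintro a b hab ha hb ⟨h1, h2⟩
  by_cases haD : a ∈ D
  · obtain ⟨c, hc, hcd, hr⟩ := h2 haD
    exact ⟨fun hbD => hr.trans (h c hc b ⟨hb, hbD⟩ hcd ⟨a, haD, hab.symm⟩), fun _ => ⟨c, hc, hcd, hr⟩⟩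
  · exact ⟨fun hbD => (h1 haD).trans (R.adj hab (hF ⟨ha, haD⟩) (hF ⟨hb, hbD⟩)),
      fun hbD => ⟨a, ⟨ha, haD⟩, ⟨b, hbD, hab⟩, h1 haD⟩⟩
structure IsM (G : SimpleGraph V) (M : V → V → Prop) : Prop where
  symm : ∀ {u v}, M u v → M v u
  uniq : ∀ {u v w}, M u v → M u w → v = w
  adj : ∀ {u v}, M u v → G.Adj u v
structure MBr (G : SimpleGraph V) (M : V → V → Prop) (k : ℕ) (U : Set V) (ℬ : Set (Set V)) : Prop where
  br : IsBr G ℬ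
  sub : ∀ B ∈ ℬ, B ⊆ U
  ord : ∀ X ⊆ U, X.ncard ≤ k → ∃ B ∈ ℬ, ∀ v ∈ B, v ∉ X ∧ ∀ u ∈ X, ¬ M u v
structure Crit (G : SimpleGraph V) (M : V → V → Prop) (k : ℕ) (U : Set V) (ℬ : Set (Set V)) : Prop extends MBr G M k U ℬ where
  m : IsM G M
  min : ∀ U' ℬ', MBr G M k U' ℬ' → U' ⊆ U → U ⊆ U'
theorem Crit.exists [Finite V] {M : V → V → Prop} {k : ℕ} {U : Set V} {ℬ : Set (Set V)} (hm : IsM G M)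
    (h : MBr G M k U ℬ) : ∃ U' ⊆ U, ∃ ℬ', Crit G M k U' ℬ' := by
  obtain ⟨U', ⟨hU, ℬ', h'⟩, hmin⟩ := (Set.toFinite {U' | U' ⊆ U ∧ ∃ ℬ', MBr G M k U' ℬ'}).exists_minimal ⟨U, subset_rfl, ℬ, h⟩
  exact ⟨U', hU, ℬ', h', hm, fun U2 ℬ2 h2 hs => hmin ⟨hs.trans hU, ℬ2, h2⟩ hs⟩
theorem Crit.rl [Finite V] {M : V → V → Prop} {k : ℕ} {U D P Q B0 : Set V} {ℬ : Set (Set V)} {x : V}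
    (hc : Crit G M k U ℬ) (hDU : D ⊆ U) (hxU : x ∈ U) (hxD : x ∉ D) (hPU : P ⊆ U) (hPD : Disjoint P D) (hP : G.IsClique P)
    (hN : ∀ d ∈ D, ∀ v ∈ U, G.Adj d v → v ∈ D ∨ v = x ∨ v ∈ P)
    (hQD : Q ⊆ D) (hQ : Conn G (insert x Q))
    (hat : ∀ c ∈ P, (∃ d ∈ D, G.Adj c d) → ∃ c' ∈ P, (c' = c ∨ M c c') ∧ ∃ r ∈ insert x Q, G.Adj r c')
    (hDP : ∀ d ∈ D, ∀ p ∈ P, ¬ M d p) (hB0 : B0 ∈ ℬ) (h0 : ∀ b ∈ B0, b ∉ D ∧ b ≠ x ∧ b ∉ P) : D ⊆ Q := by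
  have hpd : ∀ p ∈ P, p ∉ D := fun p hp hd => dsj hPD hp hd
  set f : Set V → Set V := fun B => (B \ D) ∪ {v | v ∈ P ∧ ∃ p ∈ B, p ∈ P ∧ M p v} ∪ {v | v ∈ Q ∧ x ∈ B} with hf
  have f1 : ∀ B, B \ D ⊆ f B := fun B v hv => Or.inl (Or.inl hv)
  have fx : ∀ B, x ∈ B → insert x Q ⊆ f B := by
    rintro B hx v (rfl | hv)
    · exact f1 B ⟨hx, hxD⟩
    · exact Or.inr ⟨hv, hx⟩
  have fc : ∀ B, ∀ c ∈ P, c ∈ B → ∀ c' ∈ P, (c' = c ∨ M c c') → c' ∈ f B := by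
    grind
  have cP : ∀ {F : Set V} {a b}, a ∈ P → b ∈ P → a ∈ F → b ∈ F → R G F a b := by
    intro F a b ha hb haF hbF
    by_cases e : a = b
    · rw [e]; exact R.refl _
    · exact R.adj (hP ha hb e) haF hbF
  have ne : ∀ B ∈ ℬ, ∃ v ∈ B, v ∉ D := by
    intro B hB
    rcases hc.br.2 B hB B0 hB0 with ⟨v, h1, h2⟩ | ⟨a, ha, b, hb, hab⟩
    · exact ⟨v, h1, (h0 v h2).1⟩
    · refine ⟨a, ha, fun haD => ?_⟩
      have := h0 b hb
      rcases hN a haD b (hc.sub B0 hB0 hb) hab with h | h | h <;> tauto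
  have cx : ∀ B, x ∈ B → ∀ B', ∀ c ∈ P, c ∈ B' → (∃ d ∈ D, G.Adj c d) → ∃ r ∈ f B, ∃ c' ∈ f B', G.Adj r c' ∧ c' ∈ P ∧ R G (insert x Q) x r := by
    intro B hx B' c hcP hcB hcD
    obtain ⟨c', h1, h2, r, h3, h4⟩ := hat c hcP hcD
    exact ⟨r, fx B hx h3, c', fc B' c hcP hcB c' h1 h2, h4, h1, hQ.2 x (Or.inl rfl) r h3⟩
  have xc : ∀ B, x ∈ B → ∀ c ∈ P, c ∈ B → (∃ d ∈ D, G.Adj c d) → R G (f B) x c := by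
    intro B hx c hcP hcB hcD
    obtain ⟨r, h1, c', h2, h3, h4, h5⟩ := cx B hx B c hcP hcB hcD
    exact ((h5.mono (fx B hx)).trans (R.adj h3 h1 h2)).trans (cP h4 hcP h2 (f1 B ⟨hcB, hpd _ hcP⟩))
  have conn : ∀ B ∈ ℬ, Conn G (f B) := by
    intro B hB
    obtain ⟨v, hv, hvD⟩ := ne B hB
    have by1 := bypass (hc.br.1 B hB) (f1 B) (D := D) (by
      rintro c ⟨hcB, hcD⟩ c' ⟨hcB', hcD'⟩ hd hd'
      have key : ∀ c, c ∈ B → c ∉ D → (∃ d ∈ D, G.Adj c d) → c = x ∨ c ∈ P := by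
        rintro c hcB hcD ⟨d, hd, hcd⟩
        rcases hN d hd c (hc.sub B hB hcB) hcd.symm with h | h | h <;> tauto
      rcases key c hcB hcD hd with rfl | h1 <;> rcases key c' hcB' hcD' hd' with rfl | h2
      · exact R.refl _
      · exact xc B hcB c' h2 hcB' hd'
      · exact (xc B hcB' c h1 hcB hd).symm
      · grind)
    refine Conn.of_center (a := v) (f1 B ⟨hv, hvD⟩) ?_
    rintro w ((hw | ⟨hwP, p, hpB, hpP, hM⟩) | ⟨hwQ, hxB⟩)
    · exact by1 v ⟨hv, hvD⟩ w hw
    · exact (by1 v ⟨hv, hvD⟩ p ⟨hpB, hpd p hpP⟩).trans (cP hpP hwP (f1 B ⟨hpB, hpd p hpP⟩) (fc B p hpP hpB w hwP (Or.inr hM)))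
    · exact (by1 v ⟨hv, hvD⟩ x ⟨hxB, hxD⟩).trans ((hQ.2 x (Or.inl rfl) w (Or.inr hwQ)).mono (fx B hxB))
  have att : ∀ B ∈ ℬ, ∀ a ∈ B, a ∈ D → ∃ c ∈ B, (c = x ∨ c ∈ P) ∧ ∃ d ∈ D, G.Adj c d := by
    intro B hB a ha haD
    obtain ⟨v, hv, hvD⟩ := ne B hB
    obtain ⟨u, w, h1, h2, h3, h4, h5⟩ := ((hc.br.1 B hB).2 a ha v hv).cross (· ∈ D) haD hvD
    exact ⟨w, h3, (hN u h4 w (hc.sub B hB h3) h1).resolve_left h5, u, h4, h1.symm⟩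
  have tch0 : ∀ B c, c ∈ B → ∀ B' c', c' ∈ B' → (c = x ∨ c ∈ P) → (∃ d ∈ D, G.Adj c d) → (c' = x ∨ c' ∈ P) →
      (∃ d ∈ D, G.Adj c' d) → Touch G (f B) (f B') := by
    intro B c hcB B' c' hcB' h1 hd h2 hd'
    rcases h1 with rfl | h1 <;> rcases h2 with rfl | h2
    · exact Or.inl ⟨_, fx B hcB (Or.inl rfl), fx B' hcB' (Or.inl rfl)⟩
    · obtain ⟨r, h1, c', h2, h3, -⟩ := cx B hcB B' c' h2 hcB' hd'
      exact Or.inr ⟨r, h1, c', h2, h3⟩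
    · obtain ⟨r, h1, c', h2, h3, -⟩ := cx B' hcB' B c h1 hcB hd
      exact Or.inr ⟨c', h2, r, h1, h3.symm⟩
    · by_cases e : c = c'
      · subst e; exact Or.inl ⟨c, f1 B ⟨hcB, hpd c h1⟩, f1 B' ⟨hcB', hpd c h1⟩⟩
      · exact Or.inr ⟨c, f1 B ⟨hcB, hpd c h1⟩, c', f1 B' ⟨hcB', hpd c' h2⟩, hP h1 h2 e⟩
  have tch : ∀ B ∈ ℬ, ∀ B' ∈ ℬ, Touch G (f B) (f B') := by
    intro B hB B' hB'
    have two : ∀ B ∈ ℬ, ∀ B' ∈ ℬ, ∀ a ∈ B, ∀ b ∈ B', a ∈ D → G.Adj a b ∨ a = b → Touch G (f B) (f B') := by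
      intro B hB B' hB' a ha b hb haD hab
      obtain ⟨c, hc1, hc2, hc3⟩ := att B hB a ha haD
      by_cases hbD : b ∈ D
      · obtain ⟨c', hc1', hc2', hc3'⟩ := att B' hB' b hb hbD
        exact tch0 B c hc1 B' c' hc1' hc2 hc3 hc2' hc3'
      · have hab : G.Adj a b := hab.resolve_right (fun e => hbD (e ▸ haD))
        exact tch0 B c hc1 B' b hb hc2 hc3 ((hN a haD b (hc.sub B' hB' hb) hab).resolve_left hbD) ⟨a, haD, hab.symm⟩
    have sym : ∀ {A C : Set V}, Touch G A C → Touch G C A := by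
      rintro A C (⟨v, h1, h2⟩ | ⟨a, ha, b, hb, h⟩)
      · exact Or.inl ⟨v, h2, h1⟩
      · exact Or.inr ⟨b, hb, a, ha, h.symm⟩
    rcases hc.br.2 B hB B' hB' with ⟨v, h1, h2⟩ | ⟨a, ha, b, hb, hab⟩
    · by_cases hv : v ∈ D
      · exact two B hB B' hB' v h1 v h2 hv (Or.inr rfl)
      · exact Or.inl ⟨v, f1 B ⟨h1, hv⟩, f1 B' ⟨h2, hv⟩⟩
    · by_cases haD : a ∈ D
      · exact two B hB B' hB' a ha b hb haD (Or.inl hab)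
      by_cases hbD : b ∈ D
      · exact sym (two B' hB' B hB b hb a ha hbD (Or.inl hab.symm))
      · exact Or.inr ⟨a, f1 B ⟨ha, haD⟩, b, f1 B' ⟨hb, hbD⟩, hab⟩
  have main : MBr G M k ((U \ D) ∪ Q) (f '' ℬ) := by
    refine ⟨⟨?_, ?_⟩, ?_, ?_⟩
    · rintro _ ⟨B, hB, rfl⟩; exact conn B hB
    · rintro _ ⟨B, hB, rfl⟩ _ ⟨B', hB', rfl⟩; exact tch B hB B' hB'
    · rintro _ ⟨B, hB, rfl⟩ v ((hv | hv) | hv)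
      · exact Or.inl ⟨hc.sub B hB hv.1, hv.2⟩
      · exact Or.inl ⟨hPU hv.1, hpd v hv.1⟩
      · exact Or.inr hv.1
    · intro X' hX' hk
      have hsub : X' ⊆ U := hX'.trans (Set.union_subset Set.sdiff_subset (hQD.trans hDU))
      obtain ⟨X, hXU, hXc, hX1, hX2⟩ : ∃ X ⊆ U, X.ncard ≤ k ∧ X' \ D ⊆ X ∧ ((∃ d ∈ X', d ∈ D) → x ∈ X) := by
        by_cases hd : ∃ d ∈ X', d ∈ D
        · obtain ⟨d, hd, hdD⟩ := hd
          refine ⟨insert x (X' \ D), Set.insert_subset hxU (Set.sdiff_subset.trans hsub), ?_, Set.subset_insert _ _, fun _ => Or.inl rfl⟩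
          have h1 : (X' \ D).ncard < X'.ncard := Set.ncard_lt_ncard ⟨Set.sdiff_subset, fun h => (h hd).2 hdD⟩ (Set.toFinite _)
          have h2 := Set.ncard_insert_le x (X' \ D)
          omega
        · exact ⟨X', hsub, hk, Set.sdiff_subset, fun h => absurd h hd⟩
      obtain ⟨B, hB, hBX⟩ := hc.ord X hXU hXc
      refine ⟨f B, ⟨B, hB, rfl⟩, ?_⟩
      rintro v ((⟨hv, hvD⟩ | ⟨hvP, p, hpB, hpP, hM⟩) | ⟨hvQ, hxB⟩)
      · refine ⟨fun h => (hBX v hv).1 (hX1 ⟨h, hvD⟩), fun u hu hM => ?_⟩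
        by_cases huD : u ∈ D
        · rcases hN u huD v (hc.sub B hB hv) (hc.m.adj hM) with h | rfl | h
          · exact hvD h
          · exact (hBX v hv).1 (hX2 ⟨u, hu, huD⟩)
          · exact hDP u huD v h hM
        · exact (hBX v hv).2 u (hX1 ⟨hu, huD⟩) hM
      · refine ⟨fun h => (hBX p hpB).2 v (hX1 ⟨h, hpd v hvP⟩) (hc.m.symm hM), fun u hu hM' => ?_⟩
        obtain rfl := hc.m.uniq (hc.m.symm hM') (hc.m.symm hM)
        exact (hBX u hpB).1 (hX1 ⟨hu, hpd u hpP⟩)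
      · have hno : ∀ d ∈ X', d ∉ D := fun d hd hdD => (hBX x hxB).1 (hX2 ⟨d, hd, hdD⟩)
        refine ⟨fun h => hno v h (hQD hvQ), fun u hu hM => ?_⟩
        rcases hN v (hQD hvQ) u (hsub hu) (hc.m.adj hM).symm with h | rfl | h
        · exact hno u hu h
        · exact (hBX u hxB).1 (hX1 ⟨hu, hno u hu⟩)
        · exact hDP v (hQD hvQ) u h (hc.m.symm hM)
  intro d hd
  rcases hc.min _ _ main (Set.union_subset Set.sdiff_subset (hQD.trans hDU)) (hDU hd) with h | h
  · exact absurd hd h.2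
  · exact h

theorem MBr.induce [Finite V] {M : V → V → Prop} {k : ℕ} {U : Set V} {ℬ : Set (Set V)} (h : MBr G M k U ℬ) :
    MBr (G.induce U) (fun a b => M a b) k Set.univ ((Subtype.val ⁻¹' ·) '' ℬ) := by
  refine ⟨⟨?_, ?_⟩, fun _ _ => Set.subset_univ _, fun X _ hX => ?_⟩
  · rintro _ ⟨B, hB, rfl⟩; exact (h.br.1 B hB).induce (h.sub B hB)
  · rintro _ ⟨B, hB, rfl⟩ _ ⟨B', hB', rfl⟩
    rcases h.br.2 B hB B' hB' with ⟨v, h1, h2⟩ | ⟨a, ha, b, hb, hab⟩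
    · exact Or.inl ⟨⟨v, h.sub B hB h1⟩, h1, h2⟩
    · exact Or.inr ⟨⟨a, h.sub B hB ha⟩, ha, ⟨b, h.sub B' hB' hb⟩, hb, by simpa using hab⟩
  · obtain ⟨B, hB, h1⟩ := h.ord (Subtype.val '' X) (by grind)
      ((Set.ncard_image_le (Set.toFinite _)).trans hX)
    exact ⟨_, ⟨B, hB, rfl⟩, fun v hv => ⟨fun hX => (h1 v hv).1 ⟨v, hX, rfl⟩, fun u hu => (h1 v hv).2 u ⟨u, hu, rfl⟩⟩⟩
theorem MBr.of_induce [Finite V] {M : V → V → Prop} {k : ℕ} {s : Set V} {U : Set s} {ℬ : Set (Set s)}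
    (h : MBr (G.induce s) (fun a b => M a b) k U ℬ) : MBr G M k (Subtype.val '' U) ((Subtype.val '' ·) '' ℬ) := by
  refine ⟨⟨?_, ?_⟩, ?_, fun X hXU hX => ?_⟩
  · rintro _ ⟨B, hB, rfl⟩; exact (h.br.1 B hB).of_induce
  · rintro _ ⟨B, hB, rfl⟩ _ ⟨B', hB', rfl⟩
    rcases h.br.2 B hB B' hB' with ⟨v, h1, h2⟩ | ⟨a, ha, b, hb, hab⟩
    · exact Or.inl ⟨v, ⟨v, h1, rfl⟩, ⟨v, h2, rfl⟩⟩
    · exact Or.inr ⟨a, ⟨a, ha, rfl⟩, b, ⟨b, hb, rfl⟩, by simpa using hab⟩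
  · rintro _ ⟨B, hB, rfl⟩; exact Set.image_mono (h.sub B hB)
  · have hX' : Subtype.val '' (Subtype.val ⁻¹' X : Set s) = X := by
      rw [Subtype.image_preimage_coe]
      grind
    obtain ⟨B, hB, h1⟩ := h.ord (Subtype.val ⁻¹' X) (fun x hx => by
        grind) (by
        rw [← Set.ncard_image_of_injective _ Subtype.val_injective, hX']; exact hX)
    refine ⟨_, ⟨B, hB, rfl⟩, ?_⟩
    grind
theorem Crit.induce [Finite V] {M : V → V → Prop} {k : ℕ} {U : Set V} {ℬ : Set (Set V)} (h : Crit G M k U ℬ) :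
    Crit (G.induce U) (fun a b => M a b) k Set.univ ((Subtype.val ⁻¹' ·) '' ℬ) := by
  refine ⟨h.toMBr.induce, ⟨fun h' => h.m.symm h', fun h1 h2 => Subtype.ext (h.m.uniq h1 h2), fun h1 => by simpa using h.m.adj h1⟩, fun U' ℬ' h' _ v _ => ?_⟩
  obtain ⟨y, hy, e⟩ := h.min _ _ h'.of_induce (by grind) v.2
  grind
theorem IP_walk {u v : V} (p : G.Walk u v) (h : IP G p.support) : IsIPath G p := by
  refine ⟨SimpleGraph.Walk.IsPath.mk' h.nodup, ?_⟩
  induction p with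
  | nil =>
    intro a ha b hb hab
    simp at ha hb
    subst ha; subst hb
    exact absurd hab (G.irrefl)
  | @cons u w v hadj p ih =>
    rw [SimpleGraph.Walk.support_cons] at h
    have key : ∀ b ∈ p.support, G.Adj u b → b = w := fun b hb hub => by
      have := ((h.1 b hb).2.1 hub)
      rw [show p.support.head? = some w by cases p <;> simp] at this
      grind
    intro a ha b hb hab
    simp only [SimpleGraph.Walk.mem_verts_toSubgraph, SimpleGraph.Walk.support_cons, List.mem_cons] at ha hb
    simp only [SimpleGraph.Walk.toSubgraph, SimpleGraph.Subgraph.sup_adj, SimpleGraph.subgraphOfAdj_adj]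
    rcases ha with rfl | ha <;> rcases hb with rfl | hb
    · exact absurd hab G.irrefl
    · grind
    · rw [key a ha hab.symm]; grind
    · exact Or.inr (ih h.2 (by simpa using ha) (by simpa using hb) hab)
theorem IP_exists_walk {l : List V} {a b : V} (h : IP G l) (ha : l.head? = some a) (hb : l.getLast? = some b) :
    ∃ p : G.Walk a b, p.support = l := by
  induction l generalizing a with
  | nil => simp at ha
  | cons c l ih =>
    simp at ha; subst ha
    cases l with
    | nil => simp at hb; subst hb; exact ⟨.nil, rfl⟩
    | cons d l =>
      obtain ⟨p, hp⟩ := ih (a := d) h.2 (by simp) (by simpa using hb)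
      exact ⟨.cons ((h.1 d (by simp)).2.2 (by simp)) p, by simp [hp]⟩
/-- hole in path form -/
def HL (G : SimpleGraph V) (x : V) (l : List V) : Prop :=
  IP G l ∧ 3 ≤ l.length ∧ x ∉ l ∧ ∀ v ∈ l, G.Adj x v ↔ l.head? = some v ∨ l.getLast? = some v
def SpL (G : SimpleGraph V) : Prop := ∀ x l, HL G x l → ∀ w, w ≠ x → w ∉ l → ∀ y ∈ x :: l, ∀ z ∈ x :: l,
  G.Adj w y → G.Adj w z → y ≠ z → G.Adj y z
def Xc (G : SimpleGraph V) (l l' : List V) (b b' : V) : Prop := ∀ p ∈ l, ∀ q ∈ l', p ≠ q ∧ (G.Adj p q → p = b ∧ q = b')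
def NoPyr (G : SimpleGraph V) : Prop := ∀ a l₁ l₂ l₃ b₁ b₂ b₃, G.Adj b₁ b₂ → G.Adj b₂ b₃ → G.Adj b₁ b₃ →
  IP G (a :: l₁) → IP G (a :: l₂) → IP G (a :: l₃) → l₁.getLast? = some b₁ → l₂.getLast? = some b₂ → l₃.getLast? = some b₃ →
  ¬ (l₁.length = 1 ∧ l₂.length = 1) → ¬ (l₁.length = 1 ∧ l₃.length = 1) → ¬ (l₂.length = 1 ∧ l₃.length = 1) →
  Xc G l₁ l₂ b₁ b₂ → Xc G l₁ l₃ b₁ b₃ → Xc G l₂ l₃ b₂ b₃ → False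
def Xd (G : SimpleGraph V) (l l' : List V) (a a' b b' : V) : Prop :=
  ∀ p ∈ l, ∀ q ∈ l', p ≠ q ∧ (G.Adj p q → (p = a ∧ q = a') ∨ (p = b ∧ q = b'))
def NoPri (G : SimpleGraph V) : Prop := ∀ l₁ l₂ l₃ a₁ a₂ a₃ b₁ b₂ b₃, G.Adj a₁ a₂ → G.Adj a₂ a₃ → G.Adj a₁ a₃ →
  G.Adj b₁ b₂ → G.Adj b₂ b₃ → G.Adj b₁ b₃ → IP G l₁ → IP G l₂ → IP G l₃ →
  l₁.head? = some a₁ → l₂.head? = some a₂ → l₃.head? = some a₃ →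
  l₁.getLast? = some b₁ → l₂.getLast? = some b₂ → l₃.getLast? = some b₃ → 2 ≤ l₁.length → 2 ≤ l₂.length → 2 ≤ l₃.length →
  Xd G l₁ l₂ a₁ a₂ b₁ b₂ → Xd G l₁ l₃ a₁ a₃ b₁ b₃ → Xd G l₂ l₃ a₂ a₃ b₂ b₃ → False
theorem wlen {a b : V} {p : G.Walk a b} {l : List V} (h : p.support = l) : p.length + 1 = l.length := by
  grind
theorem noPyr_of (h : ¬ ContainsPyramid G) : NoPyr G := by
  intro a l₁ l₂ l₃ b₁ b₂ b₃ e12 e23 e13 i1 i2 i3 t1 t2 t3 n12 n13 n23 x12 x13 x23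
  have la : ∀ {l : List V} {b : V}, l.getLast? = some b → (a :: l).getLast? = some b := by
    grind
  obtain ⟨P1, h1⟩ := IP_exists_walk i1 rfl (la t1)
  obtain ⟨P2, h2⟩ := IP_exists_walk i2 rfl (la t2)
  obtain ⟨P3, h3⟩ := IP_exists_walk i3 rfl (la t3)
  have w1 := wlen h1; have w2 := wlen h2; have w3 := wlen h3
  simp only [List.length_cons] at w1 w2 w3
  have p1 := List.length_pos_of_mem (mLa t1)
  have p2 := List.length_pos_of_mem (mLa t2)
  have p3 := List.length_pos_of_mem (mLa t3)
  have ml : ∀ {l : List V} {p}, p ∈ a :: l → p ≠ a → p ∈ l := fun h h' => (mCo h).resolve_left h'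
  refine h ⟨a, b₁, b₂, b₃, P1, P2, P3, e12, e23, e13, IP_walk _ (h1 ▸ i1), IP_walk _ (h2 ▸ i2), IP_walk _ (h3 ▸ i3), by omega, by omega, by omega,
    by omega, by omega, by omega, ?_, ?_, ?_⟩
  · rw [h1, h2]; exact fun p hp hpa q hq hqa => x12 p (ml hp hpa) q (ml hq hqa)
  · rw [h1, h3]; exact fun p hp hpa q hq hqa => x13 p (ml hp hpa) q (ml hq hqa)
  · rw [h2, h3]; exact fun p hp hpa q hq hqa => x23 p (ml hp hpa) q (ml hq hqa)
theorem noPri_of (h : ¬ ContainsPrism G) : NoPri G := by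
  intro l₁ l₂ l₃ a₁ a₂ a₃ b₁ b₂ b₃ f12 f23 f13 e12 e23 e13 i1 i2 i3 s1 s2 s3 t1 t2 t3 n1 n2 n3 x12 x13 x23
  obtain ⟨P1, h1⟩ := IP_exists_walk i1 s1 t1
  obtain ⟨P2, h2⟩ := IP_exists_walk i2 s2 t2
  obtain ⟨P3, h3⟩ := IP_exists_walk i3 s3 t3
  have w1 := wlen h1; have w2 := wlen h2; have w3 := wlen h3
  subst h1; subst h2; subst h3
  exact h ⟨a₁, a₂, a₃, b₁, b₂, b₃, P1, P2, P3, f12, f23, f13, e12, e23, e13, IP_walk _ i1, IP_walk _ i2, IP_walk _ i3, by omega, by omega, by omega,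
    x12, x13, x23⟩
theorem spL_of (h : Sparse G) : SpL G := by
  rintro x l ⟨hl, hlen, hx, hadj⟩ w hwx hwl y hy z hz hwy hwz hyz
  have hne : l ≠ [] := by grind
  obtain ⟨a, ha⟩ : ∃ a, l.head? = some a := ⟨_, List.head?_eq_some_head hne⟩
  obtain ⟨b, hb⟩ : ∃ b, l.getLast? = some b := ⟨_, List.getLast?_eq_some_getLast hne⟩
  obtain ⟨p, hp⟩ := IP_exists_walk hl ha hb
  have hxa : G.Adj x a := (hadj a (mHe ha)).2 (Or.inl ha)
  have hxb : G.Adj x b := (hadj b (mLa hb)).2 (Or.inr hb)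
  have hpI := IP_walk p (hp ▸ hl)
  have hab : a ≠ b := by
    rintro rfl
    have h1 := SimpleGraph.Walk.nil_iff_length_eq.1 (SimpleGraph.Walk.isPath_iff_nil.1 hpI.1)
    grind
  let c : G.Walk x x := .cons hxa (p.concat hxb.symm)
  have hs : ∀ v, v ∈ c.support ↔ v = x ∨ v ∈ l := by
    intro v
    simp only [c, SimpleGraph.Walk.support_cons, SimpleGraph.Walk.support_concat, hp, List.mem_cons, List.mem_append]
    simp; tauto
  have hcA : ∀ u v, c.toSubgraph.Adj u v ↔ s(x, a) = s(u, v) ∨ p.toSubgraph.Adj u v ∨ s(b, x) = s(u, v) := by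
    intro u v
    rw [← SimpleGraph.Subgraph.mem_edgeSet, ← SimpleGraph.Subgraph.mem_edgeSet, SimpleGraph.Walk.mem_edges_toSubgraph, SimpleGraph.Walk.mem_edges_toSubgraph]
    simp [c, SimpleGraph.Walk.edges_concat, eq_comm]
  have hcyc : IsHole G c := by
    refine ⟨?_, ?_, ?_⟩
    · rw [SimpleGraph.Walk.cons_isCycle_iff]
      refine ⟨hpI.1.concat (by rw [hp]; exact hx) _, ?_⟩
      rw [SimpleGraph.Walk.edges_concat]
      simp only [List.concat_eq_append, List.mem_append, List.mem_singleton, not_or]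
      refine ⟨fun h => hx (hp ▸ p.fst_mem_support_of_mem_edges h), ?_⟩
      grind
    · have := wlen hp
      simp [c]; omega
    · intro u hu v hv huv
      rw [SimpleGraph.Walk.mem_verts_toSubgraph, hs] at hu hv
      rw [hcA]
      have key : ∀ v ∈ l, G.Adj x v → v = a ∨ v = b := fun v hv h => by
        grind
      rcases hu with rfl | hu <;> rcases hv with rfl | hv
      · exact absurd huv G.irrefl
      · grind
      · rcases key u hu huv.symm with rfl | rfl
        · exact Or.inl Sym2.eq_swap
        · grind
      · exact Or.inr (Or.inl (hpI.2 (by simpa [hp] using hu) (by simpa [hp] using hv) huv))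
  obtain ⟨a', b', h1, h2⟩ := h x c hcyc w (by rw [hs]; tauto)
  have hy' := h2 y ((hs y).2 (mCo hy)) hwy
  have hz' := h2 z ((hs z).2 (mCo hz)) hwz
  have h3 := c.toSubgraph.adj_sub h1
  rcases hy' with rfl | rfl <;> rcases hz' with rfl | rfl
  · exact absurd rfl hyz
  · exact h3
  · exact h3.symm
  · exact absurd rfl hyz
theorem IP_map {s : Set V} {l : List s} : IP G (l.map Subtype.val) ↔ IP (G.induce s) l := by
  induction l with
  | nil => simp [IP]
  | cons a l ih =>
    simp only [List.map_cons, IP, ih]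
    refine and_congr_left fun _ => ?_
    rw [List.head?_map]
    simp only [List.mem_map, forall_exists_index, and_imp, forall_apply_eq_imp_iff₂]
    refine forall₂_congr fun b _ => ?_
    cases l.head? <;> simp [Subtype.ext_iff]
def VSL (G : SimpleGraph V) : Prop := SpL G ∧ NoPyr G ∧ NoPri G
theorem VSL.induce (h : VSL G) (s : Set V) : VSL (G.induce s) := by
  obtain ⟨h1, h2, h3⟩ := h
  have xc : ∀ {l l' : List s} {b b'}, Xc (G.induce s) l l' b b' → Xc G (l.map (↑)) (l'.map (↑)) b b' := by
    intro l l' b b' h p hp q hq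
    rw [List.mem_map] at hp hq
    obtain ⟨p, hp, rfl⟩ := hp; obtain ⟨q, hq, rfl⟩ := hq
    have := h p hp q hq
    simpa [Subtype.ext_iff] using this
  have xd : ∀ {l l' : List s} {a a' b b'}, Xd (G.induce s) l l' a a' b b' → Xd G (l.map (↑)) (l'.map (↑)) a a' b b' := by
    intro l l' a a' b b' h p hp q hq
    rw [List.mem_map] at hp hq
    obtain ⟨p, hp, rfl⟩ := hp; obtain ⟨q, hq, rfl⟩ := hq
    have := h p hp q hq
    simpa [Subtype.ext_iff] using this
  have la : ∀ {l : List s} {b}, l.getLast? = some b → (l.map Subtype.val).getLast? = some b.1 := fun h => by grind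
  have he : ∀ {l : List s} {b}, l.head? = some b → (l.map Subtype.val).head? = some b.1 := fun h => by simp only [List.getLast?_map, List.head?_map, h, Option.map_some]
  refine ⟨?_, ?_, ?_⟩
  · rintro x l ⟨i1, i2, i3, i4⟩ w hwx hwl y hy z hz hwy hwz hyz
    have := h1 x (l.map (↑)) ⟨IP_map.2 i1, by simpa using i2, by simpa using i3, by
      intro v hv
      rw [List.mem_map] at hv
      obtain ⟨v, hv, rfl⟩ := hv
      have := i4 v hv
      rw [List.getLast?_map, List.head?_map]
      cases h5 : l.head? <;> cases h6 : l.getLast? <;> simpa [Subtype.ext_iff, h5, h6] using this⟩ w (by simpa [Subtype.ext_iff] using hwx) (by simpa using hwl)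
      y (by simpa [Subtype.ext_iff] using hy) z (by simpa [Subtype.ext_iff] using hz) (by simpa using hwy) (by simpa using hwz) (by simpa [Subtype.ext_iff] using hyz)
    simpa using this
  · intro a l₁ l₂ l₃ b₁ b₂ b₃ e12 e23 e13 i1 i2 i3 t1 t2 t3 n12 n13 n23 x12 x13 x23
    exact h2 a (l₁.map (↑)) (l₂.map (↑)) (l₃.map (↑)) b₁ b₂ b₃ e12 e23 e13 (by simpa using IP_map.2 i1) (by simpa using IP_map.2 i2)
      (by simpa using IP_map.2 i3) (la t1) (la t2) (la t3) (by simpa using n12) (by simpa using n13) (by simpa using n23) (xc x12) (xc x13) (xc x23)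
  · intro l₁ l₂ l₃ a₁ a₂ a₃ b₁ b₂ b₃ f12 f23 f13 e12 e23 e13 i1 i2 i3 s1 s2 s3 t1 t2 t3 n1 n2 n3 x12 x13 x23
    exact h3 (l₁.map (↑)) (l₂.map (↑)) (l₃.map (↑)) a₁ a₂ a₃ b₁ b₂ b₃ f12 f23 f13 e12 e23 e13 (IP_map.2 i1) (IP_map.2 i2) (IP_map.2 i3)
      (he s1) (he s2) (he s3) (la t1) (la t2) (la t3) (by simpa using n1) (by simpa using n2) (by simpa using n3) (xd x12) (xd x13) (xd x23)

theorem IP.join {l₁ l₂ : List V} {u v : V} (h1 : IP G l₁) (h2 : IP G l₂) (hu : l₁.getLast? = some u)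
    (hv : l₂.head? = some v) (ha : G.Adj u v) (hx : Xc G l₁ l₂ u v) : IP G (l₁ ++ l₂) := by
  refine IP_append.2 ⟨h1, h2, fun a ha' b hb => ⟨(hx a ha' b hb).1, fun h => ?_, ?_⟩⟩
  · obtain ⟨rfl, rfl⟩ := (hx a ha' b hb).2 h; grind
  · grind
theorem IP.single (a : V) : IP G [a] := by simp [IP]
theorem HL.mk' {x u v : V} {l : List V} (h : IP G l) (hl : 3 ≤ l.length) (hx : x ∉ l) (hu : l.head? = some u)
    (hv : l.getLast? = some v) (hxu : G.Adj x u) (hxv : G.Adj x v) (hw : ∀ w ∈ l, G.Adj x w → w = u ∨ w = v) : HL G x l := by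
  refine ⟨h, hl, hx, fun w hw' => ?_⟩
  grind
theorem R.exit {s : Set V} {a b : V} (h : R G s a b) (p : V → Prop) (ha : p a) (hb : ¬ p b) :
    ∃ u v, R G {w | w ∈ s ∧ p w} a u ∧ G.Adj u v ∧ u ∈ s ∧ v ∈ s ∧ p u ∧ ¬ p v := by
  by_contra hc
  refine hb (h.prop (fun w => p w ∧ R G {w | w ∈ s ∧ p w} a w) ?_ ⟨ha, R.refl _⟩).1
  rintro u v huv hu hv ⟨h1, h2⟩
  by_cases hpv : p v
  · exact ⟨hpv, h2.trans (R.adj huv ⟨hu, h1⟩ ⟨hv, hpv⟩)⟩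
  · grind
theorem getLast?_ac {l₁ l₂ : List V} {a : V} : (l₁ ++ a :: l₂).getLast? = (a :: l₂).getLast? := by
  grind
theorem tri1 (hs : SpL G) {h Q Q1 Q2 : List V} {a c γ q qj : V} (hh : IP G h) (hγ : h.getLast? = some γ)
    (hQ : IP G Q) (hq : Q.getLast? = some q) (hch : c ∉ h) (hcQ : c ∉ Q) (hah : a ∉ h) (haQ : a ∉ Q) (hac : G.Adj a c)
    (hcγ : G.Adj c γ) (hc : ∀ v ∈ h, G.Adj c v → v = γ) (hQh : ∀ u ∈ Q, ∀ v ∈ h, u ≠ v ∧ (G.Adj u v → u = q))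
    (hqh : ∃ v ∈ h, G.Adj q v) (e : Q = Q1 ++ qj :: Q2) (hqj : G.Adj c qj) (hQ2 : ∀ v ∈ Q2, ¬ G.Adj c v) : ∀ v ∈ Q2, ¬ G.Adj a v := by
  intro v hv hav
  obtain ⟨h1, d, h2, rfl, hd, hh2⟩ := split_last _ hqh
  subst e
  rw [getLast?_ac] at hγ hq
  have hl : IP G ((qj :: Q2) ++ (d :: h2)) := hQ.right.join hh.right hq rfl hd (by
    intro x hx y hy
    grind)
  have hH : HL G c ((qj :: Q2) ++ (d :: h2)) := HL.mk' hl (by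
      have := List.length_pos_of_mem hv
      simp; omega) (by grind) rfl (by rw [getLast?_ac]; exact hγ) hqj hcγ (by
    grind)
  have hvc : c ≠ v := by rintro rfl; exact hcQ (by simp; tauto)
  exact hQ2 v hv (hs c _ hH a hac.ne (by grind) c (by simp) v (by simp; tauto) hac hav hvc)
set_option maxHeartbeats 1000000 in
theorem tri2 (hs : VSL G) {h : List V} {a b c α γ : V} (hh : IP G h) (h2l : 2 ≤ h.length) (hα : h.head? = some α) (hγ : h.getLast? = some γ)
    (hah : a ∉ h) (hch : c ∉ h) (hbh : b ∉ h) (hac : G.Adj a c) (hab : G.Adj a b) (hcb : G.Adj c b) (haα : G.Adj a α) (hcγ : G.Adj c γ)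
    (ha : ∀ v ∈ h, G.Adj a v → v = α) (hc : ∀ v ∈ h, G.Adj c v → v = γ) (hR : R G {v | v ≠ a ∧ v ≠ c} b α) : False := by
  obtain ⟨hS, hpyr, hpri⟩ := hs
  have hαh := mHe hα
  have hγh := mLa hγ
  have hαγ : α ≠ γ := by
    rintro rfl
    obtain ⟨l, rfl⟩ := List.head?_eq_some_iff.1 hα
    cases l with
    | nil => simp at h2l
    | cons d l => exact (hh.1 α (mLa (by simpa using hγ))).1 rfl
  have hH : HL G a (h ++ [c]) := HL.mk' (hh.join (IP.single c) hγ rfl hcγ.symm (by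
      intro x hx y hy
      rw [List.mem_singleton] at hy; subst hy
      exact ⟨fun e => hch (e ▸ hx), fun h => ⟨hc x hx h.symm, rfl⟩⟩)) (by simp; omega) (by simp [hah, hac.ne]) (by simp [hα]) (by simp) haα hac (by
    grind)
  obtain ⟨u, v, hRu, huv, -, -, hu, hv⟩ := hR.exit (· ∉ h) hbh (not_not.2 hαh)
  rw [not_not] at hv
  obtain ⟨Q, b', q, hQ, hb', hq, hb'', ⟨hqh', hqh⟩, hQs, -, hQq⟩ := exists_IP_sets hRu ⟨⟨hab.ne', hcb.ne'⟩, hbh⟩ (· = b) (fun w => w ∉ h ∧ ∃ v ∈ h, G.Adj w v) rfl ⟨hu, v, hv, huv⟩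
  subst hb''
  have haQ : a ∉ Q := fun h => (hQs a h).1.1 rfl
  have hcQ : c ∉ Q := fun h => (hQs c h).1.2 rfl
  have hQh : ∀ u ∈ Q, ∀ v ∈ h, u ≠ v ∧ (G.Adj u v → u = q) := fun u hu v hv =>
    ⟨fun e => (hQs u hu).2 (e ▸ hv), fun huv => hQq u hu ⟨(hQs u hu).2, v, hv, huv⟩⟩
  obtain ⟨Q1, w, Q2, e, hcw, hQ2⟩ := split_last (G.Adj c) ⟨b', mHe hb', hcb⟩
  have hQa := tri1 hS hh hγ hQ hq hch hcQ hah haQ hac hcγ hc hQh hqh e hcw hQ2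
  have haw : G.Adj a w := by
    by_contra haw
    obtain ⟨Q3, w', Q4, e', haw', hQ4⟩ := split_last (G.Adj a) ⟨b', mHe hb', hab⟩
    have hQc := tri1 hS (IP_reverse.2 hh) (by simpa using hα) hQ hq (by simpa using hah) haQ (by simpa using hch) hcQ hac.symm haα (by simpa using ha)
      (by simpa using hQh) (by simpa using hqh) e' haw' hQ4
    have hw4 : w ∈ Q4 := by
      rw [e'] at e
      rcases List.append_eq_append_iff.1 e with ⟨as, h3, h4⟩ | ⟨bs, h3, h4⟩
      · cases as with
        | nil => grind
        | cons z as => simp at h4; rw [h4.2]; simp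
      · cases bs with
        | nil => grind
        | cons z bs =>
          simp at h4
          exact absurd haw' (hQa w' (by rw [h4.2]; simp))
    exact hQc w hw4 hcw
  subst e
  have hq0 := hq
  rw [getLast?_ac] at hq
  have hqm : q ∈ Q1 ++ w :: Q2 := mLa hq0
  have hqa : q ≠ a := fun e => haQ (e ▸ hqm)
  have hqc : q ≠ c := fun e => hcQ (e ▸ hqm)
  have hqs : ∀ y ∈ h, ∀ z ∈ h, G.Adj q y → G.Adj q z → y ≠ z → G.Adj y z := fun y hy z hz => hS a _ hH q hqa (by
    simp [hqc, hqh']) y (by simp [hy]) z (by simp [hz])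
  obtain ⟨q2, Q2', hQ2e⟩ : ∃ q2 Q2', Q2 = q2 :: Q2' := by
    cases hQ2' : Q2 with
    | cons x l => exact ⟨x, l, rfl⟩
    | nil =>
      subst hQ2'
      simp at hq; subst hq
      obtain ⟨d, hd, hwd⟩ := hqh
      have h3 := hS a _ hH w hqa (by simp [hqc, hqh']) a (by simp) d (by simp [hd]) haw.symm hwd (fun e => hah (e ▸ hd))
      have h4 := hS a _ hH w hqa (by simp [hqc, hqh']) c (by simp) d (by simp [hd]) hcw.symm hwd (fun e => hch (e ▸ hd))
      grind
  have hq2 : Q2.getLast? = some q := by rw [hQ2e] at hq ⊢; simpa using hq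
  have hqQ2 : q ∈ Q2 := mLa hq2
  have hwQ : ∀ v ∈ h, w ≠ v ∧ ¬ G.Adj w v := fun v hv => ⟨(hQh w (by simp) v hv).1, fun hwv => by
    obtain rfl := (hQh w (by simp) v hv).2 hwv
    exact hQ2 w hqQ2 hcw⟩
  have hQ2h : ∀ u ∈ Q2, ∀ v ∈ h, u ≠ v ∧ (G.Adj u v → u = q) := fun u hu => hQh u (by simp [hu])
  have hwl : IP G (Q2.reverse ++ [w]) := by simpa using IP_reverse.2 hQ.right
  have hwa : w ≠ a := fun e => haQ (e ▸ by simp)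
  have hwc : w ≠ c := fun e => hcQ (e ▸ by simp)
  obtain ⟨h1, d, h2, e1, hd, hh1⟩ := split_first _ hqh
  subst e1
  have pa : IP G (d :: h1.reverse ++ [a]) := by
    have h5 : IP G (d :: h1.reverse) := by
      have := hh; rw [← List.singleton_append, ← List.append_assoc] at this
      simpa using IP_reverse.2 this.left
    refine h5.join (IP.single a) (u := α) ?_ rfl haα.symm ?_
    · cases h1 with
      | nil => simpa using hα
      | cons z l =>
        simp at hα; subst hα
        rw [List.reverse_cons, ← List.cons_append]; exact List.getLast?_concat
    · intro x hx y hy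
      rw [List.mem_singleton] at hy; subst hy
      have hx' : x ∈ h1 ++ d :: h2 := by simp at hx ⊢; tauto
      exact ⟨fun e => hah (e ▸ hx'), fun h => ⟨ha x hx' h.symm, rfl⟩⟩
  have pc : ∀ {l1 l2 : List V} {f : V}, h1 ++ d :: h2 = l1 ++ f :: l2 → IP G (f :: l2 ++ [c]) := by
    intro l1 l2 f e
    rw [e] at hh hγ
    rw [getLast?_ac] at hγ
    refine hh.right.join (IP.single c) hγ rfl hcγ.symm ?_
    intro x hx y hy
    rw [List.mem_singleton] at hy; subst hy
    have hx' : x ∈ h1 ++ d :: h2 := by rw [e]; simp at hx ⊢; tauto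
    exact ⟨fun e => hch (e ▸ hx'), fun h => ⟨hc x hx' h.symm, rfl⟩⟩
  have hQQ : ∀ u ∈ Q2, u ≠ a ∧ u ≠ c := fun u hu => ⟨fun e => haQ (by simp [← e, hu]), fun e => hcQ (by simp [← e, hu])⟩
  -- cross relations
  have x1 : ∀ v ∈ h1 ++ d :: h2, v ≠ a ∧ v ≠ c := fun v hv => ⟨fun e => hah (e ▸ hv), fun e => hch (e ▸ hv)⟩
  have cr := (IP_append.1 hh).2.2
  by_cases huniq : ∃ f ∈ h2, G.Adj q f
  · obtain ⟨f, hf, hqf⟩ := huniq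
    have hdf : d ≠ f := (hh.right.1 f hf).1
    have hadj := hqs d (by simp) f (by simp [hf]) hd hqf hdf
    have hhd := (hh.right.1 f hf).2.1 hadj
    obtain ⟨h3, rfl⟩ := List.head?_eq_some_iff.1 hhd
    have hnot : ∀ v ∈ h3, ¬ G.Adj q v ∧ ¬ G.Adj d v := fun v hv => by
      have h7 := hh.right.1 v (by simp [hv])
      have h8 := hh.right.2.1 v hv
      have h9 : ¬ G.Adj d v := fun h => by grind
      exact ⟨fun h => h9 (hqs d (by simp) v (by simp [hv]) hd h h7.1), h9⟩
    refine hpri (d :: h1.reverse ++ [a]) (f :: h3 ++ [c]) (Q2.reverse ++ [w]) d f q a c w hadj hqf.symm hd.symm hac hcw haw pa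
      (pc (l1 := h1 ++ [d]) (by simp)) hwl rfl rfl (by simp [hq2]) List.getLast?_concat List.getLast?_concat List.getLast?_concat (by simp) (by simp) (by rw [hQ2e]; simp) ?_ ?_ ?_
    · intro x hx y hy
      have hx' : x = a ∨ x = d ∨ x ∈ h1 := by simp at hx; tauto
      have hy' : y = c ∨ y = f ∨ y ∈ h3 := by simp at hy; tauto
      rcases hx' with rfl | rfl | hx <;> rcases hy' with rfl | rfl | hy
      · exact ⟨hac.ne, fun _ => Or.inr ⟨rfl, rfl⟩⟩
      · exact ⟨(x1 y (by simp)).1.symm, fun h => by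
          have e0 := ha y (by simp) h
          subst e0
          cases h1 with
          | nil => simp at hα; exact absurd hα hdf
          | cons z l =>
            simp at hα
            exact absurd hα ((cr z (by simp) y (by simp)).1)⟩
      · exact ⟨(x1 y (by simp [hy])).1.symm, fun h => by
          have e0 := ha y (by simp [hy]) h
          subst e0
          cases h1 with
          | nil => simp at hα; exact absurd hα ((hh.right.1 y (by simp [hy])).1)
          | cons z l =>
            simp at hα
            exact absurd hα ((cr z (by simp) y (by simp [hy])).1)⟩
      · exact ⟨(x1 x (by simp)).2, fun h => by
          have e0 := hc x (by simp) h.symm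
          subst e0
          rw [getLast?_ac] at hγ
          have : x ∈ f :: h3 := mLa (by simpa using hγ)
          exact absurd rfl ((hh.right.1 x this).1)⟩
      · grind
      · exact ⟨(hh.right.1 y (by simp [hy])).1, fun h => absurd h (hnot y hy).2⟩
      · exact ⟨(x1 x (by simp [hx])).2, fun h => by
          have e0 := hc x (by simp [hx]) h.symm
          subst e0
          rw [getLast?_ac] at hγ
          exact absurd rfl ((cr x hx x (mLa hγ)).1)⟩
      · have := cr x hx y (by simp)
        grind
      · have := cr x hx y (by simp [hy])
        exact ⟨this.1, fun h => absurd (this.2.1 h).2 (by simpa using (hh.right.1 y (by simp [hy])).1)⟩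
    · intro x hx y hy
      have hx' : x = a ∨ x = d ∨ x ∈ h1 := by simp at hx; tauto
      have hy' : y = w ∨ y ∈ Q2 := by simp at hy; tauto
      rcases hx' with rfl | hx <;> rcases hy' with rfl | hy
      · grind
      · exact ⟨(hQQ y hy).1.symm, fun h => absurd h (hQa y hy)⟩
      · have := hwQ x (by simp; tauto)
        exact ⟨this.1.symm, fun h => absurd h.symm this.2⟩
      · have := hQ2h y hy x (by simp; tauto)
        refine ⟨this.1.symm, fun h => Or.inl ?_⟩
        obtain rfl := this.2 h.symm
        rcases hx with rfl | hx
        · exact ⟨rfl, rfl⟩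
        · exact absurd h.symm (hh1 x hx)
    · intro x hx y hy
      have hx' : x = c ∨ x = f ∨ x ∈ h3 := by simp at hx; tauto
      have hy' : y = w ∨ y ∈ Q2 := by simp at hy; tauto
      rcases hx' with rfl | hx <;> rcases hy' with rfl | hy
      · grind
      · exact ⟨(hQQ y hy).2.symm, fun h => absurd h (hQ2 y hy)⟩
      · have := hwQ x (by simp; tauto)
        exact ⟨this.1.symm, fun h => absurd h.symm this.2⟩
      · have := hQ2h y hy x (by simp; tauto)
        refine ⟨this.1.symm, fun h => Or.inl ?_⟩
        obtain rfl := this.2 h.symm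
        rcases hx with rfl | hx
        · exact ⟨rfl, rfl⟩
        · exact absurd h.symm (hnot x hx).1
  · push Not at huniq
    have hd1 : ∀ v ∈ h1, G.Adj q v → False := fun v hv h => hh1 v hv h
    refine hpyr d (h1.reverse ++ [a]) (h2 ++ [c]) (Q2.reverse ++ [w]) a c w hac hcw haw pa (pc rfl) ?_ (by simp) (by simp) (by simp)
      (by simp at h2l ⊢; rintro rfl rfl; simp at h2l) (by rw [hQ2e]; simp) (by rw [hQ2e]; simp) ?_ ?_ ?_
    · rw [← List.singleton_append]
      refine (IP.single d).join hwl rfl (v := q) (by simp [hq2]) hd.symm ?_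
      intro x hx y hy
      rw [List.mem_singleton] at hx; subst hx
      have hy' : y = w ∨ y ∈ Q2 := by simp at hy; tauto
      rcases hy' with rfl | hy
      · have := hwQ x (by simp)
        exact ⟨this.1.symm, fun h => absurd h.symm this.2⟩
      · have := hQ2h y hy x (by simp)
        exact ⟨this.1.symm, fun h => ⟨rfl, this.2 h.symm⟩⟩
    · intro x hx y hy
      have hx' : x = a ∨ x ∈ h1 := by simp at hx; tauto
      have hy' : y = c ∨ y ∈ h2 := by simp at hy; tauto
      rcases hx' with rfl | hx <;> rcases hy' with rfl | hy
      · exact ⟨hac.ne, fun _ => ⟨rfl, rfl⟩⟩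
      · exact ⟨(x1 y (by simp [hy])).1.symm, fun h => by
          have e0 := ha y (by simp [hy]) h
          subst e0
          cases h1 with
          | nil => grind
          | cons z l =>
            simp at hα
            exact absurd hα ((cr z (by simp) y (by simp [hy])).1)⟩
      · exact ⟨(x1 x (by simp [hx])).2, fun h => by
          have e0 := hc x (by simp [hx]) h.symm
          subst e0
          rw [getLast?_ac] at hγ
          exact absurd rfl ((cr x hx x (mLa hγ)).1)⟩
      · have := cr x hx y (by simp [hy])
        exact ⟨this.1, fun h => absurd (this.2.1 h).2 (by simpa using (hh.right.1 y (by simp [hy])).1)⟩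
    · intro x hx y hy
      have hx' : x = a ∨ x ∈ h1 := by simp at hx; tauto
      have hy' : y = w ∨ y ∈ Q2 := by simp at hy; tauto
      rcases hx' with rfl | hx <;> rcases hy' with rfl | hy
      · grind
      · exact ⟨(hQQ y hy).1.symm, fun h => absurd h (hQa y hy)⟩
      · have := hwQ x (by simp; tauto)
        exact ⟨this.1.symm, fun h => absurd h.symm this.2⟩
      · have := hQ2h y hy x (by simp; tauto)
        refine ⟨this.1.symm, fun h => ?_⟩
        obtain rfl := this.2 h.symm
        exact absurd h.symm (hh1 x hx)
    · intro x hx y hy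
      have hx' : x = c ∨ x ∈ h2 := by simp at hx; tauto
      have hy' : y = w ∨ y ∈ Q2 := by simp at hy; tauto
      rcases hx' with rfl | hx <;> rcases hy' with rfl | hy
      · exact ⟨hwc.symm, fun _ => ⟨rfl, rfl⟩⟩
      · exact ⟨(hQQ y hy).2.symm, fun h => absurd h (hQ2 y hy)⟩
      · have := hwQ x (by simp; tauto)
        exact ⟨this.1.symm, fun h => absurd h.symm this.2⟩
      · have := hQ2h y hy x (by simp; tauto)
        refine ⟨this.1.symm, fun h => ?_⟩
        obtain rfl := this.2 h.symm
        exact absurd h.symm (huniq x hx)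

abbrev VC (G : SimpleGraph V) (k : ℕ) (ℬ : Set (Set V)) : Prop := Crit G (fun _ _ => False) k Set.univ ℬ
theorem VC.ord' {k : ℕ} {ℬ : Set (Set V)} (h : VC G k ℬ) {X : Set V} (hX : X.ncard ≤ k) : ∃ B ∈ ℬ, ∀ v ∈ B, v ∉ X := by
  obtain ⟨B, hB, h'⟩ := h.ord X (Set.subset_univ _) hX
  grind
theorem VC.rl' [Finite V] {k : ℕ} {D P Q B0 : Set V} {ℬ : Set (Set V)} {x : V} (hc : VC G k ℬ) (hxD : x ∉ D)
    (hPD : ∀ p ∈ P, p ∉ D) (hP : G.IsClique P) (hN : ∀ d ∈ D, ∀ v, G.Adj d v → v ∈ D ∨ v = x ∨ v ∈ P)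
    (hQD : Q ⊆ D) (hQ : Conn G (insert x Q)) (hat : ∀ c ∈ P, (∃ d ∈ D, G.Adj c d) → ∃ r ∈ insert x Q, G.Adj r c)
    (hB0 : B0 ∈ ℬ) (h0 : ∀ b ∈ B0, b ∉ D ∧ b ≠ x ∧ b ∉ P) : D ⊆ Q :=
  Crit.rl hc (Set.subset_univ _) trivial hxD (Set.subset_univ _) (Set.disjoint_left.2 hPD) hP (fun d hd v _ => hN d hd v) hQD hQ
    (fun c hc h => ⟨c, hc, Or.inl rfl, hat c hc h⟩) (fun _ _ _ _ h => h) hB0 h0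
theorem ncc [Finite V] {k : ℕ} {ℬ : Set (Set V)} (hc : VC G k ℬ) {C : Set V} (hC : G.IsClique C) (hne : C.Nonempty)
    (hk : C.ncard ≤ k) {a b : V} (ha : a ∉ C) (hb : b ∉ C) : R G Cᶜ a b := by
  obtain ⟨x, hx⟩ := hne
  obtain ⟨B0, hB, h0⟩ := hc.ord' hk
  have key : ∀ a, a ∉ C → ∃ b ∈ B0, R G Cᶜ a b := by
    intro a ha
    by_contra hcon
    push Not at hcon
    have := hc.rl' (D := comp G Cᶜ a) (P := C \ {x}) (Q := ∅) (x := x) (B0 := B0) (fun h => h.1 hx) (fun p hp h => h.1 hp.1)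
      (hC.subset Set.sdiff_subset) (fun d hd v hv => by
        by_cases hv' : v ∈ C
        · grind
        · exact Or.inl (comp_step hd hv' hv)) (Set.empty_subset _) (by simpa using Conn.single x)
      (fun c hc' _ => ⟨x, by simp, hC hx hc'.1 (Ne.symm hc'.2)⟩) hB
      (fun b hb => ⟨fun h => hcon b hb h.2, fun e => h0 b hb (e ▸ hx), fun h => h0 b hb h.1⟩)
    exact this (mem_comp (s := Cᶜ) ha)
  obtain ⟨a', ha', h1⟩ := key a ha
  obtain ⟨b', hb', h2⟩ := key b hb
  exact h1.trans ((((hc.br.1 B0 hB).2 a' ha' b' hb').mono fun v hv => h0 v hv).trans h2.symm)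
def TF (G : SimpleGraph V) : Prop := ∀ a b c, G.Adj a b → G.Adj b c → G.Adj a c → False
theorem tri_free [Finite V] {k : ℕ} {ℬ : Set (Set V)} (hc : VC G k ℬ) (hs : VSL G) (hcl : ∀ s, G.IsClique s → s.ncard ≤ k) : TF G := by
  intro a0 b0 c0 h1 h2 h3
  obtain ⟨K, ⟨hK, hK0⟩, hmax⟩ := (Set.toFinite {K : Set V | G.IsClique K ∧ {a0, b0, c0} ⊆ K}).exists_maximal ⟨{a0, b0, c0}, by
    simp only [SimpleGraph.isClique_iff, Set.Pairwise, Set.mem_insert_iff, Set.mem_singleton_iff]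
    rintro x (rfl | rfl | rfl) y (rfl | rfl | rfl) <;> intro hne <;> first | exact absurd rfl hne | assumption | (apply SimpleGraph.Adj.symm; assumption), subset_rfl⟩
  have third : ∀ a c, ∃ b ∈ K, b ≠ a ∧ b ≠ c := by
    intro a c
    have i1 := hK0 (show a0 ∈ _ by simp)
    have i2 := hK0 (show b0 ∈ _ by simp)
    have i3 := hK0 (show c0 ∈ _ by simp)
    have := h1.ne; have := h2.ne; have := h3.ne
    grind
  obtain ⟨B0, hB, hB0⟩ := hc.ord' (hcl K hK)
  obtain ⟨v0, hv0⟩ := (hc.br.1 B0 hB).1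
  have out : ∀ κ ∈ K, ∃ d, d ∉ K ∧ G.Adj κ d := by
    intro κ hκ
    have hC : G.IsClique (K \ {κ}) := hK.subset Set.sdiff_subset
    obtain ⟨b, hb, hbκ, -⟩ := third κ κ
    obtain ⟨u, v, huv, hu, hv, hu', hv'⟩ := (ncc hc hC ⟨b, hb, hbκ⟩ (hcl _ hC) (a := κ) (b := v0) (by simp) (fun h => hB0 v0 hv0 h.1)).cross (· ∈ K) hκ (hB0 v0 hv0)
    grind
  obtain ⟨d, hd, hdm⟩ := Set.exists_max_image Kᶜ (fun d => (K ∩ {v | G.Adj d v}).ncard) (Set.toFinite _) ⟨v0, hB0 v0 hv0⟩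
  have hKa0 : a0 ∈ K := hK0 (by simp)
  obtain ⟨c, hcK, hdc⟩ : ∃ c ∈ K, ¬ G.Adj d c := by
    by_contra hcon
    push Not at hcon
    have := hmax (y := insert d K) ⟨hK.insert fun b hb _ => hcon b hb, hK0.trans (Set.subset_insert _ _)⟩ (Set.subset_insert _ _)
    grind
  obtain ⟨e, heK, hce⟩ := out c hcK
  obtain ⟨l, d', pk, hl, hhd, hlast, rfl, hpk, hlK, -, hlc⟩ := exists_IP_sets (ncc hc hK ⟨a0, hKa0⟩ (hcl K hK) hd heK) hd (· = d) (G.Adj c) rfl hce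
  have hpkl := mLa hlast
  obtain ⟨a, haK, hda, hapk⟩ : ∃ a ∈ K, G.Adj d' a ∧ ¬ G.Adj pk a := by
    by_contra hcon
    push Not at hcon
    refine absurd (hdm pk (hlK _ hpkl)) (not_le.2 (Set.ncard_lt_ncard ⟨fun v hv => ⟨hv.1, hcon v hv.1 hv.2⟩, fun h => ?_⟩ (Set.toFinite _)))
    exact hdc (h ⟨hcK, hpk.symm⟩).2
  obtain ⟨l1, p, l2, rfl, hp, hl2⟩ := split_last (G.Adj a) ⟨d', mHe hhd, hda.symm⟩
  rw [getLast?_ac] at hlast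
  have hac : a ≠ c := by rintro rfl; exact hdc hda
  have hpK : p ∉ K := hlK p (by simp)
  obtain ⟨b, hbK, hba, hbc⟩ := third a c
  have hcl' : G.IsClique {a, c} := hK.subset (by rintro x (rfl | rfl) <;> assumption)
  have hout : ∀ x ∈ K, x ∉ p :: l2 := fun x hx h => hlK x (by simp at h ⊢; tauto) hx
  refine tri2 hs (h := p :: l2) (a := a) (b := b) (c := c) hl.right ?_ rfl hlast (hout a haK) (hout c hcK) (hout b hbK) (hK haK hcK hac)
    (hK haK hbK hba.symm) (hK hcK hbK hbc.symm) hp hpk ?_ ?_ ?_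
  · cases l2 with
    | nil => simp at hlast; exact absurd (hlast ▸ hp.symm) hapk
    | cons _ _ => simp
  · grind
  · grind
  · refine (ncc hc hcl' ⟨a, by simp⟩ (hcl _ hcl') (a := b) (b := p) (by simp [hba, hbc]) ?_).mono ?_
    · rintro (rfl | rfl) <;> contradiction
    · intro v hv; simpa using hv
/-- a vertex outside a hole has at most one neighbour on it -/
def T1 (G : SimpleGraph V) : Prop := ∀ x l, HL G x l → ∀ w, w ≠ x → w ∉ l → ∀ y ∈ x :: l, ∀ z ∈ x :: l, G.Adj w y → G.Adj w z → y = z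
theorem t1_of (h : SpL G) (ht : TF G) : T1 G := fun x l hl w h1 h2 y hy z hz hwy hwz => by
  by_contra e
  exact ht w y z hwy (h x l hl w h1 h2 y hy z hz hwy hwz e) hwz

theorem HL.rev {x : V} {l : List V} (h : HL G x l) : HL G x l.reverse :=
  ⟨IP_reverse.2 h.1, by simpa using h.2.1, by simpa using h.2.2.1, fun v hv => by
    rw [h.2.2.2 v (by simpa using hv)]; simp [or_comm]⟩
theorem HL.rot {h n : V} {g : List V} (hg : HL G h (n :: g)) : HL G n (g ++ [h]) := by
  obtain ⟨h1, h2, h3, h4⟩ := hg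
  cases g with
  | nil => simp at h2
  | cons m g =>
    obtain ⟨f, hf⟩ : ∃ f, (m :: g).getLast? = some f := ⟨_, List.getLast?_eq_some_getLast (by simp)⟩
    have hfl : (n :: m :: g).getLast? = some f := by simpa using hf
    rw [hfl] at h4
    refine HL.mk' (u := m) (v := h) (h1.2.join (IP.single h) hf rfl ?_ ?_) (by simpa using h2) ?_ (by simp) List.getLast?_concat ?_ ?_ ?_
    · exact ((h4 f (mLa hfl)).2 (Or.inr rfl)).symm
    · intro a ha b hb
      rw [List.mem_singleton] at hb; subst hb
      refine ⟨fun e => h3 (by grind), fun hab => ⟨?_, rfl⟩⟩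
      rcases (h4 a (List.mem_cons_of_mem _ ha)).1 hab.symm with e | e
      · simp at e; exact absurd e (h1.1 a ha).1
      · simpa using e.symm
    · rw [List.mem_append]; rintro (h | h)
      · exact (h1.1 n h).1 rfl
      · grind
    · exact (h1.1 m (by simp)).2.2 rfl
    · exact ((h4 n (by simp)).2 (Or.inl rfl)).symm
    · intro w hw hnw
      rcases mAp hw with hw | hw
      · have := (h1.1 w hw).2.1 hnw; grind
      · exact Or.inr (by simpa using hw)
theorem ear_aux (ht : T1 G) {M N : List V} {s o σ f : V} (hI : IP G (M ++ σ :: N)) (hM : ∃ e ∈ M, G.Adj s e) (hf : N.getLast? = some f)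
    (hsf : G.Adj s f) (hs : ∀ v ∈ σ :: N, G.Adj s v → v = f) (hso : G.Adj s o) (hoσ : G.Adj o σ) (h1 : s ∉ M ++ σ :: N) (h2 : o ∉ M ++ σ :: N) : False := by
  obtain ⟨M1, θ, M2, rfl, hθ, hM2⟩ := split_last _ hM
  have hl : IP G ((θ :: M2) ++ σ :: N) := by
    rw [List.append_assoc] at hI; exact hI.right
  have hN := List.length_pos_of_mem (mLa hf)
  have hH : HL G s ((θ :: M2) ++ σ :: N) := by
    refine HL.mk' hl (by simp; omega) (by simp at h1 ⊢; tauto) rfl (v := f) ?_ hθ hsf ?_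
    · grind
    · grind
  have := ht s _ hH o hso.ne' (by simp at h2 ⊢; tauto) s (by simp) σ (by simp) hso.symm hoσ
  grind
theorem join3 {X r Y : List V} {wy ra rb gd : V} (hX : IP G (X ++ [wy])) (hr : IP G r) (hY : IP G (gd :: Y)) (ha : r.head? = some ra) (hb : r.getLast? = some rb)
    (h1 : G.Adj wy ra) (h2 : G.Adj rb gd) (hXr : Xc G (X ++ [wy]) r wy ra) (hrY : Xc G r (gd :: Y) rb gd)
    (hXY : ∀ a ∈ X ++ [wy], ∀ b ∈ gd :: Y, a ≠ b ∧ ¬ G.Adj a b) : IP G (X ++ (wy :: r) ++ gd :: Y) := by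
  have i1 := hX.join hr List.getLast?_concat ha h1 hXr
  have i2 : IP G ((X ++ [wy] ++ r) ++ gd :: Y) := i1.join hY (u := rb) (v := gd) (by
    grind) rfl h2 (by
    intro a ha b hb
    rcases mAp ha with ha | ha
    · grind
    · exact hrY a ha b hb)
  simpa using i2
/-- `n` lies on a hole inside `U` through `h` and `u`, next to `h` -/
def Th (G : SimpleGraph V) (U : Set V) (u h n : V) : Prop := ∃ g, HL G h g ∧ (∀ v ∈ g, v ∈ U) ∧ u ∈ g ∧ g.head? = some n
theorem ear1 {U : Set V} {u h n' wj ζ : V} {E g1 g2 : List V} (hg : HL G h (g1 ++ ζ :: g2)) (hgU : ∀ v ∈ g1 ++ ζ :: g2, v ∈ U) (hE : IP G E) (hEU : ∀ v ∈ E, v ∈ U)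
    (hEj : E.head? = some wj) (hEn : E.getLast? = some n') (hE2 : 2 ≤ E.length) (hEg : Xc G E (g1 ++ ζ :: g2) wj ζ) (hwζ : G.Adj wj ζ) (hhE : h ∉ E)
    (hhn : G.Adj h n') (hh : ∀ v ∈ E, G.Adj h v → v = n') (hg1 : g1 ≠ []) (hu : u ∈ ζ :: g2) : Th G U u h n' := by
  obtain ⟨q1, q2, q3, q4⟩ := hg
  rw [getLast?_ac] at q4
  obtain ⟨f, hf⟩ : ∃ f, (ζ :: g2).getLast? = some f := ⟨_, List.getLast?_eq_some_getLast (by simp)⟩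
  rw [hf] at q4
  refine ⟨E.reverse ++ ζ :: g2, HL.mk' (u := n') (v := f) ((IP_reverse.2 hE).join q1.right (by simpa using hEj) rfl hwζ ?_) (by simp; omega) ?_ ?_ ?_ hhn ?_ ?_, ?_, by simp at hu ⊢; tauto, ?_⟩
  · intro a ha b hb
    exact hEg a (by simpa using ha) b (by simp at hb ⊢; tauto)
  · simp at q3 ⊢; tauto
  · rw [List.head?_append]; simp [hEn]
  · rw [getLast?_ac]; exact hf
  · grind
  · intro w hw hhw
    rcases mAp hw with hw | hw
    · grind
    · rcases (q4 w (by simp at hw ⊢; tauto)).1 hhw with e | e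
      · obtain ⟨g1', rfl⟩ : ∃ g1', g1 = w :: g1' := by
          cases g1 with
          | nil => simp at hg1
          | cons a l => simp at e; exact ⟨l, by rw [e]⟩
        exact absurd rfl ((IP_append.1 q1).2.2 w (by simp) w hw).1
      · grind
  · grind
  · rw [List.head?_append]; simp [hEn]

theorem link {U : Set V} {E F : List V} {a b : V} (hR : R G U a b) (haU : a ∈ U) (ha : a ∈ E) (hb : b ∈ F) (hEF : ∀ u ∈ E, ∀ v ∈ F, u ≠ v ∧ ¬ G.Adj u v) :
    ∃ r ra rb e f, IP G r ∧ r.head? = some ra ∧ r.getLast? = some rb ∧ e ∈ E ∧ f ∈ F ∧ G.Adj e ra ∧ G.Adj rb f ∧ (∀ v ∈ r, v ∈ U ∧ v ∉ E ∧ v ∉ F) ∧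
      (∀ u ∈ E, ∀ v ∈ r, G.Adj u v → v = ra) ∧ (∀ u ∈ F, ∀ v ∈ r, G.Adj v u → v = rb) := by
  obtain ⟨m, e, f, hm, he, hf, heE, hfF, hmU, hmE, hmF⟩ := exists_IP_sets hR haU (· ∈ E) (· ∈ F) ha hb
  obtain ⟨m0, rfl⟩ := List.getLast?_eq_some_iff.1 hf
  cases m0 with
  | nil => grind
  | cons e' r0 =>
    simp at he; subst he
    cases r0 with
    | nil => exact absurd ((hm.1 f (by simp)).2.2 rfl) (hEF _ heE f hfF).2
    | cons a' r' =>
      have hea : G.Adj e' a' := (hm.1 a' (by simp)).2.2 rfl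
      obtain ⟨b', hb'⟩ : ∃ b', (a' :: r').getLast? = some b' := ⟨_, List.getLast?_eq_some_getLast (by simp)⟩
      have hb'm := mLa hb'
      have hbf : G.Adj b' f := ((IP_append.1 hm).2.2 b' (by simp at hb'm ⊢; tauto) f (by simp)).2.2 ⟨by simpa using hb', rfl⟩
      have hm2 : IP G (a' :: r') := hm.2.left
      obtain ⟨r, ra, rb, h1, h2, h3, ⟨e, h4, h5⟩, ⟨f', h6, h7⟩, h8, h9, h10⟩ := exists_IP_sets ((chain_conn hm2.chain (by simp)).2 a' (by simp) b' hb'm)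
        (show a' ∈ {x | x ∈ a' :: r'} by simp) (fun v => ∃ e ∈ E, G.Adj e v) (fun v => ∃ f ∈ F, G.Adj v f) ⟨_, heE, hea⟩ ⟨_, hfF, hbf⟩
      refine ⟨r, ra, rb, e, f', h1, h2, h3, h4, h6, h5, h7, fun v hv => ?_, fun u hu v hv h => h9 v hv ⟨u, hu, h⟩, fun u hu v hv h => h10 v hv ⟨u, hu, h⟩⟩
      have hv' : v ∈ a' :: r' := h8 v hv
      refine ⟨hmU v (by simp at hv' ⊢; tauto), fun h => ?_, fun h => ?_⟩
      · have := hmE v (by simp at hv' ⊢; tauto) h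
        exact (hm.1 v (by simp at hv' ⊢; tauto)).1 this.symm
      · have := hmF v (by simp at hv' ⊢; tauto) h
        exact ((IP_append.1 hm).2.2 v (by simp at hv' ⊢; tauto) f (by simp)).1 this
set_option maxHeartbeats 1000000 in
theorem ear2 (hT : TF G) (ht : T1 G) {U : Set V} {u h n' wj g0 : V} {E g : List V} (hg : HL G h (g0 :: g)) (hgU : ∀ v ∈ g0 :: g, v ∈ U) (hE : IP G E) (hEU : ∀ v ∈ E, v ∈ U)
    (hEj : E.head? = some wj) (hEn : E.getLast? = some n') (hE2 : 2 ≤ E.length) (hEg : Xc G E (g0 :: g) wj g0) (hwζ : G.Adj wj g0) (hhE : h ∉ E)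
    (hhn : G.Adj h n') (hh : ∀ v ∈ E, G.Adj h v → v = n') (hu : u ∈ g)
    (hR : ∀ a ∈ U \ {h, g0}, ∀ b ∈ U \ {h, g0}, R G (U \ {h, g0}) a b) : Th G U u h n' := by
  have hg' := hg
  obtain ⟨q1, q2, q3, q4⟩ := hg'
  obtain ⟨gN, hgN⟩ : ∃ f, g.getLast? = some f := ⟨_, List.getLast?_eq_some_getLast (List.ne_nil_of_mem hu)⟩
  have hgNm := mLa hgN
  have hgN' : (g0 :: g).getLast? = some gN := by grind
  rw [hgN'] at q4
  have hg0 : ∀ v ∈ g, g0 ≠ v := fun v hv => (q1.1 v hv).1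
  have hhg0 : G.Adj h g0 := (q4 g0 (by simp)).2 (Or.inl rfl)
  have hhgN : G.Adj h gN := (q4 gN (by simp [hgNm])).2 (Or.inr rfl)
  have hhg : ∀ v ∈ g, G.Adj h v → v = gN := fun v hv hhv => by
    grind
  have hg0E : ∀ v ∈ E, v ≠ g0 ∧ (G.Adj v g0 → v = wj) := fun v hv => ⟨(hEg v hv g0 (by simp)).1, fun h => ((hEg v hv g0 (by simp)).2 h).1⟩
  have hEF : ∀ a ∈ E, ∀ v ∈ g, a ≠ v ∧ ¬ G.Adj a v := fun a ha v hv => ⟨(hEg a ha v (by simp [hv])).1, fun h' => hg0 v hv ((hEg a ha v (by simp [hv])).2 h').2.symm⟩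
  have hwE := mHe hEj
  have hnE := mLa hEn
  have hhg' : h ∉ g := fun h' => q3 (by simp [h'])
  have hwU : wj ∈ U \ {h, g0} := ⟨hEU _ hwE, by rintro (rfl | rfl); exact hhE hwE; grind⟩
  obtain ⟨r, ra, rb, wy, gd, hr, hra, hrb, hwyE, hgdg, hwyra, hrbgd, hrU, hrE, hrg⟩ := link (hR wj hwU u ⟨hgU u (by simp [hu]), by
    rintro (rfl | rfl); exact hhg' hu; exact hg0 _ hu rfl⟩) hwU hwE hu hEF
  have hram := mHe hra
  have hrbm := mLa hrb
  have hrh : ∀ v ∈ r, v ≠ h ∧ v ≠ g0 := fun v hv => ⟨fun e => (hrU v hv).1.2 (by simp [e]), fun e => (hrU v hv).1.2 (by simp [e])⟩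
  -- unique attachments
  have hole2 : HL G g0 (E ++ [h]) := HL.mk' (hE.join (IP.single h) hEn rfl hhn.symm (by
      intro a ha b hb
      rw [List.mem_singleton] at hb; subst hb
      exact ⟨fun e => hhE (e ▸ ha), fun h' => ⟨hh a ha h'.symm, rfl⟩⟩)) (by simp; omega) (by
      rw [List.mem_append]; rintro (h' | h')
      · grind
      · rw [List.mem_singleton] at h'; exact hhg0.ne h'.symm) (by rw [List.head?_append, hEj]; rfl) List.getLast?_concat hwζ.symm hhg0.symm (by
    intro w hw hw'
    rcases mAp hw with hw | hw
    · exact Or.inl ((hg0E w hw).2 hw'.symm)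
    · exact Or.inr (by simpa using hw))
  have uE : ∀ a ∈ E, G.Adj a ra → a = wy := fun a ha h' => ht g0 _ hole2 ra (hrh _ hram).2 (by simp [(hrU _ hram).2.1, (hrh _ hram).1]) a (by simp [ha]) wy (by simp [hwyE]) h'.symm hwyra.symm
  have ug : ∀ a ∈ g, G.Adj rb a → a = gd := fun a ha h' => ht h _ hg rb (hrh _ hrbm).1 (by simp [(hrU _ hrbm).2.2, (hrh _ hrbm).2]) a (by simp [ha]) gd (by simp [hgdg]) h' hrbgd
  obtain ⟨E1, E2, rfl⟩ := List.append_of_mem hwyE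
  obtain ⟨C1, C2, rfl⟩ := List.append_of_mem hgdg
  obtain ⟨g1, hg1⟩ : ∃ g1, (C1 ++ gd :: C2).head? = some g1 := ⟨_, List.head?_eq_some_head (by simp)⟩
  have hg1l : (gd :: C1.reverse).getLast? = some g1 := by
    cases C1 with
    | nil => simpa using hg1
    | cons z l =>
      simp at hg1; subst hg1
      rw [List.reverse_cons, ← List.cons_append]; exact List.getLast?_concat
  have hg1' : ∀ v ∈ C1 ++ gd :: C2, G.Adj g0 v ↔ v = g1 := fun v hv => by
    rw [(q1.1 v hv).2, hg1]; simp [eq_comm]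
  rw [getLast?_ac] at hEn hgN
  have iC : IP G (gd :: C1.reverse ++ [g0]) := by
    have : IP G ((g0 :: C1 ++ [gd]) ++ C2) := by simpa using q1
    simpa using IP_reverse.2 this.left
  have XE : ∀ {X : List V}, (∀ v ∈ X, v ∈ E1 ++ wy :: E2) → Xc G X r wy ra := fun hX a ha b hb =>
    ⟨fun e => (hrU b hb).2.1 (e ▸ hX a ha), fun h' => by
      have e := hrE a (hX a ha) b hb h'
      subst e; exact ⟨uE a (hX a ha) h', rfl⟩⟩
  have Xg : ∀ {Y : List V}, (∀ v ∈ Y, v ∈ C1 ++ gd :: C2) → Xc G r Y rb gd := fun hX a ha b hb =>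
    ⟨fun e => (hrU a ha).2.2 (e ▸ hX b hb), fun h' => by
      have e := hrg b (hX b hb) a ha h'
      subst e; exact ⟨rfl, ug b (hX b hb) h'⟩⟩
  have iE2 : IP G (E2.reverse ++ [wy]) := by simpa using IP_reverse.2 hE.right
  have iE1 : IP G (E1 ++ [wy]) := by rw [← List.singleton_append, ← List.append_assoc] at hE; exact hE.left
  have sE2 : ∀ v ∈ E2.reverse ++ [wy], v ∈ E1 ++ wy :: E2 := fun v hv => by simp at hv ⊢; tauto
  have sE1 : ∀ v ∈ E1 ++ [wy], v ∈ E1 ++ wy :: E2 := fun v hv => by simp at hv ⊢; tauto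
  have sC2 : ∀ v ∈ gd :: C2, v ∈ C1 ++ gd :: C2 := fun v hv => by simp at hv ⊢; tauto
  have sC1 : ∀ v ∈ gd :: C1.reverse, v ∈ C1 ++ gd :: C2 := fun v hv => by simp at hv ⊢; tauto
  have PA : IP G (E2.reverse ++ (wy :: r) ++ gd :: C2) := join3 iE2 hr q1.2.right hra hrb hwyra hrbgd (XE sE2) (Xg sC2)
    (fun a ha b hb => hEF a (sE2 a ha) b (sC2 b hb))
  have PB : IP G (E1 ++ (wy :: r) ++ gd :: C1.reverse) := join3 iE1 hr iC.left hra hrb hwyra hrbgd (XE sE1) (Xg sC1)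
    (fun a ha b hb => hEF a (sE1 a ha) b (sC1 b hb))
  have nh : h ∉ r := fun h' => (hrh _ h').1 rfl
  have ng0 : g0 ∉ r := fun h' => (hrh _ h').2 rfl
  have nh2 : ∀ v ∈ E1 ++ wy :: E2, v ≠ h ∧ v ≠ g0 := fun v hv => ⟨fun e => hhE (e ▸ hv), (hg0E v hv).1⟩
  have nh3 : ∀ v ∈ C1 ++ gd :: C2, v ≠ h ∧ v ≠ g0 := fun v hv => ⟨fun e => hhg' (e ▸ hv), (hg0 v hv).symm⟩
  have memA : ∀ v ∈ E2.reverse ++ (wy :: r) ++ gd :: C2, v ∈ E1 ++ wy :: E2 ∨ v ∈ r ∨ v ∈ C1 ++ gd :: C2 := fun v hv => by simp at hv ⊢; tauto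
  have memB : ∀ v ∈ E1 ++ (wy :: r) ++ gd :: C1.reverse, v ∈ E1 ++ wy :: E2 ∨ v ∈ r ∨ v ∈ C1 ++ gd :: C2 := fun v hv => by simp at hv ⊢; tauto
  have nall : ∀ v, (v ∈ E1 ++ wy :: E2 ∨ v ∈ r ∨ v ∈ C1 ++ gd :: C2) → v ≠ h ∧ v ≠ g0 := by
    rintro v (h' | h' | h')
    exacts [nh2 v h', hrh v h', nh3 v h']
  have clean : ∀ v ∈ wy :: r, ¬ G.Adj h v ∧ ¬ G.Adj g0 v := by
    by_contra hcon
    obtain ⟨r1, σ, r2, e, hσ, hr2⟩ := split_last (fun v => G.Adj h v ∨ G.Adj g0 v) (l := wy :: r) (by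
      push Not at hcon
      obtain ⟨v, hv, h'⟩ := hcon
      exact ⟨v, hv, by tauto⟩)
    rw [e] at PA PB memA memB
    have eq : ∀ {v : V}, v = wy → v ∈ r1 ++ σ :: r2 := fun h => by rw [← e, h]; simp
    rcases hσ with hσ | hσ
    · have hσ' : ¬ G.Adj g0 σ := fun h' => hT h g0 σ hhg0 h' hσ
      refine ear_aux ht (M := E1 ++ r1) (σ := σ) (N := r2 ++ gd :: C1.reverse) (s := g0) (o := h) (f := g1) (by simpa using PB) ?_ (by rw [getLast?_ac]; exact hg1l)
        ((hg1' g1 (mHe hg1)).2 rfl) ?_ hhg0.symm hσ (fun h' => (nall _ (memB _ (by simp at h' ⊢; tauto))).2 rfl) (fun h' => (nall _ (memB _ (by simp at h' ⊢; tauto))).1 rfl)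
      · refine ⟨wj, ?_, hwζ.symm⟩
        cases E1 with
        | cons z l => simp at hEj; simp [hEj]
        | nil =>
          have := eq (v := wj) (by simpa using hEj.symm)
          rcases mAp this with h' | h'
          · simp [h']
          · rcases mCo h' with rfl | h'
            · exact absurd hwζ.symm hσ'
            · exact absurd (Or.inr hwζ.symm) (hr2 _ h')
      · intro v hv hgv
        have : v = σ ∨ v ∈ r2 ∨ v ∈ gd :: C1.reverse := by simp at hv ⊢; tauto
        rcases this with rfl | h' | h'
        · exact absurd hgv hσ'
        · exact absurd (Or.inr hgv) (hr2 v h')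
        · exact (hg1' v (sC1 v h')).1 hgv
    · have hσ' : ¬ G.Adj h σ := fun h' => hT h g0 σ hhg0 hσ h'
      refine ear_aux ht (M := E2.reverse ++ r1) (σ := σ) (N := r2 ++ gd :: C2) (s := h) (o := g0) (f := gN) (by simpa using PA) ?_ (by rw [getLast?_ac]; exact hgN)
        hhgN ?_ hhg0 hσ (fun h' => (nall _ (memA _ (by simp at h' ⊢; tauto))).1 rfl) (fun h' => (nall _ (memA _ (by simp at h' ⊢; tauto))).2 rfl)
      · refine ⟨n', ?_, hhn⟩
        rcases mCo (mLa hEn) with h' | h'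
        · rcases mAp (eq h') with h' | h'
          · simp [h']
          · rcases mCo h' with rfl | h'
            · exact absurd hhn hσ'
            · exact absurd (Or.inl hhn) (hr2 _ h')
        · simp [h']
      · intro v hv hgv
        have : v = σ ∨ v ∈ r2 ∨ v ∈ gd :: C2 := by simp at hv ⊢; tauto
        rcases this with rfl | h' | h'
        · exact absurd hgv hσ'
        · exact absurd (Or.inl hgv) (hr2 v h')
        · exact hhg v (sC2 v h') hgv
  have headA : ∀ {Y : List V}, (E2.reverse ++ (wy :: r) ++ Y).head? = some n' := by
    intro Y
    rw [List.append_assoc, List.head?_append, List.head?_reverse]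
    cases E2 with
    | nil => simpa using hEn
    | cons z l => rw [List.getLast?_cons_cons] at hEn; rw [hEn]; rfl
  have rl := List.length_pos_of_mem hram
  have nbA : ∀ v ∈ E2.reverse ++ (wy :: r), G.Adj h v → v = n' := fun v hv hhv => by
    have : v ∈ E2.reverse ++ [wy] ∨ v ∈ r := by simp at hv ⊢; tauto
    rcases this with h' | h'
    · exact hh v (sE2 v h') hhv
    · exact absurd hhv (clean v (by simp [h'])).1
  have hUA : ∀ v, (v ∈ E1 ++ wy :: E2 ∨ v ∈ r ∨ v ∈ C1 ++ gd :: C2) → v ∈ U := by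
    rintro v (h' | h' | h')
    exacts [hEU v h', (hrU v h').1.1, hgU v (by simp at h' ⊢; tauto)]
  by_cases huA : u ∈ gd :: C2
  · refine ⟨E2.reverse ++ (wy :: r) ++ gd :: C2, HL.mk' PA (by simp; omega) (fun h' => (nall _ (memA _ h')).1 rfl) headA (by rw [getLast?_ac]; exact hgN) hhn hhgN ?_,
      fun v hv => hUA v (memA v hv), by simp at huA ⊢; tauto, headA⟩
    intro v hv hhv
    rcases mAp hv with h' | h'
    · exact Or.inl (nbA v h' hhv)
    · exact Or.inr (hhg v (sC2 v h') hhv)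
  · have hgdN : gd ≠ gN := by
      intro e
      have hB : HL G g0 (E1 ++ (wy :: r) ++ gd :: C1.reverse) := by
        refine HL.mk' (u := wj) (v := g1) PB (by simp; omega) (fun h' => (nall _ (memB _ h')).2 rfl) ?_ (by rw [getLast?_ac]; exact hg1l) hwζ.symm
          ((hg1' g1 (mHe hg1)).2 rfl) ?_
        · cases E1 <;> simpa using hEj
        · intro v hv hgv
          rcases memB v hv with h' | h' | h'
          · exact Or.inl ((hg0E v h').2 hgv.symm)
          · exact absurd hgv (clean v (by simp [h'])).2
          · exact Or.inr ((hg1' v h').1 hgv)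
      have := ht g0 _ hB h hhg0.ne (fun h' => (nall _ (memB _ h')).1 rfl) g0 (by simp) gd (by simp) hhg0 (e ▸ hhgN)
      exact hg0 gd (by simp) this
    have sCg : ∀ v ∈ gd :: C1.reverse ++ [g0], v = g0 ∨ v ∈ C1 ++ gd :: C2 := fun v hv => by simp at hv ⊢; tauto
    have PC : IP G (E2.reverse ++ (wy :: r) ++ (gd :: (C1.reverse ++ [g0]))) := by
      refine join3 iE2 hr (by simpa using iC) hra hrb hwyra hrbgd (XE sE2) ?_ ?_
      · intro a ha b hb
        rcases sCg b (by simpa using hb) with rfl | h'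
        · exact ⟨(hrh a ha).2, fun h' => absurd h'.symm (clean a (by simp [ha])).2⟩
        · exact Xg (fun v hv => hv) a ha b h'
      · intro a ha b hb
        rcases sCg b (by simpa using hb) with rfl | h'
        · refine ⟨(hg0E a (sE2 a ha)).1, fun h' => ?_⟩
          have e := (hg0E a (sE2 a ha)).2 h'
          subst e
          have h3 : a ∈ E1 ++ [wy] := by
            cases E1 with
            | nil => simp at hEj; simp [hEj]
            | cons z l => simp at hEj; simp [hEj]
          rcases mAp ha with h4 | h4
          · have h4 : a ∈ E2 := by simpa using h4
            rw [← List.singleton_append, ← List.append_assoc] at hE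
            exact ((IP_append.1 hE).2.2 a h3 a h4).1 rfl
          · rw [List.mem_singleton] at h4
            exact (clean a (by simp [h4])).2 h'.symm
        · exact hEF a (sE2 a ha) b h'
    have memC : ∀ v ∈ E2.reverse ++ (wy :: r) ++ (gd :: (C1.reverse ++ [g0])), v = g0 ∨ v ∈ E1 ++ wy :: E2 ∨ v ∈ r ∨ v ∈ C1 ++ gd :: C2 := fun v hv => by simp at hv ⊢; tauto
    refine ⟨_, HL.mk' PC (by simp; omega) (fun h' => ?_) headA (v := g0) (by rw [← List.cons_append, ← List.append_assoc]; exact List.getLast?_concat) hhn hhg0 ?_, fun v hv => ?_, ?_, headA⟩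
    · rcases memC _ h' with e | h'
      · exact hhg0.ne e
      · exact (nall _ h').1 rfl
    · intro v hv hhv
      rcases mAp hv with h' | h'
      · exact Or.inl (nbA v h' hhv)
      · rcases sCg v (by simpa using h') with rfl | h''
        · exact Or.inr rfl
        · exfalso
          obtain rfl := hhg v h'' hhv
          have h5 : v ∈ C1 := by
            simp at h'
            grind
          exact ((IP_append.1 q1.2).2.2 v h5 v (mLa hgN)).1 rfl
    · rcases memC _ hv with rfl | h'
      · exact hgU _ (by simp)
      · exact hUA v h'
    · simp at hu huA ⊢; tauto

theorem Th.mem {U : Set V} {u h n : V} (h' : Th G U u h n) : n ∈ U ∧ G.Adj h n := by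
  obtain ⟨g, h1, h2, h3, h4⟩ := h'
  exact ⟨h2 n (mHe h4), (h1.2.2.2 n (mHe h4)).2 (Or.inl h4)⟩
theorem clique2 {a b : V} (h : G.Adj a b) : G.IsClique {a, b} := by
  rintro x (rfl | rfl) y (rfl | rfl) hne
  exacts [absurd rfl hne, h, h.symm, absurd rfl hne]
theorem th_all (hT : TF G) (ht : T1 G) {U : Set V} (hNC : ∀ S ⊆ U, G.IsClique S → ∀ a ∈ U \ S, ∀ b ∈ U \ S, R G (U \ S) a b) {u h n0 n' : V} (hhU : h ∈ U)
    (h0 : Th G U u h n0) (hn' : n' ∈ U) (hadj : G.Adj h n') : Th G U u h n' := by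
  by_contra hcon
  have hn0 := h0.mem
  obtain ⟨w, n, m, hw, hwn, hwm, hn, ⟨hm, hm'⟩, hwU, hwA, hwB⟩ := exists_IP_sets (hNC {h} (by simpa using hhU) (by simp) n0 ⟨hn0.1, hn0.2.ne'⟩ n' ⟨hn', hadj.ne'⟩)
    ⟨hn0.1, hn0.2.ne'⟩ (Th G U u h) (fun v => G.Adj h v ∧ ¬ Th G U u h v) h0 ⟨hadj, hcon⟩
  obtain ⟨g, hg, hgU, hug, hgn⟩ := hn
  have hwh : ∀ v ∈ w, G.Adj h v → v = n ∨ v = m := fun v hv hv' => by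
    grind
  have hng := mHe hgn
  have hmg : m ∉ g := fun h1 => by
    rcases (hg.2.2.2 m h1).1 hm with h2 | h2
    · exact hm' ⟨g, hg, hgU, hug, h2⟩
    · exact hm' ⟨g.reverse, hg.rev, by simpa using hgU, by simpa using hug, by simpa using h2⟩
  obtain ⟨w1, wj, w2, rfl, hp, hw2⟩ := split_last (fun v => v ∈ g ∨ ∃ b ∈ g, G.Adj v b) ⟨n, mHe hwn, Or.inl hng⟩
  rw [getLast?_ac] at hwm
  have hE := hw.right
  have hjg : wj ∉ g := fun h1 => by
    cases w2 with
    | nil => simp at hwm; grind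
    | cons b l => exact hw2 b (by simp) (Or.inr ⟨wj, h1, ((hE.1 b (by simp)).2.2 rfl).symm⟩)
  obtain ⟨ζ, hζ, hjζ⟩ := hp.resolve_left hjg
  have hwjh : wj ≠ h := (hwU wj (by simp)).2
  have uniq : ∀ a ∈ h :: g, G.Adj wj a → a = ζ := fun a ha h1 => ht h g hg wj hwjh hjg a ha ζ (by simp [hζ]) h1 hjζ
  have hjh : ¬ G.Adj wj h := fun h1 => hg.2.2.1 ((uniq h (by simp) h1).symm ▸ hζ)
  have hw2l : w2 ≠ [] := by
    rintro rfl
    simp at hwm; subst hwm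
    exact hjh hm.symm
  have hE2 : 2 ≤ (wj :: w2).length := by have := List.length_pos_of_ne_nil hw2l; simp; omega
  have hEU : ∀ v ∈ wj :: w2, v ∈ U := fun v hv => (hwU v (by simp at hv ⊢; tauto)).1
  have hhE : h ∉ wj :: w2 := fun h1 => (hwU h (by simp at h1 ⊢; tauto)).2 rfl
  have hEh : ∀ v ∈ wj :: w2, G.Adj h v → v = m := fun v hv hv' => by
    grind
  have hX : Xc G (wj :: w2) g wj ζ := by
    intro a ha b hb
    grind
  have fin : ∀ g : List V, HL G h g → (∀ v ∈ g, v ∈ U) → u ∈ g → Xc G (wj :: w2) g wj ζ → ζ ∈ g → (∃ g1 g2, g = g1 ++ ζ :: g2 ∧ (g1 = [] ∨ u ∈ ζ :: g2)) → False := by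
    rintro g hg hgU hug hX hζ ⟨g1, g2, rfl, h1⟩
    by_cases hg1 : g1 = []
    · subst hg1
      by_cases hu : u ∈ g2
      · exact hm' (ear2 hT ht hg hgU hE hEU rfl hwm hE2 hX hjζ hhE hm hEh hu (hNC _ (by
          rintro v (rfl | rfl)
          · exact hhU
          · exact hgU _ hζ) (clique2 ((hg.2.2.2 ζ hζ).2 (Or.inl rfl)))))
      · have hr := hg.rev
        have : u = ζ := by simp at hug; tauto
        simp only [List.nil_append, List.reverse_cons] at hr
        have hl := hg.2.1
        exact hm' (ear1 (g1 := g2.reverse) (g2 := []) hr (fun v hv => hgU v (by simp at hv ⊢; tauto)) hE hEU rfl hwm hE2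
          (fun a ha b hb => hX a ha b (by simp at hb ⊢; tauto)) hjζ hhE hm hEh (by rintro h1; simp at h1; subst h1; simp at hl) (by simp [this]))
    · exact hm' (ear1 hg hgU hE hEU rfl hwm hE2 hX hjζ hhE hm hEh hg1 (h1.resolve_left hg1))
  obtain ⟨g1, g2, rfl⟩ := List.append_of_mem hζ
  by_cases h1 : u ∈ ζ :: g2
  · exact fin _ hg hgU hug hX hζ ⟨g1, g2, rfl, Or.inr h1⟩
  · exact fin (g1 ++ ζ :: g2).reverse hg.rev (fun v hv => hgU v (List.mem_reverse.1 hv)) (List.mem_reverse.2 hug) (fun a ha b hb => hX a ha b (List.mem_reverse.1 hb)) (by simp)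
      ⟨g2.reverse, g1.reverse, by simp, Or.inr (by simp at hug h1 ⊢; tauto)⟩
theorem cut_exists [Finite V] (hT : TF G) (ht : T1 G) {x y z : V} (hxy : G.Adj x y) (hxz : G.Adj x z) (hyz : y ≠ z) :
    ∃ S : Set V, x ∉ S ∧ G.IsClique S ∧ y ∉ S ∧ z ∉ S ∧ ¬ R G ({x}ᶜ \ S) y z := by
  by_contra hcon
  push Not at hcon
  obtain ⟨U, ⟨hxU, hyU, hzU, hU⟩, hmin⟩ := (Set.toFinite {U : Set V | x ∉ U ∧ y ∈ U ∧ z ∈ U ∧ ∀ S ⊆ U, G.IsClique S → y ∉ S → z ∉ S → R G (U \ S) y z}).exists_minimal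
    ⟨{x}ᶜ, by simp, hxy.ne', hxz.ne', fun S hS hc hy hz => hcon S (fun h => hS h rfl) hc hy hz⟩
  have hNC : ∀ S ⊆ U, G.IsClique S → ∀ a ∈ U \ S, ∀ b ∈ U \ S, R G (U \ S) a b := by
    intro S hSU hS
    have key : ∀ a ∈ U \ S, (y ∈ comp G (U \ S) a ∨ z ∈ comp G (U \ S) a) := by
      intro a ha
      by_contra hc
      push Not at hc
      set D := comp G (U \ S) a
      have : U \ D ∈ {U : Set V | x ∉ U ∧ y ∈ U ∧ z ∈ U ∧ ∀ S ⊆ U, G.IsClique S → y ∉ S → z ∉ S → R G (U \ S) y z} := by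
        refine ⟨fun h => hxU h.1, ⟨hyU, hc.1⟩, ⟨hzU, hc.2⟩, fun S' hS' hcl hy hz => ?_⟩
        have hyS : y ∈ U \ S' := ⟨hyU, hy⟩
        refine bypass (comp_conn hyS) (D := D) (F := (U \ D) \ S') (fun v hv => ⟨⟨hv.1.1.1, hv.2⟩, hv.1.1.2⟩) ?_ y ⟨mem_comp hyS, hc.1⟩ z ⟨⟨⟨hzU, hz⟩, hU S' (fun v hv => (hS' hv).1) hcl hy hz⟩, hc.2⟩
        have : ∀ c ∈ comp G (U \ S') y \ D, (∃ d ∈ D, G.Adj c d) → c ∈ S := by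
          rintro c hc ⟨d, hd, hcd⟩
          by_contra hcS
          exact hc.2 (comp_step hd ⟨hc.1.1.1, hcS⟩ hcd.symm)
        intro c hc c' hc' h1 h2
        by_cases e : c = c'
        · rw [e]; exact R.refl _
        · exact R.adj (hS (this c hc h1) (this c' hc' h2) e) ⟨⟨hc.1.1.1, hc.2⟩, hc.1.1.2⟩ ⟨⟨hc'.1.1.1, hc'.2⟩, hc'.1.1.2⟩
      exact (hmin this Set.sdiff_subset ha.1).2 (mem_comp ha)
    intro a ha b hb
    have eyz : y ∈ U \ S → z ∈ U \ S → R G (U \ S) y z := fun hy hz => hU S hSU hS hy.2 hz.2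
    rcases key a ha with h1 | h1 <;> rcases key b hb with h2 | h2
    · exact h1.2.trans h2.2.symm
    · exact h1.2.trans ((eyz h1.1 h2.1).trans h2.2.symm)
    · exact h1.2.trans ((eyz h2.1 h1.1).symm.trans h2.2.symm)
    · exact h1.2.trans h2.2.symm
  have hyz' : ¬ G.Adj y z := fun h => hT x y z hxy h hxz
  have nbr : ∀ S ⊆ U, G.IsClique S → y ∉ S → z ∉ S → ∃ a ∈ U, a ∉ S ∧ a ≠ z ∧ a ≠ y ∧ G.Adj z a := by
    intro S hS hc hy hz
    obtain ⟨u, v, huv, hu, hv, rfl, hv'⟩ := (hU S hS hc hy hz).symm.cross (· = z) rfl hyz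
    exact ⟨v, hv.1, hv.2, hv', fun e => hyz' (e ▸ huv.symm), huv⟩
  obtain ⟨a, haU, -, haz, hay, hza⟩ := nbr ∅ (by simp) (by simp) (by simp) (by simp)
  obtain ⟨b, hbU, hba, hbz, -, hzb⟩ := nbr {a} (by simpa using haU) (by simp) (fun h => hay h.symm) (fun h => haz h.symm)
  obtain ⟨g, n, m, hg, hgn, hgm, rfl, ⟨hm, hmn⟩, hgU, hgA, hgB⟩ := exists_IP_sets (hNC {z} (by simpa using hzU) (by simp) a ⟨haU, haz⟩ b ⟨hbU, hbz⟩) ⟨haU, haz⟩ (· = a)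
    (fun v => G.Adj z v ∧ v ≠ a) rfl ⟨hzb, hba⟩
  have h0 : HL G z g := by
    refine HL.mk' hg ?_ (fun h => (hgU z h).2 rfl) hgn hgm hza hm fun w hw hzw => ?_
    · match g, hg, hgn, hgm with
      | [], _, h, _ => simp at h
      | [c], _, h1, h2 => simp at h1 h2; grind
      | [c, d], h, h1, h2 =>
        simp at h1 h2; subst h1 h2
        exact (hT z _ _ hza ((h.1 _ (by simp)).2.2 rfl) hm).elim
      | _ :: _ :: _ :: _, _, _, _ => simp
    · grind
  obtain ⟨g', rfl⟩ := List.head?_eq_some_iff.1 hgn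
  have h1 : HL G n (g' ++ [z]) := h0.rot
  have hgU' : ∀ v ∈ n :: g', v ∈ U := fun v hv => (hgU v hv).1
  have rot : ∀ {h n g}, HL G h (n :: g) → h ∈ U → (∀ v ∈ n :: g, v ∈ U) → z ∈ g ++ [h] → ∃ g, HL G n g ∧ (∀ v ∈ g, v ∈ U) ∧ z ∈ g :=
    fun h1 h2 h3 h4 => ⟨_, h1.rot, fun v hv => by
      grind, h4⟩
  obtain ⟨g, hg, hgU, hzg⟩ := (hNC {z} (by simpa using hzU) (by simp) n ⟨haU, haz⟩ y ⟨hyU, hyz⟩).prop (fun h => ∃ g, HL G h g ∧ (∀ v ∈ g, v ∈ U) ∧ z ∈ g) (by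
    rintro h m' hadj hh hm' ⟨g, hg, hgU, hzg⟩
    obtain ⟨c, hc⟩ : ∃ c, g.head? = some c := ⟨_, List.head?_eq_some_head (List.ne_nil_of_mem hzg)⟩
    obtain ⟨g2, k1, k2, k3, k4⟩ := th_all hT ht hNC hh.1 ⟨g, hg, hgU, hzg, hc⟩ hm'.1 hadj
    obtain ⟨g3, rfl⟩ := List.head?_eq_some_iff.1 k4
    refine rot k1 hh.1 k2 ?_
    grind) (rot h0 hzU hgU' (by simp))
  exact hyz (ht y g hg x hxy.ne (fun h => hxU (hgU x h)) y (by simp) z (by simp [hzg]) hxy hxz)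

def Light (G : SimpleGraph V) (w : V) : Prop := ∃ a b, ∀ u, G.Adj w u → u = a ∨ u = b
theorem lightN [Finite V] {s : Set V} (hs : Conn G s) (hl : ∀ v ∈ s, Light G v) : ∃ a b, ∀ v ∈ s, ∀ u, G.Adj v u → u ∈ s ∨ u = a ∨ u = b := by
  classical
  obtain ⟨b0, hb0⟩ := hs.1
  obtain ⟨t, ⟨hts, hbt, a, b, ht⟩, hmax⟩ := (Set.toFinite {t : Set V | t ⊆ s ∧ b0 ∈ t ∧ ∃ a b, ∀ v ∈ t, ∀ u, G.Adj v u → u ∈ t ∨ u = a ∨ u = b}).exists_maximal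
    ⟨{b0}, by simpa using hb0, rfl, (by
      obtain ⟨a, b, h⟩ := hl b0 hb0
      exact ⟨a, b, by grind⟩)⟩
  have aux : ∀ a b : V, (∀ v ∈ t, ∀ u, G.Adj v u → u ∈ t ∨ u = a ∨ u = b) → (∃ v ∈ t, G.Adj v a) → a ∈ s → a ∈ t := by
    rintro a b ht ⟨v, hv, hva⟩ has
    obtain ⟨c, d, h⟩ := hl a has
    refine hmax (y := insert a t) ⟨Set.insert_subset has hts, Set.mem_insert_of_mem _ hbt, b, if v = c then d else c, ?_⟩ (Set.subset_insert _ _) (Set.mem_insert _ _)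
    rintro w (rfl | hw) u hu
    · by_cases e : u = v
      · grind
      · right; right
        have h1 := h u hu; have h2 := h v hva.symm
        grind
    · grind
  have hst : s ⊆ t := by
    intro v hv
    by_contra hvt
    obtain ⟨u, w, huw, hu, hw, hut, hwt⟩ := (hs.2 b0 hb0 v hv).cross (· ∈ t) hbt hvt
    rcases ht u hut w huw with h | rfl | rfl
    · exact hwt h
    · exact hwt (aux w b ht ⟨u, hut, huw⟩ hw)
    · exact hwt (aux w a (fun v hv u hu => by grind <;> simp [h]) ⟨u, hut, huw⟩ hw)
  exact ⟨a, b, fun v hv u hu => (ht v (hst hv) u hu).imp_left (hts ·)⟩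
theorem noLight [Finite V] {M : V → V → Prop} {k : ℕ} {U : Set V} {ℬ : Set (Set V)} (h : MBr G M k U ℬ) (hk : 3 ≤ k) : ∀ B ∈ ℬ, ∃ v ∈ B, ¬ Light G v := by
  by_contra hcon
  push Not at hcon
  obtain ⟨B1, hB1, hl1⟩ := hcon
  obtain ⟨B0, ⟨hB0, hl⟩, hmin⟩ := (Set.toFinite {B | B ∈ ℬ ∧ ∀ v ∈ B, Light G v}).exists_minimal ⟨B1, hB1, hl1⟩
  obtain ⟨a, b, hab⟩ := lightN (h.br.1 B0 hB0) hl
  obtain ⟨b0, hb0⟩ := (h.br.1 B0 hB0).1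
  obtain ⟨B, hB, hX⟩ := h.ord ({b0, a, b} ∩ U) Set.inter_subset_right (by
    refine (Set.ncard_le_ncard Set.inter_subset_left (Set.toFinite _)).trans (le_trans ?_ hk)
    exact (Set.ncard_insert_le _ _).trans (Nat.succ_le_succ ((Set.ncard_insert_le _ _).trans (by simp))))
  have hX' : ∀ v ∈ B, v ≠ b0 ∧ v ≠ a ∧ v ≠ b := fun v hv => by
    have := (hX v hv).1
    have hU := h.sub B hB hv
    grind <;> rintro rfl <;> grind
  have hsub : B ⊆ B0 := by
    have step : ∀ v ∈ B0, ∀ u ∈ B, G.Adj v u → u ∈ B0 := fun v hv u hu huv => (hab v hv u huv).resolve_right (by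
      have := hX' u hu; tauto)
    have ex : ∃ v ∈ B, v ∈ B0 := by
      rcases h.br.2 B0 hB0 B hB with ⟨u, hu, hu'⟩ | ⟨u, hu, v, hv, huv⟩
      · exact ⟨u, hu', hu⟩
      · grind
    obtain ⟨v, hv, hv0⟩ := ex
    intro w hw
    exact ((h.br.1 B hB).2 v hv w hw).prop (· ∈ B0) (fun u u' huu' _ hu' h0 => step u h0 u' hu' huu') hv0
  grind
theorem crit_light [Finite V] {M : V → V → Prop} {k : ℕ} {U P B0 : Set V} {ℬ : Set (Set V)} (hc : Crit G M k U ℬ) (hT : TF G) {x y : V} (hx : x ∈ U) (hy : y ∈ U)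
    (hxy : G.Adj x y) (hPU : P ⊆ U) (hP : G.IsClique P) (hPM : ∀ c ∈ P, ∀ c' ∈ P, c' = c ∨ M c c') (hxP : x ∉ P) (hyP : y ∉ P)
    (hDM : ∀ d ∈ U, d ∉ P → ∀ p ∈ P, ¬ M d p) (hB0 : B0 ∈ ℬ) (h0 : ∀ b ∈ B0, b ≠ x ∧ b ∉ P ∧ b ∉ comp G (U \ insert x P) y) :
    ∃ a b, ∀ u ∈ U, G.Adj y u → u = a ∨ u = b := by
  set D := comp G (U \ insert x P) y with hD
  have hyU : y ∈ U \ insert x P := ⟨hy, by rintro (h | h); exact hxy.ne' h; exact hyP h⟩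
  have hyD : y ∈ D := mem_comp hyU
  have hN : ∀ d ∈ D, ∀ v ∈ U, G.Adj d v → v ∈ D ∨ v = x ∨ v ∈ P := fun d hd v hv hdv => by
    by_cases h : v ∈ insert x P
    · exact Or.inr h
    · exact Or.inl (comp_step hd ⟨hv, h⟩ hdv)
  have rl : ∀ l : List V, l.IsChain G.Adj → y ∈ l → (∀ v ∈ l, v ∈ D) → (∀ c ∈ P, (∃ d ∈ D, G.Adj c d) → ∃ c' ∈ P, ∃ r ∈ l, G.Adj r c') → D ⊆ {v | v ∈ l} := by
    intro l hl hyl hlD hat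
    refine hc.rl (D := D) (x := x) (P := P) (fun d hd => hd.1.1) hx (fun h => h.1.2 (by simp)) hPU (Set.disjoint_left.2 fun p hp h => h.1.2 (by simp [hp])) hP hN hlD ?_ ?_
      (fun d hd p hp => hDM d hd.1.1 (fun h => hd.1.2 (by simp [h])) p hp) hB0 (fun b hb => ⟨(h0 b hb).2.2, (h0 b hb).1, (h0 b hb).2.1⟩)
    · rw [Set.insert_eq]
      exact (Conn.single x).union_adj (chain_conn hl (List.ne_nil_of_mem hyl)) rfl hyl hxy
    · intro c hc' h
      obtain ⟨c', h1, r, h2, h3⟩ := hat c hc' h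
      grind
  obtain ⟨l, hl, hyl, hDl, hB⟩ : ∃ l, IP G l ∧ l.head? = some y ∧ D ⊆ {v | v ∈ l} ∧ ∀ v ∈ l, (∃ p ∈ P, G.Adj v p) → l.getLast? = some v := by
    by_cases h : ∃ d ∈ D, ∃ p ∈ P, G.Adj d p
    · obtain ⟨d, hd, hdp⟩ := h
      obtain ⟨l, y', e, hl, h1, h2, rfl, ⟨p, hp, hep⟩, h4, h5, h6⟩ := exists_IP_sets ((comp_conn hyU).2 y hyD d hd) hyD (· = y) (fun v => ∃ p ∈ P, G.Adj v p) rfl hdp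
      exact ⟨l, hl, h1, rl l hl.chain (mHe h1) h4 (fun c _ _ => ⟨p, hp, e, mLa h2, hep⟩), fun v hv hvp => by rw [h6 v hv hvp]; exact h2⟩
    · push Not at h
      exact ⟨[y], IP.single y, rfl, rl [y] (by simp) (by simp) (by simpa using hyD) (fun c hc' ⟨d, hd, hcd⟩ => absurd hcd.symm (h d hd c hc')), fun v hv _ => by simp at hv; simp [hv]⟩
  obtain ⟨l', rfl⟩ := List.head?_eq_some_iff.1 hyl
  by_cases hyp : ∃ p ∈ P, G.Adj y p
  · obtain ⟨p, hp, hyp'⟩ := hyp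
    have hl' : l' = [] := by
      cases l' with
      | nil => rfl
      | cons a l =>
        have := hB y (by simp) ⟨p, hp, hyp'⟩
        rw [List.getLast?_cons_cons] at this
        exact absurd rfl (hl.1 y (mLa this)).1
    subst hl'
    refine ⟨x, p, fun u hu hyu => ?_⟩
    rcases hN y hyD u hu hyu with h | h | h
    · have := hDl h; simp at this; exact absurd this hyu.ne'
    · exact Or.inl h
    · right; by_contra e
      exact hT y u p hyu (hP h hp e) hyp'
  · refine ⟨x, l'.headD x, fun u hu hyu => ?_⟩
    rcases hN y hyD u hu hyu with h | h | h
    · have h1 : u ∈ y :: l' := hDl h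
      rcases mCo h1 with h1 | h1
      · exact absurd h1 hyu.ne'
      · have := (hl.1 u h1).2.1 hyu
        grind
    · exact Or.inl h
    · exact absurd ⟨u, h, hyu⟩ hyp
theorem cut2 [Finite V] {k : ℕ} {B0 : Set V} {ℬ : Set (Set V)} (hc : VC G k ℬ) (hT : TF G) {x y q : V} (hxy : G.Adj x y) (hy : ¬ Light G y) (hxq : x ≠ q) (hyq : y ≠ q)
    (hB0 : B0 ∈ ℬ) (h0 : ∀ b ∈ B0, b ≠ x ∧ b ≠ q ∧ b ∉ comp G {x, q}ᶜ y) : False := by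
  obtain ⟨a, b, h⟩ := crit_light hc hT (P := {q}) trivial trivial hxy (Set.subset_univ _) (by simp) (by grind) hxq hyq
    (fun _ _ _ _ _ h => h) hB0 (by rw [← Set.compl_eq_univ_sdiff]; exact h0)
  exact hy ⟨a, b, fun u hu => h u trivial hu⟩

theorem compSub {s T : Set V} {a : V} (ha : a ∈ T) (h : ∀ u ∈ T, ∀ v ∈ s, G.Adj u v → v ∈ T) : comp G s a ⊆ T :=
  fun _ hb => hb.2.prop (· ∈ T) (fun u v huv _ hv hu => h u hu v hv huv) ha
structure LP (G : SimpleGraph V) (D : Set V) (x p : V) (l : List V) (a : V) : Prop where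
  ip : IP G l
  sub : ∀ v ∈ l, v ∈ D
  hd : l.head? = some a
  xa : G.Adj x a
  ux : ∀ v ∈ l, G.Adj x v → v = a
  last : ∃ e, l.getLast? = some e ∧ G.Adj e p
  up : ∀ v ∈ l, G.Adj v p → l.getLast? = some v
def RLc (G : SimpleGraph V) (D : Set V) (x p q : V) : Prop :=
  ∀ Q ⊆ D, Conn G (insert x Q) → (∃ r ∈ Q, G.Adj r p) → (∃ r ∈ Q, G.Adj r q) → D ⊆ Q
theorem LP.conn {D : Set V} {x p a : V} {l : List V} (h : LP G D x p l a) : Conn G (insert x {v | v ∈ l}) := by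
  rw [Set.insert_eq]
  exact (Conn.single x).union_adj (chain_conn h.ip.chain (List.ne_nil_of_mem (mHe h.hd))) rfl (show a ∈ l from mHe h.hd) h.xa
theorem LP.rl {D : Set V} {x p q a : V} {l : List V} (h : LP G D x p l a) (hR : RLc G D x p q) (hq : ∃ r ∈ l, G.Adj r q) : ∀ d ∈ D, d ∈ l := by
  obtain ⟨e, he, hep⟩ := h.last
  exact fun d hd => hR {v | v ∈ l} h.sub h.conn ⟨e, mLa he, hep⟩ hq hd
theorem LP.light {D : Set V} {x p w a : V} {l l1 l2 : List V} (h : LP G D x p l a) (hl : l = l1 ++ w :: l2)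
    (hN : ∀ u, G.Adj w u → u ∈ l ∨ u = x ∨ u = p) : Light G w := by
  subst hl
  refine ⟨l1.getLast?.getD x, l2.head?.getD p, fun u hu => ?_⟩
  have hip := IP_append.1 h.ip
  rcases hN u hu with h1 | rfl | rfl
  · rcases mAp h1 with h1 | h1
    · left; rw [((hip.2.2 u h1 w (by simp)).2.1 hu.symm).1]; rfl
    · right
      rcases mCo h1 with rfl | h1
      · exact absurd hu G.irrefl
      · rw [(hip.2.1.1 u h1).2.1 hu]; rfl
  · left
    have := h.ux w (by simp) hu.symm
    cases l1 with
    | nil => rfl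
    | cons b l1 =>
      have hb := h.hd; grind
  · right
    have := h.up w (by simp) hu
    cases l2 with
    | nil => rfl
    | cons b l2 =>
      rw [getLast?_ac, List.getLast?_cons_cons] at this
      exact absurd rfl (hip.2.1.1 w (mLa this)).1
theorem tch {D : Set V} {x p q a τ : V} {lp T L : List V} (hp : LP G D x p lp a) (hR : RLc G D x p q) (hL : ∀ v ∈ L, v ∈ lp) (hT : IP G T)
    (hTD : ∀ v ∈ T, v ∈ D) (hq : ∃ e, T.getLast? = some e ∧ G.Adj e q) (hh : T.head? = some τ) (hτ : τ ∉ lp) :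
    ∀ v ∈ T, ∀ b ∈ L, (b = v ∨ G.Adj b v) → v = τ := by
  intro v hv b hb hbv
  obtain ⟨T1, c, T2, rfl, ⟨b', hb', hbc⟩, hl⟩ := split_last (fun v => ∃ b ∈ L, b = v ∨ G.Adj b v) (l := T) ⟨v, hv, b, hb, hbv⟩
  obtain ⟨e, he, heq⟩ := hq
  obtain ⟨f, hf, hfp⟩ := hp.last
  have h1 : Conn G {v | v ∈ c :: T2} := chain_conn hT.right.chain (by simp)
  have := hR ({v | v ∈ lp} ∪ {v | v ∈ c :: T2}) (by
    rintro v (h | h)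
    · exact hp.sub v h
    · grind) (by
    rw [← Set.insert_union]
    rcases hbc with rfl | h
    · exact hp.conn.union h1 ⟨b', Or.inr (hL _ hb'), by simp⟩
    · exact hp.conn.union_adj h1 (Or.inr (hL _ hb')) (by simp) h) ⟨f, Or.inl (mLa hf), hfp⟩
    ⟨e, Or.inr (by rw [getLast?_ac] at he; exact mLa he), heq⟩ (hTD τ (mHe hh))
  have hτ2 : τ ∈ c :: T2 := this.resolve_left hτ
  cases T1 with
  | nil =>
    grind
  | cons d T1 =>
    simp at hh; subst hh
    exact absurd rfl (hT.1 d (List.mem_append_right _ hτ2)).1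
theorem RLc.symm {D : Set V} {x p q : V} (h : RLc G D x p q) : RLc G D x q p := fun Q h1 h2 h3 h4 => h Q h1 h2 h4 h3
theorem LP.step {D : Set V} {x y p q w : V} {l : List V} (h : LP G D x p l y) (hR : RLc G D x p q) (hN : ∀ d ∈ D, ∀ u, G.Adj d u → u ∈ D ∨ u = x ∨ u = p ∨ u = q)
    (hw : w ∈ l) (hwy : w ≠ y) (hwl : ¬ Light G w) (hwN : ∀ u ∈ D, G.Adj w u → u ∈ l) : G.Adj w q ∧ comp G {x, w, q}ᶜ y ⊆ D \ {w} := by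
  obtain ⟨l1, l2, rfl⟩ := List.append_of_mem hw
  have hwq : G.Adj w q := by
    by_contra hq
    refine hwl (h.light rfl fun u hu => ?_)
    rcases hN w (h.sub w hw) u hu with h1 | h1 | h1 | h1
    · grind
    · grind
    · grind
    · grind
  have hDl := h.rl hR ⟨w, hw, hwq⟩
  have hip := IP_append.1 h.ip
  have hy : y ∈ l1 := by
    have := h.hd
    cases l1 with
    | nil => grind
    | cons b l => simp at this; simp [this]
  refine ⟨hwq, fun v hv => ?_⟩
  have hv1 : v ∈ {v | v ∈ l1} := by
    refine compSub (s := {x, w, q}ᶜ) (T := {v | v ∈ l1}) hy (fun u hu v hv huv => ?_) hv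
    simp only [Set.mem_compl_iff, Set.mem_insert_iff, Set.mem_singleton_iff, not_or] at hv
    rcases hN u (h.sub u (List.mem_append_left _ hu)) v huv with h1 | h1 | h1 | h1
    · grind
    · grind
    · have := h.up u (List.mem_append_left _ hu) (h1 ▸ huv)
      rw [getLast?_ac] at this
      exact absurd rfl (hip.2.2 u hu u (mLa this)).1
    · grind
  exact ⟨h.sub v (List.mem_append_left _ hv1), (hip.2.2 v hv1 w (by simp)).1⟩
def Sp (G : SimpleGraph V) (x y p q : V) : Prop :=
  G.Adj p q ∧ x ≠ p ∧ x ≠ q ∧ y ≠ p ∧ y ≠ q ∧ ∀ w ∈ comp G {x, p, q}ᶜ y, w ≠ y → Light G w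
theorem Sp.symm {x y p q : V} (h : Sp G x y p q) : Sp G x y q p :=
  ⟨h.1.symm, h.2.2.1, h.2.1, h.2.2.2.2.1, h.2.2.2.1, by rw [Set.pair_comm]; exact h.2.2.2.2.2⟩
theorem LP.anti {D : Set V} {x y p q : V} {tp tq : List V} (hT : TF G) (hp : LP G D x p (y :: tp) y) (hq : LP G D x q (y :: tq) y) (hR : RLc G D x p q)
    (hs : ∀ s, tp.head? = some s → tq.head? ≠ some s) : ∀ a ∈ tp, ∀ b ∈ tq, a ≠ b ∧ ¬ G.Adj a b := by
  intro a ha b hb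
  have h1 : ∃ s, tp.head? = some s := by cases tp; simp at ha; simp
  have h2 : ∃ s, tq.head? = some s := by cases tq; simp at hb; simp
  obtain ⟨s, hs1⟩ := h1
  obtain ⟨s', hs2⟩ := h2
  have las : ∀ {p : V} {t : List V} {s : V}, LP G D x p (y :: t) y → t.head? = some s → ∃ e, t.getLast? = some e ∧ G.Adj e p := by
    intro p t s h hs
    obtain ⟨e, he, hep⟩ := h.last
    cases t with
    | nil => simp at hs
    | cons b t => grind
  have hyp : ∀ {p : V} {t : List V} {s : V}, LP G D x p (y :: t) y → t.head? = some s → G.Adj y s := fun h hs => (h.ip.1 _ (mHe hs)).2.2 hs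
  have nin : ∀ {p : V} {t : List V} {s : V}, LP G D x p (y :: t) y → t.head? ≠ some s → G.Adj y s → s ∉ y :: t := by
    intro p t s h hs hys hm
    rcases mCo hm with rfl | hm
    · exact absurd hys G.irrefl
    · exact hs ((h.ip.1 s hm).2.1 hys)
  have e1 := fun h => tch hp hR (L := tp) (fun v hv => List.mem_cons_of_mem _ hv) hq.ip.2 (fun v hv => hq.sub v (List.mem_cons_of_mem _ hv)) (las hq hs2) hs2
    (nin hp (fun h => hs s' h hs2) (hyp hq hs2)) b hb a ha h
  have e2 := fun h => tch hq hR.symm (L := tq) (fun v hv => List.mem_cons_of_mem _ hv) hp.ip.2 (fun v hv => hp.sub v (List.mem_cons_of_mem _ hv)) (las hp hs1) hs1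
    (nin hq (fun h => hs s hs1 h) (hyp hp hs1)) a ha b hb h
  constructor
  · grind
  · intro e
    have h3 := e1 (Or.inr e); have h4 := e2 (Or.inr e.symm)
    subst h3 h4; exact hT y a b (hyp hp hs1) e (hyp hq hs2)

theorem spN [Finite V] {k : ℕ} {B0 : Set V} {ℬ : Set (Set V)} (hc : VC G k ℬ) (hT : TF G) {x y p q : V} (hxy : G.Adj x y) (hy : ¬ Light G y)
    (h2 : x ≠ q) (h3 : y ≠ p) (h4 : y ≠ q) (hB0 : B0 ∈ ℬ) (h0 : ∀ b ∈ B0, b ≠ x ∧ b ≠ q ∧ b ∉ comp G {x, p, q}ᶜ y) : ∃ d ∈ comp G {x, p, q}ᶜ y, G.Adj d p := by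
  by_contra hcon
  push Not at hcon
  refine cut2 hc hT hxy hy h2 h4 hB0 fun b hb => ⟨(h0 b hb).1, (h0 b hb).2.1, fun hbc => (h0 b hb).2.2 (compSub (s := {x, q}ᶜ) ?_ ?_ hbc)⟩
  · exact mem_comp (by simp [hxy.ne', h3, h4])
  · intro u hu v hv huv
    refine comp_step hu ?_ huv
    grind
theorem LP.exists {D : Set V} {x y p : V} (hD : Conn G D) (hy : y ∈ D) (hxy : G.Adj x y) (h : ∃ d ∈ D, G.Adj d p) : ∃ l a, LP G D x p l a := by
  obtain ⟨d, hd, hdp⟩ := h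
  obtain ⟨l, a, e, h1, h2, h3, h4, h5, h6, h7, h8⟩ := exists_IP_sets (hD.2 y hy d hd) hy (G.Adj x) (G.Adj · p) hxy hdp
  exact ⟨l, a, h1, h6, h2, h4, h7, ⟨e, h3, h5⟩, fun v hv h => by grind⟩
theorem LP.side {D : Set V} {x y p q b : V} {lp lq : List V} (hT : TF G) (hp : LP G D x p lp y) (hq : LP G D x q lq b) (hR : RLc G D x p q) (hyb : y ≠ b)
    (hN : ∀ d ∈ D, ∀ u, G.Adj d u → u ∈ D ∨ u = x ∨ u = p ∨ u = q) (hDl : ∀ d ∈ D, d ∈ lp ∨ d ∈ lq) : Light G y := by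
  have n1 : b ∉ lp := fun h => hyb (hp.ux b h hq.xa).symm
  have n2 : y ∉ lq := fun h => hyb (hq.ux y h hp.xa)
  have hyl := mHe hp.hd
  obtain ⟨l', rfl⟩ := List.head?_eq_some_iff.1 hp.hd
  refine hp.light (l1 := []) rfl fun u hu => ?_
  rcases hN y (hp.sub y hyl) u hu with h | h | h | h
  · refine Or.inl ((hDl u h).resolve_right fun hul => ?_)
    have e1 := tch hp hR (L := y :: l') (fun _ h => h) hq.ip hq.sub hq.last hq.hd n1 u hul y hyl (Or.inr hu)
    subst e1
    exact hT x y u hp.xa hu hq.xa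
  · grind
  · grind
  · subst h
    exact absurd (hp.rl hR ⟨y, hyl, hu⟩ b (hq.sub b (mHe hq.hd))) n1
theorem sp1 [Finite V] {k : ℕ} {B0 : Set V} {ℬ : Set (Set V)} (hc : VC G k ℬ) (hT : TF G) {x y : V} (hxy : G.Adj x y) (hy : ¬ Light G y) (hB0 : B0 ∈ ℬ) :
    ∀ (n : ℕ) (p q : V), G.Adj p q → x ≠ p → x ≠ q → y ≠ p → y ≠ q → (∀ b ∈ B0, b ≠ x ∧ b ≠ p ∧ b ≠ q ∧ b ∉ comp G {x, p, q}ᶜ y) →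
      (comp G {x, p, q}ᶜ y).ncard ≤ n → ∃ p q, Sp G x y p q := by
  intro n
  induction n with
  | zero =>
    intro p q _ _ _ h3 h4 _ hn
    exact absurd (mem_comp (G := G) (s := {x, p, q}ᶜ) (a := y) (by simp [hxy.ne', h3, h4])) (by
      rw [(Set.ncard_eq_zero (Set.toFinite _)).1 (Nat.le_zero.1 hn)]; simp)
  | succ n ih =>
    intro p q hpq h1 h2 h3 h4 h0 hn
    by_contra hcon
    obtain ⟨w, hw, hwy, hwl⟩ : ∃ w ∈ comp G {x, p, q}ᶜ y, w ≠ y ∧ ¬ Light G w := by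
      by_contra h
      push Not at h
      exact hcon ⟨p, q, hpq, h1, h2, h3, h4, h⟩
    have e1 := spN hc hT hxy hy h2 h3 h4 hB0 (fun b hb => ⟨(h0 b hb).1, (h0 b hb).2.2.1, (h0 b hb).2.2.2⟩)
    have e2 := spN (p := q) (q := p) hc hT hxy hy h1 h4 h3 hB0 (fun b hb => ⟨(h0 b hb).1, (h0 b hb).2.1, by rw [Set.pair_comm]; grind⟩)
    rw [Set.pair_comm q p] at e2
    have hyD : y ∈ comp G {x, p, q}ᶜ y := mem_comp (by simp [hxy.ne', h3, h4])
    have hDc : Conn G (comp G {x, p, q}ᶜ y) := comp_conn (by simp [hxy.ne', h3, h4])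
    have hN : ∀ d ∈ comp G {x, p, q}ᶜ y, ∀ u, G.Adj d u → u ∈ comp G {x, p, q}ᶜ y ∨ u = x ∨ u = p ∨ u = q := fun d hd u hu => by
      by_cases h : u ∈ ({x, p, q} : Set V)
      · exact Or.inr h
      · exact Or.inl (comp_step hd h hu)
    have hnD : ∀ d ∈ comp G {x, p, q}ᶜ y, d ≠ x ∧ d ≠ p ∧ d ≠ q := fun d hd => by
      have := comp_sub hd; simpa using this
    have hR : RLc G (comp G {x, p, q}ᶜ y) x p q := fun Q hQ hcn hp hq => by
      refine hc.rl' (P := {p, q}) (fun h => (hnD x h).1 rfl) ?_ (clique2 hpq) hN hQ hcn ?_ hB0 (fun b hb => ⟨(h0 b hb).2.2.2, (h0 b hb).1, ?_⟩)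
      · grind
      · grind
      · have := h0 b hb
        simp [this]
    generalize hDe : comp G {x, p, q}ᶜ y = D at *
    obtain ⟨lp, a, hp⟩ := LP.exists hDc hyD hxy e1
    obtain ⟨lq, b, hq⟩ := LP.exists hDc hyD hxy e2
    have hDl : ∀ d ∈ D, d ∈ lp ∨ d ∈ lq := by
      obtain ⟨e, he, hep⟩ := hp.last
      obtain ⟨f, hf, hfq⟩ := hq.last
      refine fun d hd => hR ({v | v ∈ lp} ∪ {v | v ∈ lq}) (by rintro v (h | h); exact hp.sub v h; exact hq.sub v h) ?_
        ⟨e, Or.inl (mLa he), hep⟩ ⟨f, Or.inr (mLa hf), hfq⟩ hd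
      rw [Set.insert_union_distrib]
      exact hp.conn.union hq.conn ⟨x, by simp, by simp⟩
    by_cases hab : a = b
    · subst hab
      have hya : y = a := (hDl y hyD).elim (fun h => hp.ux y h hxy) (fun h => hq.ux y h hxy)
      subst hya
      obtain ⟨tp, rfl⟩ := List.head?_eq_some_iff.1 hp.hd
      obtain ⟨tq, rfl⟩ := List.head?_eq_some_iff.1 hq.hd
      have hs : ∀ s, tp.head? = some s → tq.head? ≠ some s := by
        intro s hs hs'
        have nl : ∀ {p : V} {t : List V}, LP G D x p (y :: t) y → t.head? = some s → ¬ G.Adj y p := by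
          intro p t h ht hyp
          have := h.up y (by simp) hyp
          cases t with
          | nil => simp at ht
          | cons b t =>
            rw [List.getLast?_cons_cons] at this
            exact absurd rfl (h.ip.1 y (mLa this)).1
        have nn : ∀ {p : V} {t : List V}, LP G D x p (y :: t) y → t.head? = some s → ∀ u ∈ y :: t, G.Adj y u → u = s := by
          intro p t h ht u hu hyu
          rcases mCo hu with rfl | hu
          · exact absurd hyu G.irrefl
          · have := (h.ip.1 u hu).2.1 hyu
            grind
        refine hy ⟨x, s, fun u hu => ?_⟩
        grind
      have hanti := LP.anti hT hp hq hR hs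
      have fin : ∀ q' : V, x ≠ q' → y ≠ q' → (∀ b ∈ B0, b ≠ q') → G.Adj w q' → comp G {x, w, q'}ᶜ y ⊆ D \ {w} → False := by
        intro q' hq1 hq2 hq3 hwq hsub
        have := hnD w hw
        refine hcon (ih w q' hwq this.1.symm hq1 hwy.symm hq2 (fun b hb => ⟨(h0 b hb).1, ?_, hq3 b hb, fun h => (h0 b hb).2.2.2 (hsub h).1⟩) ?_)
        · grind
        · have := Set.ncard_lt_ncard (s := comp G {x, w, q'}ᶜ y) (t := D) ⟨fun v h => (hsub h).1, fun h => (hsub (h hw)).2 rfl⟩ (Set.toFinite _)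
          omega
      rcases hDl w hw with h | h
      · have := hp.step hR hN h hwy hwl (fun u hu hwu => (hDl u hu).elim id (fun h' => by
          grind))
        exact fin q h2 h4 (fun b hb => (h0 b hb).2.2.1) this.1 this.2
      · have := hq.step hR.symm (fun d hd u hu => by have := hN d hd u hu; tauto) h hwy hwl (fun u hu hwu => (hDl u hu).elim (fun h' => by
          rcases mCo h' with rfl | h'
          · simp
          · exact absurd hwu.symm (hanti u h' w (List.mem_of_ne_of_mem hwy h)).2) id)
        exact fin p h1 h3 (fun b hb => (h0 b hb).2.1) this.1 this.2
    · rcases hDl y hyD with h | h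
      · have := hp.ux y h hxy
        subst this
        exact hy (hp.side hT hq hR hab hN hDl)
      · have := hq.ux y h hxy
        subst this
        exact hy (hq.side hT hp hR.symm (Ne.symm hab) (fun d hd u hu => by have := hN d hd u hu; tauto) (fun d hd => (hDl d hd).symm))

theorem oneSide {s B : Set V} {y z : V} (hB : Conn G B) (hs : B ⊆ s) (h : ¬ R G s y z) : (∀ b ∈ B, b ∉ comp G s y) ∨ ∀ b ∈ B, b ∉ comp G s z := by
  by_contra hcon
  push Not at hcon
  obtain ⟨⟨b, hb, hb1⟩, ⟨c, hc, hc1⟩⟩ := hcon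
  exact h (hb1.2.trans (((hB.2 b hb c hc).mono hs).trans hc1.2.symm))
theorem nc3 [Finite V] (a b c : V) : ({a, b, c} : Set V).ncard ≤ 3 :=
  (Set.ncard_insert_le _ _).trans (Nat.succ_le_succ ((Set.ncard_insert_le _ _).trans (by simp)))
theorem nc4 [Finite V] (a b c d : V) : ({a, b, c, d} : Set V).ncard ≤ 4 :=
  (Set.ncard_insert_le _ _).trans (Nat.succ_le_succ (nc3 b c d))
theorem SP [Finite V] {k : ℕ} {ℬ : Set (Set V)} (hc : VC G k ℬ) (hT : TF G) (hT1 : T1 G) (hk : 4 ≤ k) {x y z : V} (hxy : G.Adj x y) (hxz : G.Adj x z)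
    (hyz : y ≠ z) (hy : ¬ Light G y) (hz : ¬ Light G z) : (∃ p q, Sp G x y p q) ∨ ∃ p q, Sp G x z p q := by
  obtain ⟨S, hxS, hS, hyS, hzS, hR⟩ := cut_exists hT hT1 hxy hxz hyz
  rcases S.eq_empty_or_nonempty with rfl | ⟨p, hp⟩
  · exact absurd (ncc hc (C := {x}) (by simp) ⟨x, rfl⟩ (by simp; omega) (a := y) (b := z) (by simp [hxy.ne']) (by simp [hxz.ne'])) (by simpa using hR)
  have np : ∀ {v}, v ∉ S → ∀ {u}, u ∈ S → v ≠ u := fun hv u hu e => hv (e ▸ hu)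
  by_cases hq : ∃ q ∈ S, q ≠ p
  · obtain ⟨q, hq, hqp⟩ := hq
    have hSe : S = {p, q} := by
      refine Set.Subset.antisymm (fun v hv => ?_) (by rintro v (rfl | rfl) <;> assumption)
      by_contra h
      simp at h
      exact hT v p q (hS hv hp h.1) (hS hp hq (Ne.symm hqp)) (hS hv hq h.2)
    have e : {x}ᶜ \ S = ({x, p, q} : Set V)ᶜ := by
      rw [hSe]; ext v; simp
    rw [e] at hR
    obtain ⟨B0, hB0, h0⟩ := hc.ord' ((nc3 x p q).trans (by omega))
    have h0' : ∀ b ∈ B0, b ≠ x ∧ b ≠ p ∧ b ≠ q := fun b hb => by simpa using h0 b hb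
    rcases oneSide (hc.br.1 B0 hB0) h0 hR with h | h
    · exact Or.inl (sp1 hc hT hxy hy hB0 _ p q (hS hp hq (Ne.symm hqp)) (np hxS hp) (np hxS hq) (np hyS hp) (np hyS hq)
        (fun b hb => ⟨(h0' b hb).1, (h0' b hb).2.1, (h0' b hb).2.2, h b hb⟩) le_rfl)
    · exact Or.inr (sp1 hc hT hxz hz hB0 _ p q (hS hp hq (Ne.symm hqp)) (np hxS hp) (np hxS hq) (np hzS hp) (np hzS hq)
        (fun b hb => ⟨(h0' b hb).1, (h0' b hb).2.1, (h0' b hb).2.2, h b hb⟩) le_rfl)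
  · push Not at hq
    have e : {x}ᶜ \ S = ({x, p} : Set V)ᶜ := by
      ext v
      grind
    rw [e] at hR
    obtain ⟨B0, hB0, h0⟩ := hc.ord' ((nc3 x p p).trans (by omega))
    have h0' : ∀ b ∈ B0, b ≠ x ∧ b ≠ p := fun b hb => by simpa using h0 b hb
    rcases oneSide (hc.br.1 B0 hB0) (fun b hb => by simpa using h0' b hb) hR with h | h
    · exact (cut2 hc hT hxy hy (np hxS hp) (np hyS hp) hB0 fun b hb => ⟨(h0' b hb).1, (h0' b hb).2, h b hb⟩).elim
    · exact (cut2 hc hT hxz hz (np hxS hp) (np hzS hp) hB0 fun b hb => ⟨(h0' b hb).1, (h0' b hb).2, h b hb⟩).elim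
theorem Sp.out [Finite V] {M : V → V → Prop} {k : ℕ} {U : Set V} {ℬ : Set (Set V)} {B0 : Set V} (hc : MBr G M k U ℬ) (hk : 4 ≤ k) {x y p q : V} (h : Sp G x y p q) (hB0 : B0 ∈ ℬ)
    (h0 : ∀ b ∈ B0, b ≠ x ∧ b ≠ y ∧ b ≠ p ∧ b ≠ q) : ∀ b ∈ B0, b ∉ comp G {x, p, q}ᶜ y := by
  intro b hb hbc
  have := (hc.br.1 B0 hB0).sub_comp (s := {x, p, q}ᶜ) (fun b hb => by have := h0 b hb; simp [this]) ⟨b, hb, hbc⟩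
  obtain ⟨v, hv, hl⟩ := noLight hc (by omega) B0 hB0
  exact hl (h.2.2.2.2.2 v (this hv) (h0 v hv).2.1)
theorem Sp.b0 [Finite V] {k : ℕ} {ℬ : Set (Set V)} (hc : VC G k ℬ) (hk : 4 ≤ k) (x y p q : V) : ∃ B0 ∈ ℬ, ∀ b ∈ B0, b ≠ x ∧ b ≠ y ∧ b ≠ p ∧ b ≠ q := by
  obtain ⟨B0, hB0, h0⟩ := hc.ord' ((nc4 x y p q).trans hk)
  exact ⟨B0, hB0, fun b hb => by simpa using h0 b hb⟩
theorem Sp.nb [Finite V] {k : ℕ} {ℬ : Set (Set V)} (hc : VC G k ℬ) (hT : TF G) (hk : 4 ≤ k) {x y p q : V} (h : Sp G x y p q) (hxy : G.Adj x y)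
    (hy : ¬ Light G y) : ∃ d ∈ comp G {x, p, q}ᶜ y, G.Adj d p := by
  obtain ⟨B0, hB0, h0⟩ := Sp.b0 hc hk x y p q
  exact spN hc hT hxy hy h.2.2.1 h.2.2.2.1 h.2.2.2.2.1 hB0 fun b hb => ⟨(h0 b hb).1, (h0 b hb).2.2.2, h.out hc.toMBr hk hB0 h0 b hb⟩
theorem F1 [Finite V] {k : ℕ} {ℬ : Set (Set V)} (hc : VC G k ℬ) (hT : TF G) (hk : 4 ≤ k) {x y p q : V} (h : Sp G x y p q) (hxy : G.Adj x y)
    (hy : ¬ Light G y) : ¬ Light G p := by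
  rintro ⟨a, b, hab⟩
  obtain ⟨B0, hB0, h0⟩ := Sp.b0 hc hk x y p q
  obtain ⟨d, hd, hdp⟩ := h.nb hc hT hk hxy hy
  obtain ⟨hpq, h1, h2, h3, h4, h5⟩ := id h
  refine cut2 hc hT hxy hy h2 h4 hB0 fun c hcB => ⟨(h0 c hcB).1, (h0 c hcB).2.2.2, fun hcc => ?_⟩
  have hsub : comp G {x, q}ᶜ y ⊆ insert p (comp G {x, p, q}ᶜ y) := by
    refine compSub (Or.inr (mem_comp (by simp [hxy.ne', h3, h4]))) ?_
    rintro u (rfl | hu) v hv huv <;> simp only [Set.mem_compl_iff, Set.mem_insert_iff, Set.mem_singleton_iff, not_or] at hv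
    · have hdq : d ≠ q := fun e => by have := comp_sub hd; simp [e] at this
      have : v = d := by
        have e1 := hab v huv; have e2 := hab q hpq; have e3 := hab d hdp.symm
        grind
      grind
    · by_cases e : v = p
      · exact Or.inl e
      · exact Or.inr (comp_step hu (by simp [e, hv]) huv)
  rcases hsub hcc with e | e
  · grind
  · exact h.out hc.toMBr hk hB0 h0 c hcB e
theorem F3 [Finite V] {k : ℕ} {ℬ : Set (Set V)} (hc : VC G k ℬ) (hT : TF G) (hk : 4 ≤ k) {x y p q : V} (h : Sp G x y p q) (hxy : G.Adj x y)
    (hy : ¬ Light G y) : ∀ p' q', ¬ Sp G q p p' q' := by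
  intro p' q' h'
  have hp := F1 hc hT hk h hxy hy
  have hqp := h.1.symm
  have hp' := F1 hc hT hk h' hqp hp
  have hq' := F1 hc hT hk h'.symm hqp hp
  obtain ⟨d, hd, hdp⟩ := h.nb hc hT hk hxy hy
  have hyD : y ∈ comp G {x, p, q}ᶜ y := mem_comp (by simp [hxy.ne', h.2.2.2.1, h.2.2.2.2.1])
  have hDc : Conn G (comp G {x, p, q}ᶜ y) := comp_conn (comp_sub hyD)
  have hpD : p ∈ comp G {q, p', q'}ᶜ p := mem_comp (by simp [h.1.ne, h'.2.2.2.1, h'.2.2.2.2.1])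
  have key : ∀ p' q', Sp G q p p' q' → p' ∈ comp G {x, p, q}ᶜ y → ¬ Light G p' → ¬ Light G q' → False := by
    intro p' q' h' hpD' hp' hq'
    have e : p' = y := by
      by_contra e
      exact hp' (h.2.2.2.2.2 p' hpD' e)
    subst e
    have e : q' = x := by
      by_contra e
      refine hq' (h.2.2.2.2.2 q' (comp_step hyD ?_ h'.1) h'.1.ne')
      simp [e, h'.2.2.1.symm, h'.2.2.2.2.1.symm]
    subst e
    have hpD : p ∈ comp G {q, p', q'}ᶜ p := mem_comp (by simp [h.1.ne, h'.2.2.2.1, h'.2.2.2.2.1])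
    obtain ⟨B0, hB0, h0⟩ := Sp.b0 hc hk q' p' p q
    refine cut2 hc hT hxy hy h.2.2.1 h.2.2.2.2.1 hB0 fun c hcB => ⟨(h0 c hcB).1, (h0 c hcB).2.2.2, fun hcc => ?_⟩
    have hsub : comp G {q', q}ᶜ p' ⊆ comp G {q', p, q}ᶜ p' ∪ comp G {q, p', q'}ᶜ p := by
      refine compSub (Or.inl hyD) ?_
      rintro u (hu | hu) v hv huv <;> simp only [Set.mem_compl_iff, Set.mem_insert_iff, Set.mem_singleton_iff, not_or] at hv
      · by_cases e : v = p
        · grind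
        · exact Or.inl (comp_step hu (by simp [e, hv]) huv)
      · by_cases e : v = p'
        · exact Or.inl (e ▸ hyD)
        · exact Or.inr (comp_step hu (by simp [e, hv]) huv)
    rcases hsub hcc with e | e
    · exact h.out hc.toMBr hk hB0 h0 c hcB e
    · exact h'.out hc.toMBr hk hB0 (fun b hb => by grind) c hcB e
  by_cases hm : p' ∈ comp G {x, p, q}ᶜ y
  · grind
  by_cases hm' : q' ∈ comp G {x, p, q}ᶜ y
  · exact key q' p' h'.symm hm' hq' hp'
  have hsub := hDc.sub_comp (s := {q, p', q'}ᶜ) (a := p) (fun v hv => by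
    have := comp_sub hv
    simp at this ⊢
    grind) ⟨d, hd, comp_step hpD (by
    have := comp_sub hd
    simp at this ⊢
    grind) hdp.symm⟩
  exact hy (h'.2.2.2.2.2 y (hsub hyD) h.2.2.2.1)
def S0 (G : SimpleGraph V) (x y : V) : Prop :=
  G.Adj x y ∧ ¬ Light G x ∧ ¬ Light G y ∧ (∀ p q, ¬ Sp G x y p q) ∧ ∀ p q, ¬ Sp G y x p q
theorem S0.isM [Finite V] {k : ℕ} {ℬ : Set (Set V)} (hc : VC G k ℬ) (hT : TF G) (hT1 : T1 G) (hk : 4 ≤ k) : IsM G (S0 G) where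
  symm := fun ⟨h1, h2, h3, h4, h5⟩ => ⟨h1.symm, h3, h2, h5, h4⟩
  uniq := fun h h' => by
    by_contra e
    rcases SP hc hT hT1 hk h.1 h'.1 e h.2.2.1 h'.2.2.1 with ⟨p, q, hs⟩ | ⟨p, q, hs⟩
    · exact h.2.2.2.1 p q hs
    · exact h'.2.2.2.1 p q hs
  adj := fun h => h.1
theorem F3' [Finite V] {k : ℕ} {ℬ : Set (Set V)} (hc : VC G k ℬ) (hT : TF G) (hk : 4 ≤ k) {x y p q : V} (h : Sp G x y p q) (hxy : G.Adj x y)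
    (hy : ¬ Light G y) : S0 G p q :=
  ⟨h.1, F1 hc hT hk h hxy hy, F1 hc hT hk h.symm hxy hy, F3 hc hT hk h.symm hxy hy, F3 hc hT hk h hxy hy⟩

structure L2 (G : SimpleGraph V) (M : V → V → Prop) (k : ℕ) (ℬ : Set (Set V)) : Prop where
  m : IsM G M
  mb : MBr G M k Set.univ ℬ
  ed : ∀ x y, G.Adj x y → M x y ∨ Light G x ∨ Light G y
  nl : ∀ x y, M x y → ¬ Light G x
  tf : TF G
theorem S0.mbr [Finite V] {k : ℕ} {ℬ : Set (Set V)} {M : V → V → Prop} (hc : VC G (2 * k) ℬ) (hm : IsM G M) : MBr G M k Set.univ ℬ := by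
  classical
  refine ⟨hc.br, hc.sub, fun X _ hX => ?_⟩
  set f : V → V := fun u => if h : ∃ v, M u v then h.choose else u
  obtain ⟨B, hB, h⟩ := hc.ord' (X := X ∪ f '' X) (by
    have := Set.ncard_union_le X (f '' X)
    have := Set.ncard_image_le (f := f) (Set.toFinite X)
    omega)
  refine ⟨B, hB, fun v hv => ⟨fun hx => h v hv (Or.inl hx), fun u hu huv => h v hv (Or.inr ⟨u, hu, ?_⟩)⟩⟩
  have he : ∃ v, M u v := ⟨v, huv⟩
  simp only [f, dif_pos he]
  exact hm.uniq he.choose_spec huv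
theorem level2 [Finite V] {k : ℕ} {ℬ : Set (Set V)} (hc : VC G (2 * k) ℬ) (hT : TF G) (hT1 : T1 G) (hk : 4 ≤ k) :
    ∃ (U : Set V) (M : U → U → Prop) (ℬ' : Set (Set U)), L2 (G.induce U) M k ℬ' := by
  classical
  have hk2 : 4 ≤ 2 * k := by omega
  have hm := S0.isM hc hT hT1 hk2
  obtain ⟨U, -, ℬ', hC⟩ := Crit.exists hm (S0.mbr hc hm)
  have lu' : ∀ y : U, (∃ a b, ∀ u ∈ U, G.Adj y u → u = a ∨ u = b) → Light (G.induce U) y := by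
    rintro ⟨y, hy⟩ ⟨a, b, h⟩
    refine ⟨if ha : a ∈ U then ⟨a, ha⟩ else ⟨y, hy⟩, if hb : b ∈ U then ⟨b, hb⟩ else ⟨y, hy⟩, fun ⟨u, hu⟩ hyu => ?_⟩
    rcases h u hu hyu with rfl | rfl
    · grind
    · grind
  have lu : ∀ y : U, Light G y → Light (G.induce U) y := fun y ⟨a, b, h⟩ => lu' y ⟨a, b, fun u _ => h u⟩
  have key : ∀ x y : U, G.Adj x y → (∃ p q, Sp G x y p q) → Light (G.induce U) y := by
    rintro ⟨x, hx⟩ ⟨y, hy⟩ hxy ⟨p, q, h⟩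
    by_cases hyl : Light G y
    · exact lu _ hyl
    change G.Adj x y at hxy
    have hS := F3' hc hT hk2 h hxy hyl
    obtain ⟨B0, hB0, h0⟩ := hC.ord ({x, y, p, q} ∩ U) Set.inter_subset_right ((Set.ncard_le_ncard Set.inter_subset_left (Set.toFinite _)).trans ((nc4 _ _ _ _).trans hk))
    have h0' : ∀ b ∈ B0, b ≠ x ∧ b ≠ y ∧ b ≠ p ∧ b ≠ q := fun b hb => by
      have h1 := (h0 b hb).1
      have hU := hC.sub B0 hB0 hb
      refine ⟨?_, ?_, ?_, ?_⟩ <;> rintro rfl <;> exact h1 ⟨by simp, hU⟩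
    obtain ⟨a, b, hab⟩ := crit_light hC hT (P := {p, q} ∩ U) hx hy hxy Set.inter_subset_right ((clique2 h.1).subset Set.inter_subset_left) (by
        rintro c ⟨rfl | rfl, hc1⟩ c' ⟨rfl | rfl, hc2⟩ <;> simp [hS, hm.symm hS])
      (by simp [h.2.1, h.2.2.1]) (by simp [h.2.2.2.1, h.2.2.2.2.1]) (by
        rintro d hd hdP p' ⟨rfl | rfl, hp'⟩ hdp
        · have := hm.uniq hS (hm.symm hdp); subst this; exact hdP ⟨by simp, hd⟩
        · have := hm.uniq (hm.symm hS) (hm.symm hdp); subst this; exact hdP ⟨by simp, hd⟩) hB0 (fun b hb => by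
        have hb' := h0' b hb
        refine ⟨hb'.1, fun hp => by simp [hb'] at hp, fun hbc => ?_⟩
        have hs : U \ insert x ({p, q} ∩ U) ⊆ ({x, p, q} : Set V)ᶜ := by
          rintro v ⟨hv, hv'⟩ (rfl | hv2)
          · exact hv' (by simp)
          · exact hv' (Or.inr ⟨hv2, hv⟩)
        exact h.out hC.toMBr hk hB0 h0' b hb ⟨hs hbc.1, hbc.2.mono hs⟩)
    refine lu' _ ⟨a, b, hab⟩
  refine ⟨U, fun x y => S0 G x y ∧ ¬ Light (G.induce U) x ∧ ¬ Light (G.induce U) y, _, ⟨fun h => ⟨hm.symm h.1, h.2.2, h.2.1⟩, fun h h' => Subtype.ext (hm.uniq h.1 h'.1), fun h => hm.adj h.1⟩,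
    ⟨hC.induce.br, hC.induce.sub, fun X hX hXc => ?_⟩, fun x y hxy => ?_, fun x y h => h.2.1, fun a b c h1 h2 h3 => hT a b c h1 h2 h3⟩
  · obtain ⟨B, hB, h⟩ := hC.induce.ord X hX hXc
    grind
  · by_contra hcon
    push Not at hcon
    obtain ⟨h1, hx, hy⟩ := hcon
    by_cases hs : S0 G x y
    · exact hy (h1 hs hx)
    · refine hs ⟨hxy, fun h => hx (lu x h), fun h => hy (lu y h), fun p q h => hy (key x y hxy ⟨p, q, h⟩), fun p q h => hx (key y x hxy.symm ⟨p, q, h⟩)⟩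

structure Mod (G : SimpleGraph V) (H : SimpleGraph W) (Y : W → Set V) : Prop where
  conn : ∀ w, Conn G (Y w)
  disj : ∀ {w w' v}, v ∈ Y w → v ∈ Y w' → w = w'
  adj : ∀ w w', H.Adj w w' → ∃ u ∈ Y w, ∃ v ∈ Y w', G.Adj u v
theorem contract [Finite V] {M : V → V → Prop} {k : ℕ} {ℬ : Set (Set V)} {H : SimpleGraph W} (hm : IsM G M) (hb : MBr G M k Set.univ ℬ)
    (hg : ∀ {V' : Type} [Finite V'] (G' : SimpleGraph V') (ℬ' : Set (Set V')), IsBr G' ℬ' → (∀ X : Set V', X.ncard ≤ k → ∃ B ∈ ℬ', Disjoint B X) → Minor G' H) :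
    ∃ Y : W → Set V, Mod G H Y ∧ ∀ w u v, M u v → u ∈ Y w → v ∈ Y w := by
  let S : Setoid V := ⟨fun u v => u = v ∨ M u v, fun _ => Or.inl rfl, fun h => h.imp Eq.symm hm.symm, fun {a b c} h h' => by
    rcases h with rfl | h
    · exact h'
    · rcases h' with rfl | h'
      · exact Or.inr h
      · exact Or.inl (hm.uniq (hm.symm h) h')⟩
  let π : V → Quotient S := Quotient.mk S
  have hπ : ∀ {u v}, π u = π v ↔ u = v ∨ M u v := fun {u v} => Quotient.eq (r := S)
  have : Finite (Quotient S) := Quotient.finite _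
  let Q : SimpleGraph (Quotient S) := ⟨fun a b => a ≠ b ∧ ∃ u v, π u = a ∧ π v = b ∧ G.Adj u v, ⟨fun a b ⟨h, u, v, h1, h2, h3⟩ => ⟨h.symm, v, u, h2, h1, h3.symm⟩⟩, ⟨fun a h => h.1 rfl⟩⟩
  have hQ : ∀ {s : Set V} {a b}, R G s a b → R Q (π '' s) (π a) (π b) := by
    intro s a b h
    refine h.prop (fun b => R Q (π '' s) (π a) (π b)) (fun u v huv hu hv h => ?_) (R.refl _)
    by_cases e : π u = π v
    · rw [← e]; exact h
    · exact h.trans (R.adj ⟨e, u, v, rfl, rfl, huv⟩ ⟨u, hu, rfl⟩ ⟨v, hv, rfl⟩)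
  obtain ⟨X, h1, h2, h3⟩ := hg Q ((π '' ·) '' ℬ) ⟨by
      rintro _ ⟨B, hB, rfl⟩
      obtain ⟨b, hb'⟩ := (hb.br.1 B hB).1
      refine Conn.of_center (a := π b) ⟨b, hb', rfl⟩ ?_
      rintro _ ⟨c, hc, rfl⟩
      exact hQ ((hb.br.1 B hB).2 b hb' c hc), by
      rintro _ ⟨B, hB, rfl⟩ _ ⟨B', hB', rfl⟩
      rcases hb.br.2 B hB B' hB' with ⟨v, hv, hv'⟩ | ⟨u, hu, v, hv, huv⟩
      · exact Or.inl ⟨π v, ⟨v, hv, rfl⟩, ⟨v, hv', rfl⟩⟩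
      · by_cases e : π u = π v
        · exact Or.inl ⟨π u, ⟨u, hu, rfl⟩, ⟨v, hv, e.symm⟩⟩
        · exact Or.inr ⟨π u, ⟨u, hu, rfl⟩, π v, ⟨v, hv, rfl⟩, e, u, v, rfl, rfl, huv⟩⟩ (by
      intro X hX
      obtain ⟨B, hB, h⟩ := hb.ord (Quotient.out '' X) (Set.subset_univ _) ((Set.ncard_image_le (Set.toFinite _)).trans hX)
      refine ⟨_, ⟨B, hB, rfl⟩, Set.disjoint_left.2 ?_⟩
      rintro _ ⟨v, hv, rfl⟩ hX
      have e : π (Quotient.out (π v)) = π v := Quotient.out_eq _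
      rcases hπ.1 e with e | e
      · exact (h v hv).1 ⟨_, hX, e⟩
      · exact (h v hv).2 _ ⟨_, hX, rfl⟩ e)
  have hfib : ∀ {s : Set (Quotient S)} {u v}, π u = π v → π u ∈ s → R G (π ⁻¹' s) u v := by
    intro s u v e hu
    have hv : v ∈ π ⁻¹' s := by rw [Set.mem_preimage, ← e]; exact hu
    rcases hπ.1 e with rfl | h
    · exact R.refl _
    · exact R.adj (hm.adj h) hu hv
  refine ⟨fun w => π ⁻¹' X w, ⟨fun w => ?_, fun {w w' v} hv hv' => ?_, fun w w' h => ?_⟩, fun w u v h hu => ?_⟩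
  · obtain ⟨a, ha⟩ := (h1 w).1
    obtain ⟨a, rfl⟩ := Quotient.exists_rep a
    refine Conn.of_center (a := a) ha fun b hb => ?_
    refine ((h1 w).2 _ ha _ hb).prop (fun c => ∀ b, π b = c → R G (π ⁻¹' X w) a b) ?_ (fun b h => hfib h.symm ha) b rfl
    rintro _ _ ⟨-, u, v, rfl, rfl, huv⟩ hu hv h b hb
    exact ((h u rfl).trans (R.adj huv hu hv)).trans (hfib hb.symm hv)
  · by_contra e
    exact dsj (h2 w w' e) hv hv'
  · obtain ⟨_, hu, _, hv, -, u, v, rfl, rfl, huv⟩ := h3 w w' h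
    exact ⟨u, hu, v, hv, huv⟩
  · change π v ∈ X w
    rw [← hπ.2 (Or.inr h)]; exact hu
/-- exact model: at most one edge between fibres, only along edges of `H` -/
structure EMod (G : SimpleGraph V) (H : SimpleGraph W) (Y : W → Set V) : Prop extends Mod G H Y where
  ex : ∀ {a b u v}, a ≠ b → u ∈ Y a → v ∈ Y b → G.Adj u v → H.Adj a b
  uniq : ∀ {a b u v u' v'}, a ≠ b → u ∈ Y a → v ∈ Y b → G.Adj u v → u' ∈ Y a → v' ∈ Y b → G.Adj u' v' → u' = u ∧ v' = v
theorem exact_model [Finite V] [Finite W] {M : V → V → Prop} {k : ℕ} {ℬ : Set (Set V)} {H : SimpleGraph W} {Y0 : W → Set V} (h : L2 G M k ℬ) (hY : Mod G H Y0)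
    (hM : ∀ w u v, M u v → u ∈ Y0 w → v ∈ Y0 w) (hd : ∀ w, ∃ a b, a ≠ b ∧ H.Adj w a ∧ H.Adj w b) : ∃ Y, EMod G H Y := by
  classical
  obtain ⟨Y, ⟨hY, hM⟩, hmin⟩ := (Set.toFinite {Y : W → Set V | Mod G H Y ∧ ∀ w u v, M u v → u ∈ Y w → v ∈ Y w}).exists_minimal ⟨Y0, hY, hM⟩
  have key : ∀ {a b u v}, a ≠ b → u ∈ Y a → v ∈ Y b → G.Adj u v → Light G v →
      H.Adj a b ∧ ∀ u' ∈ Y a, ∀ v' ∈ Y b, G.Adj u' v' → u' = u ∧ v' = v := by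
    intro a b u v hab hu hv huv ⟨p, q, hpq⟩
    have hvb : ∀ {c z}, z ∈ Y c → G.Adj v z → z ≠ u → ∀ {z'}, G.Adj v z' → z' = u ∨ z' = z := by
      intro c z _ hz hzu z' hz'
      have e1 := hpq u huv.symm; grind
    by_cases hs : ∃ z ∈ Y b, z ≠ v
    · -- `v` is a leaf of its fibre
      obtain ⟨z0, hz0, hz0v⟩ := hs
      obtain ⟨x, z, hvz, -, hz, hx, hzv⟩ := ((hY.conn b).2 v hv z0 hz0).cross (· = v) rfl hz0v
      have hx : x = v := hx
      rw [hx] at hvz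
      have hzu : z ≠ u := fun e => hab (hY.disj hu (e ▸ hz))
      have hnb : ∀ {z'}, G.Adj v z' → z' = u ∨ z' = z := fun h => hvb hz hvz hzu h
      by_contra hcon
      have cl : ∀ w', H.Adj b w' → ∃ v1 ∈ Y b \ {v}, ∃ z1 ∈ Y w', G.Adj v1 z1 := by
        intro w' hbw
        by_cases e : w' = a
        · subst e
          have : ∃ u' ∈ Y w', ∃ v' ∈ Y b, G.Adj u' v' ∧ ¬ (u' = u ∧ v' = v) := by
            by_contra hn
            push Not at hn
            exact hcon ⟨hbw.symm, fun u' hu' v' hv' h => hn u' hu' v' hv' h⟩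
          obtain ⟨u', hu', v', hv', h1, h2⟩ := this
          refine ⟨v', ⟨hv', ?_⟩, u', hu', h1.symm⟩
          rintro rfl
          rcases hnb h1.symm with e | e
          · grind
          · exact hab (hY.disj hu' (e ▸ hz))
        · obtain ⟨v1, hv1, z1, hz1, h1⟩ := hY.adj b w' hbw
          refine ⟨v1, ⟨hv1, ?_⟩, z1, hz1, h1⟩
          rintro rfl
          rcases hnb h1 with e' | e'
          · exact e (hY.disj hz1 (e' ▸ hu))
          · exact hbw.ne (hY.disj hz (e' ▸ hz1))
      have hle : Function.update Y b (Y b \ {v}) ≤ Y := by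
        intro w
        by_cases e : w = b
        · subst e; simp
        · simp [e]
      have hup : ∀ w, w ≠ b → Function.update Y b (Y b \ {v}) w = Y w := fun w hw => Function.update_of_ne hw _ _
      have hub : Function.update Y b (Y b \ {v}) b = Y b \ {v} := Function.update_self ..
      have hY' : Mod G H (Function.update Y b (Y b \ {v})) := by
        refine ⟨fun w => ?_, fun {w w' x} h1 h2 => hY.disj (hle w h1) (hle w' h2), fun w w' hww => ?_⟩
        · by_cases e : w = b
          · rw [e, hub]
            refine ⟨⟨z, hz, hzv⟩, bypass (hY.conn b) subset_rfl ?_⟩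
            have : ∀ c ∈ Y b \ {v}, (∃ d ∈ ({v} : Set V), G.Adj c d) → c = z := by
              rintro c hc ⟨_, rfl, hcv⟩
              exact (hnb hcv.symm).resolve_left fun e => hab (hY.disj hu (e ▸ hc.1))
            intro c hc c' hc' h1 h2
            rw [this c hc h1, this c' hc' h2]; exact R.refl _
          · rw [hup w e]; exact hY.conn w
        · by_cases e : w = b
          · subst e
            rw [hub, hup w' hww.ne']
            exact cl w' hww
          · by_cases e' : w' = b
            · subst e'
              rw [hub, hup w e]
              obtain ⟨v1, h1, z1, h2, h3⟩ := cl w hww.symm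
              exact ⟨z1, h2, v1, h1, h3.symm⟩
            · rw [hup w e, hup w' e']; exact hY.adj w w' hww
      have := hmin (y := Function.update Y b (Y b \ {v})) ⟨hY', fun w x y hxy hx => ?_⟩ hle b hv
      · rw [hub] at this; exact this.2 rfl
      · by_cases e : w = b
        · subst e
          rw [hub] at hx ⊢
          refine ⟨hM _ x y hxy hx.1, ?_⟩
          rintro rfl
          exact h.nl _ _ (h.m.symm hxy) ⟨p, q, hpq⟩
        · rw [hup w e] at hx ⊢; exact hM w x y hxy hx
    · push Not at hs
      obtain ⟨c, d, hcd, hbc, hbd⟩ := hd b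
      have nb : ∀ {c}, H.Adj b c → ∃ z ∈ Y c, G.Adj v z := by
        intro c hc
        obtain ⟨v', hv', z, hz, h⟩ := hY.adj b c hc
        grind
      have main : ∀ {c d}, c ≠ d → H.Adj b c → ∀ zc ∈ Y c, ∀ zd ∈ Y d, G.Adj v zd → u = zc → H.Adj a b ∧ ∀ u' ∈ Y a, ∀ v' ∈ Y b, G.Adj u' v' → u' = u ∧ v' = v := by
        intro c d hcd hbc zc hzc zd hzd hvd e
        have hac : a = c := hY.disj hu (e ▸ hzc)
        subst hac
        refine ⟨hbc.symm, fun u' hu' v' hv' h' => ⟨?_, hs v' hv'⟩⟩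
        rw [hs v' hv'] at h'
        exact (hvb hzd hvd (fun e' => hcd (hY.disj hu (e' ▸ hzd))) h'.symm).resolve_right fun e' => hcd (hY.disj hu' (e' ▸ hzd))
      obtain ⟨zc, hzc, hvc⟩ := nb hbc
      obtain ⟨zd, hzd, hvd⟩ := nb hbd
      by_cases e : u = zc
      · exact main hcd hbc zc hzc zd hzd hvd e
      · refine main (Ne.symm hcd) hbd zd hzd zc hzc hvc ?_
        exact ((hvb hzc hvc (Ne.symm e) hvd).resolve_right fun e' => hcd (hY.disj hzc (e' ▸ hzd))).symm
  have all : ∀ {a b u v}, a ≠ b → u ∈ Y a → v ∈ Y b → G.Adj u v → H.Adj a b ∧ ∀ u' ∈ Y a, ∀ v' ∈ Y b, G.Adj u' v' → u' = u ∧ v' = v := by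
    intro a b u v hab hu hv huv
    rcases h.ed u v huv with h1 | h1 | h1
    · exact absurd (hY.disj (hM a u v h1 hu) hv) hab
    · have := key (Ne.symm hab) hv hu huv.symm h1
      exact ⟨this.1.symm, fun u' hu' v' hv' h' => (this.2 v' hv' u' hu' h'.symm).symm⟩
    · exact key hab hu hv huv h1
  exact ⟨Y, hY, fun h1 h2 h3 h4 => (all h1 h2 h3 h4).1, fun h1 h2 h3 h4 h5 h6 h7 => (all h1 h2 h3 h4).2 _ h5 _ h6 h7⟩

theorem noncut [Finite V] {T : Set V} (hT : Conn G T) {r s : V} (hr : r ∈ T) (hs : s ∈ T) (hsr : s ≠ r) : ∃ w ∈ T, w ≠ r ∧ Conn G (T \ {w}) := by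
  obtain ⟨A, ⟨hA, hAc, hrA, x, hx, hxA⟩, hmax⟩ := (Set.toFinite {A : Set V | A ⊆ T ∧ Conn G A ∧ r ∈ A ∧ ∃ x ∈ T, x ∉ A}).exists_maximal
    ⟨{r}, by simpa using hr, Conn.single r, rfl, s, hs, hsr⟩
  obtain ⟨u, v, huv, hu, hv, huA, hvA⟩ := (hT.2 r hr x hx).cross (· ∈ A) hrA hxA
  have : ∀ y ∈ T, y ∉ A → y = v := by
    intro y hy hyA
    by_contra e
    refine hvA (hmax (y := A ∪ {v}) ⟨Set.union_subset hA (by simpa using hv), hAc.union_adj (Conn.single v) huA rfl huv, Or.inl hrA, y, hy, ?_⟩ Set.subset_union_left (Or.inr rfl))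
    grind
  have e : T \ {v} = A := by
    grind
  grind
theorem leaf3 [Finite V] {T : Set V} {w p q : V} (hT : Conn G T) (htf : ∀ a ∈ T, ∀ b ∈ T, ∀ c ∈ T, G.Adj a b → G.Adj b c → G.Adj a c → False) (hw : w ∈ T)
    (hc : Conn G (T \ {w})) (hp : p ∈ T \ {w}) (hq : q ∈ T \ {w}) (hmin : ∀ Z ⊆ T, Conn G Z → w ∈ Z → p ∈ Z → q ∈ Z → T ⊆ Z) :
    ∃ z ∈ T, G.Adj w z ∧ ∀ z' ∈ T, G.Adj w z' → z' = z := by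
  obtain ⟨A, hA, hAp, hAq, hAT⟩ := exists_IP (hc.2 p hp q hq) hp
  have hpA := mHe hAp
  have hqA := mLa hAq
  have hAc : Conn G {v | v ∈ A} := chain_conn hA.chain (List.ne_nil_of_mem hpA)
  have hwA : w ∉ A := fun h => (hAT w h).2 rfl
  obtain ⟨x, y, hxy, hx, hy, hxA, -⟩ := (hT.2 p hp.1 w hw).cross (· ∈ A) hpA hwA
  obtain ⟨l, w', e, hl, h1, h2, hw', ⟨a, haA, hea⟩, h5, -, h7⟩ := exists_IP_sets (hT.2 w hw y hy) hw (· = w) (fun v => ∃ a ∈ A, G.Adj v a) rfl ⟨x, hxA, hxy.symm⟩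
  have hw' : w' = w := hw'
  subst hw'
  have hTQ := hmin ({v | v ∈ A} ∪ {v | v ∈ l}) (by rintro v (h | h); exact (hAT v h).1; exact h5 v h)
    (hAc.union_adj (chain_conn hl.chain (List.ne_nil_of_mem (mHe h1))) haA (mLa h2) hea.symm) (Or.inr (mHe h1)) (Or.inl hpA) (Or.inl hqA)
  obtain ⟨l', rfl⟩ := List.head?_eq_some_iff.1 h1
  cases l' with
  | cons b l' =>
    refine ⟨b, h5 b (by simp), (hl.1 b (by simp)).2.2 (by simp), fun z hz hwz => ?_⟩
    rcases hTQ hz with h | h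
    · have := h7 w' (by simp) ⟨z, h, hwz⟩
      subst this
      rw [List.getLast?_cons_cons] at h2
      exact absurd rfl (hl.1 _ (mLa h2)).1
    · rcases mCo h with rfl | h
      · exact absurd hwz G.irrefl
      · have := (hl.1 z h).2.1 hwz
        simpa using this.symm
  | nil =>
    simp at h2; subst h2
    obtain ⟨A1, c, A2, rfl, hc, hA1⟩ := split_first (G.Adj w') (l := A) ⟨a, haA, hea⟩
    refine ⟨c, (hAT c (by simp)).1, hc, fun z hz hwz => ?_⟩
    by_contra hzc
    have hzA : z ∈ A1 ++ c :: A2 := by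
      rcases hTQ hz with h | h
      · exact h
      · simp at h; exact absurd h hwz.ne'
    have hz2 : z ∈ A2 := by
      grind
    obtain ⟨A3, d, A4, rfl, hd, hA4⟩ := split_last (G.Adj w') (l := A2) ⟨z, hz2, hwz⟩
    have e : A1 ++ c :: (A3 ++ d :: A4) = (A1 ++ [c]) ++ (A3 ++ d :: A4) := by simp
    rw [e] at hA hAp hAq hAT
    have hA' := IP_append.1 hA
    have hA'' := IP_append.1 hA'.2.1
    have c1 : Conn G {v | v ∈ A1 ++ [c]} := chain_conn hA.left.chain (by simp)
    have c2 : Conn G {v | v ∈ d :: A4} := chain_conn hA'.2.1.right.chain (by simp)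
    have hQ := hmin ({v | v ∈ A1 ++ [c]} ∪ {w'} ∪ {v | v ∈ d :: A4}) (by
        rintro v ((h | rfl) | h)
        · exact (hAT v (List.mem_append_left _ h)).1
        · exact hw
        · exact (hAT v (List.mem_append_right _ (List.mem_append_right _ h))).1)
      ((c1.union_adj (Conn.single w') (a := c) (by simp) rfl hc.symm).union_adj c2 (a := w') (by simp) (b := d) (by simp) hd) (by simp)
      (Or.inl (Or.inl (by
        have hne : A1 ++ [c] ≠ [] := by simp
        rw [List.head?_append_of_ne_nil _ hne] at hAp
        exact mHe hAp)))
      (Or.inr (by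
        rw [← List.append_assoc, getLast?_ac] at hAq
        exact mLa hAq))
    have h3 : A3 = [] := by
      rcases A3 with _ | ⟨f, A3⟩
      · rfl
      · exfalso
        have hf := (hAT f (by simp))
        rcases hQ hf.1 with (h | h) | h
        · exact (hA'.2.2 f h f (by simp)).1 rfl
        · exact hf.2 h
        · exact (hA''.2.2 f (by simp) f h).1 rfl
    subst h3
    exact htf w' hw c (hAT c (by simp)).1 d (hAT d (by simp)).1 hc ((hA'.2.2 c (by simp) d (by simp)).2.2 (by simp)) hd
theorem leaf [Finite V] {T : Set V} {S : Set W} {P : W → V} (hT : Conn G T) (htf : ∀ a ∈ T, ∀ b ∈ T, ∀ c ∈ T, G.Adj a b → G.Adj b c → G.Adj a c → False)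
    (hS : ∃ c1 c2 c3, ∀ c ∈ S, c = c1 ∨ c = c2 ∨ c = c3) (hP : ∀ c ∈ S, P c ∈ T) (hmin : ∀ Z ⊆ T, Conn G Z → (∀ c ∈ S, P c ∈ Z) → T ⊆ Z) {x y : V} (hx : x ∈ T) (hy : y ∈ T) (hxy : x ≠ y) :
    ∃ w ∈ T, Conn G (T \ {w}) ∧ ∃ c ∈ S, P c = w ∧ (∀ c' ∈ S, P c' = w → c' = c) ∧ ∃ z ∈ T, G.Adj w z ∧ ∀ z' ∈ T, G.Adj w z' → z' = z := by
  classical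
  obtain ⟨c1, c2, c3, hS⟩ := hS
  have port : ∀ w ∈ T, Conn G (T \ {w}) → ∃ c ∈ S, P c = w := by
    intro w hw hc
    by_contra hcon
    push Not at hcon
    exact (hmin (T \ {w}) Set.sdiff_subset hc (fun c hc => ⟨hP c hc, hcon c hc⟩) hw).2 rfl
  obtain ⟨w, hw, hc, c, hcS, hcw, hcu⟩ : ∃ w ∈ T, Conn G (T \ {w}) ∧ ∃ c ∈ S, P c = w ∧ ∀ c' ∈ S, P c' = w → c' = c := by
    obtain ⟨w1, hw1, -, h1⟩ := noncut hT hx hy hxy.symm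
    obtain ⟨y', hy', hy1⟩ : ∃ y' ∈ T, y' ≠ w1 := by
      grind
    obtain ⟨w2, hw2, h12, h2⟩ := noncut hT hw1 hy' hy1
    obtain ⟨d1, hd1, e1⟩ := port w1 hw1 h1
    obtain ⟨d2, hd2, e2⟩ := port w2 hw2 h2
    by_contra hcon
    push Not at hcon
    obtain ⟨f1, hf1, g1, n1⟩ := hcon w1 hw1 h1 d1 hd1 e1
    obtain ⟨f2, hf2, g2, n2⟩ := hcon w2 hw2 h2 d2 hd2 e2
    grind
  refine ⟨w, hw, hc, c, hcS, hcw, hcu, ?_⟩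
  obtain ⟨r, hr⟩ := hc.1
  let g : W → V := fun d => if d ∈ S ∧ d ≠ c then P d else r
  have hg : ∀ d, g d ∈ T \ {w} := by
    intro d
    by_cases h : d ∈ S ∧ d ≠ c
    · simp only [g, if_pos h]; exact ⟨hP d h.1, fun e => h.2 (hcu d h.1 e)⟩
    · simp only [g, if_neg h]; exact hr
  have hg' : ∀ d ∈ S, d ≠ c → P d = g d := fun d h1 h2 => by grind
  obtain ⟨d1, d2, hd⟩ : ∃ d1 d2, ∀ d ∈ S, d ≠ c → d = d1 ∨ d = d2 := by
    rcases hS c hcS with rfl | rfl | rfl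
    · exact ⟨c2, c3, fun d h1 h2 => (hS d h1).resolve_left h2⟩
    · exact ⟨c1, c3, fun d h1 h2 => by have := hS d h1; tauto⟩
    · exact ⟨c1, c2, fun d h1 h2 => by have := hS d h1; tauto⟩
  refine leaf3 hT htf hw hc (hg d1) (hg d2) fun Z hZ hZc hwZ h1 h2 => hmin Z hZ hZc fun d hdS => ?_
  by_cases e : d = c
  · rw [e, hcw]; exact hwZ
  · rw [hg' d hdS e]
    rcases hd d hdS e with rfl | rfl <;> assumption

theorem sub_some {u v x y : V} : (subdivideEdge G u v).Adj (some x) (some y) ↔ G.Adj x y ∧ ¬(x = u ∧ y = v) ∧ ¬(x = v ∧ y = u) := by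
  simp only [subdivideEdge, SimpleGraph.fromRel_adj, ne_eq, Option.some.injEq]
  constructor
  · rintro ⟨-, (⟨p, q, rfl, rfl, h⟩ | ⟨h, -⟩) | (⟨p, q, rfl, rfl, h, h1, h2⟩ | ⟨h, -⟩)⟩
    · exact h
    · cases h
    · exact ⟨h.symm, fun h' => h2 ⟨h'.2, h'.1⟩, fun h' => h1 ⟨h'.2, h'.1⟩⟩
    · cases h
  · intro h
    exact ⟨h.1.ne, Or.inl (Or.inl ⟨x, y, rfl, rfl, h⟩)⟩
theorem sub_none {u v x : V} : (subdivideEdge G u v).Adj none (some x) ↔ x = u ∨ x = v := by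
  simp [subdivideEdge, SimpleGraph.fromRel_adj]
theorem sub_congr {H : SimpleGraph W} (e : G ≃g H) (a z : V) : Nonempty (subdivideEdge G a z ≃g subdivideEdge H (e a) (e z)) := by
  refine ⟨⟨Equiv.optionCongr e.toEquiv, ?_⟩⟩
  rintro (_ | x) (_ | y)
  · simp
  · simp [sub_none]
  · rw [SimpleGraph.adj_comm, SimpleGraph.adj_comm _ (some x)]
    simp [sub_none]
  · simp only [Equiv.optionCongr_apply, Option.map_some, sub_some]
    have := e.map_adj_iff (v := x) (w := y)
    simp [this]
theorem sub_out {α : Type} {K' : SimpleGraph α} {β : Type} {H : SimpleGraph β} (h : IsSubdivision K' H) : ∀ {a z : α}, K'.Adj a z → ∀ {γ : Type} (K : SimpleGraph γ),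
    Nonempty (K ≃g subdivideEdge K' a z) → IsSubdivision K H := by
  induction h with
  | base h =>
    intro a z haz γ K ⟨f⟩
    obtain ⟨e⟩ := h
    obtain ⟨g⟩ := sub_congr e a z
    exact IsSubdivision.step (e a) (e z) (e.map_rel_iff.2 haz) (IsSubdivision.base ⟨f.trans g⟩)
  | step u v huv _ ih =>
    intro a z haz γ K hK
    exact IsSubdivision.step u v huv (ih haz K hK)
theorem Conn.change {K : SimpleGraph V} {s : Set V} (h : Conn G s) (hh : ∀ u ∈ s, ∀ v ∈ s, G.Adj u v → K.Adj u v) : Conn K s := by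
  refine ⟨h.1, fun a ha b hb => ?_⟩
  have := h.2 a ha b hb
  clear hb
  induction this with
  | refl => exact R.refl _
  | tail _ h ih => exact ih.trans (R.adj (hh _ h.2.1 _ h.2.2 h.1) h.2.1 h.2.2)
def MinM (K : SimpleGraph V) (H : SimpleGraph W) (Y : W → Set V) : Prop :=
  ∀ b Z, Z ⊆ Y b → Conn K Z → (∀ c, H.Adj b c → ∃ v ∈ Z, ∃ u ∈ Y c, K.Adj v u) → Y b ⊆ Z
set_option maxHeartbeats 1000000 in
theorem subdiv_main [Finite V] {H : SimpleGraph W} (hdeg : ∀ b, ∃ c1 c2 c3, ∀ c, H.Adj b c → c = c1 ∨ c = c2 ∨ c = c3) (n : ℕ) : ∀ (K : SimpleGraph V) (Y : W → Set V),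
    EMod K H Y → MinM K H Y → (∀ d, ∀ a ∈ Y d, ∀ b ∈ Y d, ∀ c ∈ Y d, K.Adj a b → K.Adj b c → K.Adj a c → False) →
    {v | ∃ w, v ∈ Y w}.ncard ≤ n → IsSubdivision (K.induce {v | ∃ w, v ∈ Y w}) H := by
  classical
  induction n using Nat.strong_induction_on with
  | _ n ih =>
  intro K Y hY hmin htf hn
  by_cases hss : ∀ d, ∀ x ∈ Y d, ∀ y ∈ Y d, x = y
  · choose f hf using fun d => (hY.conn d).1
    refine IsSubdivision.base ⟨SimpleGraph.Iso.symm ⟨Equiv.ofBijective (fun d => ⟨f d, d, hf d⟩) ⟨?_, ?_⟩, ?_⟩⟩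
    · intro d e h
      have h : f d = f e := congrArg Subtype.val h
      exact hY.disj (hf d) (h ▸ hf e)
    · rintro ⟨v, d, hd⟩
      grind
    · intro d e
      simp only [Equiv.ofBijective_apply, SimpleGraph.comap_adj, Function.Embedding.subtype_apply]
      constructor
      · intro h
        refine hY.ex ?_ (hf d) (hf e) h
        rintro rfl
        exact h.ne rfl
      · intro h
        obtain ⟨u, hu, v, hv, huv⟩ := hY.adj _ _ h
        grind
  push Not at hss
  obtain ⟨b, x, hx, y, hy, hxy⟩ := hss
  have hP : ∀ c, ∃ p, H.Adj b c → p ∈ Y b ∧ ∃ u ∈ Y c, K.Adj p u := by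
    intro c
    by_cases h : H.Adj b c
    · obtain ⟨u, hu, v, hv, huv⟩ := hY.adj _ _ h
      exact ⟨u, fun _ => ⟨hu, v, hv, huv⟩⟩
    · grind
  choose P hP using hP
  obtain ⟨w, hw, hwc, c, hbc, hPc, hPu, z, hz, hwz, hzu⟩ := leaf (S := {c | H.Adj b c}) (P := P) (hY.conn b) (htf b) (hdeg b) (fun c hc => (hP c hc).1)
    (fun Z hZ hZc hZP => hmin b Z hZ hZc (fun c hc => ⟨P c, hZP c hc, (hP c hc).2⟩)) hx hy hxy
  obtain ⟨-, a, ha, hwa⟩ := hP c hbc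
  rw [hPc] at hwa
  have hbc : H.Adj b c := hbc
  have hbcn : b ≠ c := hbc.ne
  have hN : ∀ d u, u ∈ Y d → K.Adj w u → (d = b ∧ u = z) ∨ (d = c ∧ u = a) := by
    intro d u hu hwu
    by_cases hd : d = b
    · subst hd
      exact Or.inl ⟨rfl, hzu u hu hwu⟩
    · have h := hY.ex (Ne.symm hd) hw hu hwu
      obtain ⟨h1, u', hu', h2⟩ := hP d h
      have h3 := hY.uniq (Ne.symm hd) hw hu hwu h1 hu' h2
      have := hPu d h h3.1
      subst this
      exact Or.inr ⟨rfl, (hY.uniq hbcn hw ha hwa hw hu hwu).2⟩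
  have hzw : z ≠ w := hwz.ne'
  have haw : a ≠ w := hwa.ne'
  have hza : ¬ K.Adj z a := fun h => hzw (hY.uniq hbcn hw ha hwa hz ha h).1
  have hzan : z ≠ a := fun h => hbcn (hY.disj hz (h ▸ ha))
  let K' : SimpleGraph V := ⟨fun u v => (K.Adj u v ∧ u ≠ w ∧ v ≠ w) ∨ (u = z ∧ v = a) ∨ (u = a ∧ v = z), ⟨fun u v h => by
    rcases h with h | h | h
    · exact Or.inl ⟨h.1.symm, h.2.2, h.2.1⟩
    · grind
    · grind⟩, ⟨fun u h => by
    rcases h with h | h | h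
    · exact h.1.ne rfl
    · exact hzan (h.1.symm.trans h.2)
    · grind⟩⟩
  have K'd : ∀ u v, K'.Adj u v ↔ (K.Adj u v ∧ u ≠ w ∧ v ≠ w) ∨ (u = z ∧ v = a) ∨ (u = a ∧ v = z) := fun _ _ => Iff.rfl
  clear_value K'
  have hin : ∀ d u v, u ∈ Y d → v ∈ Y d → K'.Adj u v → K.Adj u v := by
    grind
  let Y' : W → Set V := fun d => Y d \ {w}
  have Y'm : ∀ d v, v ∈ Y' d ↔ v ∈ Y d ∧ v ≠ w := fun _ _ => Iff.rfl
  have hwn : ∀ d, d ≠ b → w ∉ Y d := fun d hd h => hd (hY.disj h hw)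
  have hcross : ∀ {d e u v}, d ≠ e → u ∈ Y' d → v ∈ Y' e → K'.Adj u v →
      (K.Adj u v) ∨ (d = b ∧ e = c ∧ u = z ∧ v = a) ∨ (d = c ∧ e = b ∧ u = a ∧ v = z) := by
    grind
  have hnoK : ∀ {u v}, u ∈ Y' b → v ∈ Y' c → ¬ K.Adj u v := fun hu hv h =>
    hu.2 (hY.uniq hbcn hw ha hwa hu.1 hv.1 h).1
  have hY' : EMod K' H Y' := by
    refine ⟨⟨?_, ?_, ?_⟩, ?_, ?_⟩
    · intro d
      have : Conn K (Y' d) := by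
        by_cases hd : d = b
        · subst hd
          exact hwc
        · have : Y' d = Y d := Set.sdiff_singleton_eq_self (hwn d hd)
          rw [this]
          exact hY.conn d
      exact this.change (fun u hu v hv h => (K'd _ _).2 (Or.inl ⟨h, hu.2, hv.2⟩))
    · intro d e v h h'
      exact hY.disj h.1 h'.1
    · intro d e hde
      obtain ⟨u, hu, v, hv, huv⟩ := hY.adj d e hde
      by_cases huw : u = w
      · subst huw
        have hd := hY.disj hu hw
        subst hd
        rcases hN e v hv huv with ⟨rfl, -⟩ | ⟨rfl, rfl⟩
        · exact absurd rfl hde.ne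
        · exact ⟨z, ⟨hz, hzw⟩, v, ⟨ha, haw⟩, (K'd _ _).2 (Or.inr (Or.inl ⟨rfl, rfl⟩))⟩
      by_cases hvw : v = w
      · subst hvw
        have hd := hY.disj hv hw
        subst hd
        rcases hN d u hu huv.symm with ⟨rfl, -⟩ | ⟨rfl, rfl⟩
        · exact absurd rfl hde.ne
        · exact ⟨u, ⟨ha, haw⟩, z, ⟨hz, hzw⟩, (K'd _ _).2 (Or.inr (Or.inr ⟨rfl, rfl⟩))⟩
      exact ⟨u, ⟨hu, huw⟩, v, ⟨hv, hvw⟩, (K'd _ _).2 (Or.inl ⟨huv, huw, hvw⟩)⟩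
    · intro d e u v hde hu hv h
      rcases hcross hde hu hv h with h | ⟨rfl, rfl, -⟩ | ⟨rfl, rfl, -⟩
      · exact hY.ex hde hu.1 hv.1 h
      · exact hbc
      · exact hbc.symm
    · intro d e u v u' v' hde hu hv h hu' hv' h'
      rcases hcross hde hu hv h with h | ⟨rfl, rfl, rfl, rfl⟩ | ⟨rfl, rfl, rfl, rfl⟩ <;>
      rcases hcross hde hu' hv' h' with h' | ⟨h1, h2, h3, h4⟩ | ⟨h1, h2, h3, h4⟩
      · exact hY.uniq hde hu.1 hv.1 h hu'.1 hv'.1 h'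
      · subst h1 h2
        exact absurd h (hnoK hu hv)
      · subst h1 h2
        exact absurd h.symm (hnoK hv hu)
      · exact absurd h' (hnoK hu' hv')
      · exact ⟨h3, h4⟩
      · exact absurd h1 hbcn
      · exact absurd h'.symm (hnoK hv' hu')
      · exact absurd h1.symm hbcn
      · exact ⟨h3, h4⟩
  have hmin' : MinM K' H Y' := by
    intro d Z hZ hZc hZp
    have hZK : Conn K Z := hZc.change (fun u hu v hv h => hin d u v (hZ hu).1 (hZ hv).1 h)
    by_cases hd : d = b
    · subst hd
      have hzZ : z ∈ Z := by
        obtain ⟨v, hv, u, hu, h⟩ := hZp c hbc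
        rcases hcross hbcn (hZ hv) hu h with h | ⟨-, -, rfl, -⟩ | ⟨h, -⟩
        · exact absurd h (hnoK (hZ hv) hu)
        · exact hv
        · exact absurd h hbcn
      have := hmin d (Z ∪ {w}) (Set.union_subset (fun v hv => (hZ hv).1) (by simpa using hw)) (hZK.union_adj (Conn.single w) hzZ rfl hwz.symm) (by
        intro e he
        obtain ⟨v, hv, u, hu, h⟩ := hZp e he
        rcases hcross he.ne (hZ hv) hu h with h | ⟨-, rfl, -⟩ | ⟨h, -⟩
        · exact ⟨v, Or.inl hv, u, hu.1, h⟩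
        · exact ⟨w, Or.inr rfl, a, ha, hwa⟩
        · exact absurd h hbcn)
      intro v hv
      rcases this hv.1 with h | h
      · exact h
      · exact absurd h hv.2
    · refine fun v hv => hmin d Z (fun v hv => (hZ hv).1) hZK ?_ hv.1
      intro e he
      obtain ⟨v, hv, u, hu, h⟩ := hZp e he
      rcases hcross he.ne (hZ hv) hu h with h | ⟨h, -⟩ | ⟨-, rfl, rfl, -⟩
      · exact ⟨v, hv, u, hu.1, h⟩
      · exact absurd h hd
      · exact ⟨v, hv, w, hw, hwa.symm⟩
  have hss' : {v | ∃ d, v ∈ Y' d} ⊂ {v | ∃ d, v ∈ Y d} := by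
    refine (Set.ssubset_iff_of_subset ?_).2 ⟨w, ⟨b, hw⟩, ?_⟩
    · rintro v ⟨d, hd⟩
      exact ⟨d, hd.1⟩
    · rintro ⟨d, hd⟩
      exact hd.2 rfl
  have hsub := ih _ (lt_of_lt_of_le (Set.ncard_lt_ncard hss' (Set.toFinite _)) hn) K' Y' hY' hmin'
    (fun d p hp q hq r hr h1 h2 h3 => htf d p hp.1 q hq.1 r hr.1 (hin d _ _ hp.1 hq.1 h1) (hin d _ _ hq.1 hr.1 h2) (hin d _ _ hp.1 hr.1 h3)) le_rfl
  let a' : {v | ∃ d, v ∈ Y' d} := ⟨a, c, ha, haw⟩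
  let z' : {v | ∃ d, v ∈ Y' d} := ⟨z, b, hz, hzw⟩
  refine sub_out hsub (a := a') (z := z') ((K'd _ _).2 (Or.inr (Or.inr ⟨rfl, rfl⟩))) _ ⟨SimpleGraph.Iso.symm
    ⟨Equiv.ofBijective (fun o => Option.elim o ⟨w, b, hw⟩ (fun v => ⟨v.1, hss'.1 v.2⟩)) ⟨?_, ?_⟩, ?_⟩⟩
  · rintro (_ | ⟨p, d, hp⟩) (_ | ⟨q, e, hq⟩) h
    · rfl
    · exact absurd (congrArg Subtype.val h).symm hq.2
    · exact absurd (congrArg Subtype.val h) hp.2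
    · have h : p = q := congrArg Subtype.val h
      subst h; rfl
  · rintro ⟨v, d, hv⟩
    by_cases h : v = w
    · subst h
      exact ⟨none, rfl⟩
    · exact ⟨some ⟨v, d, hv, h⟩, rfl⟩
  · have h1 : ∀ p : {v | ∃ d, v ∈ Y' d}, K.Adj w p ↔ p = a' ∨ p = z' := by
      rintro ⟨p, d, hp⟩
      constructor
      · intro h
        rcases hN d p hp.1 h with ⟨-, h⟩ | ⟨-, h⟩
        · exact Or.inr (Subtype.ext h)
        · exact Or.inl (Subtype.ext h)
      · rintro (h | h)
        · have h : p = a := congrArg Subtype.val h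
          change K.Adj w p; rw [h]; exact hwa
        · have h : p = z := congrArg Subtype.val h
          change K.Adj w p; rw [h]; exact hwz
    rintro (_ | p) (_ | q)
    · simp
    · rw [sub_none]
      exact h1 q
    · rw [SimpleGraph.adj_comm, SimpleGraph.adj_comm _ (some p), sub_none]
      exact h1 p
    · rw [sub_some]
      change K.Adj p.1 q.1 ↔ K'.Adj p.1 q.1 ∧ _
      have hp : p.1 ≠ w := by obtain ⟨p, d, hp⟩ := p; exact hp.2
      have hq : q.1 ≠ w := by obtain ⟨q, d, hq⟩ := q; exact hq.2
      rw [K'd, Subtype.ext_iff, Subtype.ext_iff, Subtype.ext_iff, Subtype.ext_iff]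
      change _ ↔ _ ∧ ¬ (p.1 = a ∧ q.1 = z) ∧ ¬ (p.1 = z ∧ q.1 = a)
      constructor
      · intro h
        refine ⟨Or.inl ⟨h, hp, hq⟩, ?_, ?_⟩
        · rintro ⟨h1, h2⟩
          exact hza (h1 ▸ h2 ▸ h.symm)
        · rintro ⟨h1, h2⟩
          exact hza (h1 ▸ h2 ▸ h)
      · rintro ⟨h | h | h, h2, h3⟩
        · exact h.1
        · exact absurd h h3
        · exact absurd h h2
theorem subdiv [Finite V] [Finite W] {H : SimpleGraph W} {Y0 : W → Set V} (hdeg : ∀ b, ∃ c1 c2 c3, ∀ c, H.Adj b c → c = c1 ∨ c = c2 ∨ c = c3) (hY : EMod G H Y0)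
    (htf : TF G) : ∃ s : Set V, IsSubdivision (G.induce s) H := by
  classical
  obtain ⟨Y, hY, hmin⟩ := (Set.toFinite {Y : W → Set V | EMod G H Y}).exists_minimal ⟨Y0, hY⟩
  have hY : EMod G H Y := hY
  refine ⟨_, subdiv_main hdeg _ G Y hY ?_ (fun d a _ b _ c _ => htf a b c) le_rfl⟩
  intro b Z hZ hZc hZp
  have hsub : ∀ d, Function.update Y b Z d ⊆ Y d := by
    grind
  have := hmin (y := Function.update Y b Z) ⟨⟨?_, fun h h' => hY.disj (hsub _ h) (hsub _ h'), ?_⟩, fun h h1 h2 => hY.ex h (hsub _ h1) (hsub _ h2),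
    fun h h1 h2 h3 h4 h5 h6 => hY.uniq h (hsub _ h1) (hsub _ h2) h3 (hsub _ h4) (hsub _ h5) h6⟩ hsub b
  · grind
  · intro d
    by_cases hd : d = b
    · grind
    · rw [Function.update_of_ne hd]; exact hY.conn d
  · intro d e hde
    by_cases hd : d = b
    · subst hd
      rw [Function.update_self, Function.update_of_ne hde.ne']
      exact hZp e hde
    · by_cases he : e = b
      · subst he
        rw [Function.update_self, Function.update_of_ne hd]
        obtain ⟨v, hv, u, hu, h⟩ := hZp d hde.symm
        exact ⟨u, hu, v, hv, h.symm⟩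
      · rw [Function.update_of_ne hd, Function.update_of_ne he]
        exact hY.adj d e hde

theorem brick_two {t : ℕ} (w : Fin (2*t) × Fin (4*t+1)) : ∃ a b, a ≠ b ∧ (Brick (2*t) (4*t+1)).Adj w a ∧ (Brick (2*t) (4*t+1)).Adj w b := by
  obtain ⟨⟨i, hi⟩, ⟨j, hj⟩⟩ := w
  simp only [Brick, SimpleGraph.fromRel_adj, BrickRel]
  by_cases h0 : j = 0
  · refine ⟨(⟨i, hi⟩, ⟨j+1, by omega⟩), (⟨if i % 2 = 0 then i+1 else i-1, by split <;> omega⟩, ⟨j, hj⟩), ?_, ?_, ?_⟩ <;> grind <;> grind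
  by_cases h1 : j = 4*t
  · refine ⟨(⟨i, hi⟩, ⟨j-1, by omega⟩), (⟨if i % 2 = 0 then i+1 else i-1, by split <;> omega⟩, ⟨j, hj⟩), ?_, ?_, ?_⟩ <;> grind <;> grind
  · refine ⟨(⟨i, hi⟩, ⟨j-1, by omega⟩), (⟨i, hi⟩, ⟨j+1, by omega⟩), ?_, ?_, ?_⟩ <;> grind <;> grind
def wb (t : ℕ) (a : Fin t × Fin (2*t)) : Fin (2*t) × Fin (4*t+1) := (⟨a.1.1, by omega⟩, ⟨a.2.1, by omega⟩)
theorem wb_inj {t : ℕ} {a b : Fin t × Fin (2*t)} (h : wb t a = wb t b) : a = b := by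
  simp only [wb, Prod.ext_iff, Fin.ext_iff] at h
  grind
theorem wb_adj {t : ℕ} {a b : Fin t × Fin (2*t)} : (Brick (2*t) (4*t+1)).Adj (wb t a) (wb t b) ↔ (Wall t).Adj a b := by
  simp [Brick, Wall, BrickRel, wb, SimpleGraph.fromRel_adj, Prod.ext_iff, Fin.ext_iff]
theorem wall_mod {t : ℕ} {Y : Fin (2*t) × Fin (4*t+1) → Set V} (h : EMod G (Brick (2*t) (4*t+1)) Y) : EMod G (Wall t) (fun a => Y (wb t a)) :=
  ⟨⟨fun _ => h.conn _, fun h1 h2 => wb_inj (h.disj h1 h2), fun _ _ h1 => h.adj _ _ (wb_adj.2 h1)⟩,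
    fun h1 h2 h3 h4 => wb_adj.1 (h.ex (fun e => h1 (wb_inj e)) h2 h3 h4), fun h1 => h.uniq (fun e => h1 (wb_inj e))⟩
theorem wall_deg {t : ℕ} (b : Fin t × Fin (2*t)) : ∃ c1 c2 c3, ∀ c, (Wall t).Adj b c → c = c1 ∨ c = c2 ∨ c = c3 := by
  classical
  have ht := b.1.2
  let f : ℕ → ℕ → Fin t × Fin (2*t) := fun i j => (⟨min i (t-1), by omega⟩, ⟨min j (2*t-1), by omega⟩)
  refine ⟨f b.1 (b.2 + 1), f b.1 (b.2 - 1), f (if (b.1.1 + b.2.1) % 2 = 0 then b.1 + 1 else b.1 - 1) b.2, fun c hc => ?_⟩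
  obtain ⟨⟨i, hi⟩, ⟨j, hj⟩⟩ := b
  obtain ⟨⟨i', hi'⟩, ⟨j', hj'⟩⟩ := c
  simp only [Wall, SimpleGraph.fromRel_adj, Prod.ext_iff, Fin.ext_iff, f] at hc ⊢
  grind

theorem ci_of_emb {S : SimpleGraph W} (e : S ↪g G) : ContainsInduced G S :=
  ⟨Set.range e, ⟨⟨Equiv.ofInjective e e.injective, by intro a b; exact e.map_rel_iff⟩⟩⟩
theorem statement3' (t : ℕ) (ht : 0 < t) :
    ∃ c : ℕ, ∀ (V : Type) [Fintype V] (G : SimpleGraph V),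
      MemF t G → ¬HasTreewidthAtMost G c → ContainsWallSubdiv G t := by
  obtain ⟨k0, hk0⟩ := grid_thm (2*t) (4*t+1) (by omega)
  obtain ⟨k, h1, h2, h3⟩ : ∃ k, k0 ≤ k ∧ t ≤ k ∧ 4 ≤ k := ⟨k0 + t + 4, by omega, by omega, by omega⟩
  refine ⟨4 * (2 * k), fun V _ G ⟨⟨hs1, hs2, hs3⟩, hcl⟩ htw => ?_⟩
  obtain ⟨ℬ, hB, ho⟩ := tw_bramble (by omega) htw
  have hm : IsM G (fun _ _ => False) := ⟨fun h => h.elim, fun h => h.elim, fun h => h.elim⟩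
  have hmb : MBr G (fun _ _ => False) (2 * k) Set.univ ℬ := ⟨hB, fun _ _ => Set.subset_univ _, fun X _ hX => by
    obtain ⟨B, hB, hd⟩ := ho X hX
    exact ⟨B, hB, fun v hv => ⟨fun hvX => dsj hd hv hvX, fun _ _ h => h⟩⟩⟩
  obtain ⟨U, -, ℬ', hc⟩ := Crit.exists hm hmb
  have hvc : VC (G.induce U) (2 * k) _ := hc.induce
  have hvs : VSL (G.induce U) := VSL.induce ⟨spL_of hs1, noPyr_of hs2, noPri_of hs3⟩ U
  have htf : TF (G.induce U) := tri_free hvc hvs (fun s hs => by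
    have h := hcl (Subtype.val '' s) (by
      rintro _ ⟨a, ha, rfl⟩ _ ⟨b, hb, rfl⟩ hab
      exact hs ha hb (fun e => hab (congrArg _ e)))
    rw [Set.ncard_image_of_injective _ Subtype.val_injective] at h
    omega)
  obtain ⟨U2, M, ℬ2, hL⟩ := level2 hvc htf (t1_of hvs.1 htf) h3
  obtain ⟨Y, hY, hYM⟩ := contract hL.m hL.mb (fun G' ℬ' h h' => hk0 G' ℬ' h (fun X hX => h' X (hX.trans h1)))
  obtain ⟨Y2, hY2⟩ := exact_model hL hY hYM brick_two
  obtain ⟨s, hs⟩ := subdiv wall_deg (wall_mod hY2) hL.tf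
  exact ⟨_, _, hs, ci_of_emb (((SimpleGraph.Embedding.induce s).trans (SimpleGraph.Embedding.induce U2)).trans (SimpleGraph.Embedding.induce U))⟩
end Paper

namespace Paper

/-- every graph in `𝓕_t` of big enough treewidth contains a subdivision of
the `t`-by-`t` wall as an induced subgraph. -/
theorem statement3 (t : ℕ) (ht : 0 < t) :
    ∃ c : ℕ, ∀ (V : Type) [Fintype V] (G : SimpleGraph V),
      MemF t G → ¬HasTreewidthAtMost G c → ContainsWallSubdiv G t :=
  statement3' t ht

end Paper
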